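/- Let n ≥ 2, let v : (0,∞) → [0,∞) be measurable with v(r) ≤ n ω_n r^{n-1} for H^1-a.e. r such that F_v is a set of finite perimeter and finite volume, and let I ⊂ (0,∞) be open. Then the following are equivalent: (i) H^{n-1}({x ∈ ∂*F_v ∩ Φ(I × S^{n-1}) : ν_∥^{F_v}(x) = 0}) = 0; (ii) ξ_v ∈ W^{1,1}_loc(I); (iii) P(F_v; Φ(B × S^{n-1})) = 0 for every Borel set B ⊂ I with H¹(B) = 0. -/

import Mathlib

/- Common definitions: geometric measure theory notions (density points, essential
boundary, perimeter, reduced boundary and measure-theoretic outer unit normal),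
spherical and circular symmetrisation, BV and Sobolev-type notions. -/

open MeasureTheory Metric Set Filter
open scoped ENNReal NNReal Topology RealInnerProductSpace

noncomputable section

/-- Euclidean space `ℝⁿ`. -/
abbrev Euc (n : ℕ) : Type := EuclideanSpace ℝ (Fin n)

/-- `ω_k`: the volume of the unit ball of `ℝ^k`. -/
def omegaBall (k : ℕ) : ℝ := (volume (ball (0 : Euc k) 1)).toReal

/-- The radial unit vector `x̂ = x/|x|`. -/
def hatv {n : ℕ} (x : Euc n) : Euc n := ‖x‖⁻¹ • x

/-- The first vector of the canonical basis. -/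
def e1 (n : ℕ) (hn : 0 < n) : Euc n := EuclideanSpace.single ⟨0, hn⟩ 1

/-- `E` has `n`-dimensional density `t` at `x`. -/
def DensityAt {n : ℕ} (E : Set (Euc n)) (x : Euc n) (t : ℝ≥0∞) : Prop :=
  Tendsto (fun ρ : ℝ => volume (E ∩ ball x ρ) / volume (ball x ρ)) (𝓝[>] (0:ℝ)) (𝓝 t)

/-- The essential boundary `∂ᵉE`: points of density neither `0` nor `1`. -/
def essBoundary {n : ℕ} (E : Set (Euc n)) : Set (Euc n) :=
  {x | ¬ DensityAt E x 0 ∧ ¬ DensityAt E x 1}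

/-- The perimeter of `E` relative to `A`: `P(E;A) = H^{n-1}(∂ᵉE ∩ A)`. -/
def perim {n : ℕ} (E A : Set (Euc n)) : ℝ≥0∞ := μH[(n : ℝ) - 1] (essBoundary E ∩ A)

/-- `ν` is the measure-theoretic outer unit normal of `E` at `x`: the blow-up of `E`
at `x` is the half space `{y : (y-x)·ν ≤ 0}` in density. -/
def HasMTNormal {n : ℕ} (E : Set (Euc n)) (x ν : Euc n) : Prop :=
  ‖ν‖ = 1 ∧
    Tendsto (fun ρ : ℝ =>
        volume ({y | y ∈ E ∧ 0 < ⟪y - x, ν⟫} ∩ ball x ρ) / volume (ball x ρ))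
      (𝓝[>] (0:ℝ)) (𝓝 0) ∧
    Tendsto (fun ρ : ℝ =>
        volume ({y | y ∉ E ∧ ⟪y - x, ν⟫ < 0} ∩ ball x ρ) / volume (ball x ρ))
      (𝓝[>] (0:ℝ)) (𝓝 0)

/-- The reduced boundary `∂*E`. -/
def redBoundary {n : ℕ} (E : Set (Euc n)) : Set (Euc n) := {x | ∃ ν, HasMTNormal E x ν}

/-- The measure-theoretic outer unit normal `ν^E`. -/
def mtNormal {n : ℕ} (E : Set (Euc n)) (x : Euc n) : Euc n :=
  haveI := Classical.propDecidable (∃ ν, HasMTNormal E x ν)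
  if h : ∃ ν, HasMTNormal E x ν then h.choose else 0

/-- The tangential component `ν∥^E(x) = ν^E(x) - (ν^E(x)·x̂)x̂` of the normal along
the sphere `∂B(|x|)`. -/
def nuPar {n : ℕ} (E : Set (Euc n)) (x : Euc n) : Euc n :=
  mtNormal E x - ⟪mtNormal E x, hatv x⟫ • hatv x

/-- The open geodesic ball (spherical cap) `B_β(r p)` in the sphere `∂B(0,r)`. -/
def capSet {n : ℕ} (p : Euc n) (r β : ℝ) : Set (Euc n) :=
  {x | x ∈ sphere (0 : Euc n) r ∧ Real.arccos ⟪hatv x, p⟫ < β}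

/-- The geodesic sphere `S_β(r p)` in the sphere `∂B(0,r)`. -/
def capSphere {n : ℕ} (p : Euc n) (r β : ℝ) : Set (Euc n) :=
  {x | x ∈ sphere (0 : Euc n) r ∧ Real.arccos ⟪hatv x, p⟫ = β}

/-- `E ⊆ ℝⁿ` is spherically `v`-distributed: `H^{n-1}(E ∩ ∂B(0,r)) = v r` for a.e. `r > 0`. -/
def SphDistrib {n : ℕ} (v : ℝ → ℝ) (E : Set (Euc n)) : Prop :=
  ∀ᵐ r ∂(volume.restrict (Ioi (0:ℝ))),
    μH[(n : ℝ) - 1] (E ∩ sphere (0 : Euc n) r) = ENNReal.ofReal (v r)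

/-- The spherical symmetral `F_v` (determined by the angle function `α = α_v` and the
direction `p`). -/
def sphSymm (n : ℕ) (α : ℝ → ℝ) (p : Euc n) : Set (Euc n) :=
  {x : Euc n | x ≠ 0 ∧ Real.arccos ⟪hatv x, p⟫ < α ‖x‖}

/-- `Φ(B × S^{n-1})`, for `B ⊆ (0,∞)`. -/
def sphShell (n : ℕ) (B : Set ℝ) : Set (Euc n) := {x : Euc n | x ≠ 0 ∧ ‖x‖ ∈ B}

/-- `v ∈ BV(0,∞)`: `v` is integrable on `(0,∞)` and has a representative of bounded
pointwise variation there. -/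
def BVIoi (v : ℝ → ℝ) : Prop :=
  IntegrableOn v (Ioi (0:ℝ)) volume ∧
    ∃ w : ℝ → ℝ, (∀ᵐ r ∂(volume.restrict (Ioi (0:ℝ))), w r = v r) ∧
      BoundedVariationOn w (Ioi (0:ℝ))

/-- `f ∈ W^{1,1}_loc(I)` for `I ⊆ ℝ`: `f` has a representative `w` which is locally
absolutely continuous on `I`, i.e. `w b - w a = ∫_a^b g` with `g` locally integrable on `I`. -/
def W11locOn (f : ℝ → ℝ) (I : Set ℝ) : Prop :=
  ∃ w g : ℝ → ℝ, (∀ᵐ r ∂(volume.restrict I), w r = f r) ∧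
    LocallyIntegrableOn g I volume ∧
    ∀ a b : ℝ, uIcc a b ⊆ I → w b - w a = ∫ t in a..b, g t

/-- `S ⊆ ℝ` has one-dimensional density `0` at `x`. -/
def RDensity0 (S : Set ℝ) (x : ℝ) : Prop :=
  Tendsto (fun ρ : ℝ => volume (S ∩ ball x ρ) / volume (ball x ρ)) (𝓝[>] (0:ℝ)) (𝓝 0)

/-- The approximate upper limit `f^∨(x)` (for bounded `f`). -/
def apSup (f : ℝ → ℝ) (x : ℝ) : ℝ := sInf {t : ℝ | RDensity0 {y | t < f y} x}

/-- The approximate lower limit `f^∧(x)` (for bounded `f`). -/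
def apInf (f : ℝ → ℝ) (x : ℝ) : ℝ := sSup {t : ℝ | RDensity0 {y | f y < t} x}

/-- `t` is the approximate limit of `f` at `x` with respect to `A`. -/
def apLimOn (f : ℝ → ℝ) (A : Set ℝ) (x t : ℝ) : Prop :=
  ∀ ε : ℝ, 0 < ε → RDensity0 ({y | ε < |f y - t|} ∩ A) x

/-- Density (with value `t`) at `x` of a subset `A` of the sphere `∂B(0,r)`,
with respect to the measure `H^{n-1}` on the sphere. -/
def SphDensityAt {n : ℕ} (A : Set (Euc n)) (r : ℝ) (x : Euc n) (t : ℝ≥0∞) : Prop :=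
  Tendsto (fun ρ : ℝ =>
      μH[(n : ℝ) - 1] (A ∩ ball x ρ) / μH[(n : ℝ) - 1] (sphere (0 : Euc n) r ∩ ball x ρ))
    (𝓝[>] (0:ℝ)) (𝓝 t)

/-- The essential boundary, within the sphere `∂B(0,r)`, of a subset `A` of that sphere. -/
def sphEssBoundary {n : ℕ} (A : Set (Euc n)) (r : ℝ) : Set (Euc n) :=
  {x | x ∈ sphere (0 : Euc n) r ∧ ¬ SphDensityAt A r x 0 ∧ ¬ SphDensityAt A r x 1}

/-- A pair of mutually singular measures `(σp, σm)` supported in `(0,∞)`, locally finite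
there, representing the distributional derivative `Dξ = σp - σm` of `ξ` on `(0,∞)`. -/
def RepDeriv (ξ : ℝ → ℝ) (σp σm : Measure ℝ) : Prop :=
  σp (Iic (0:ℝ)) = 0 ∧ σm (Iic (0:ℝ)) = 0 ∧
    (∀ K : Set ℝ, K ⊆ Ioi (0:ℝ) → IsCompact K → σp K < ⊤ ∧ σm K < ⊤) ∧
    σp.MutuallySingular σm ∧
    ∀ φ : ℝ → ℝ, ContDiff ℝ 1 φ → HasCompactSupport φ → tsupport φ ⊆ Ioi (0:ℝ) →
      (∫ r in Ioi (0:ℝ), ξ r * deriv φ r) = (∫ r, φ r ∂σm) - ∫ r, φ r ∂σp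

/-- The density `ξ'` of the absolutely continuous part of `Dξ = σp - σm`. -/
def acDeriv (σp σm : Measure ℝ) (r : ℝ) : ℝ :=
  (σp.rnDeriv volume r).toReal - (σm.rnDeriv volume r).toReal

/-- `p_E(r) = H^{n-2}(∂*E ∩ ∂B(0,r))` (as a real number). -/
def pSlice {n : ℕ} (E : Set (Euc n)) (r : ℝ) : ℝ :=
  (μH[(n : ℝ) - 2] (redBoundary E ∩ sphere (0 : Euc n) r)).toReal

/-- The projection `x ↦ x₁₂` onto the plane of the first two coordinates. -/
def pr12 {n : ℕ} (hn : 2 ≤ n) (x : Euc n) : Euc 2 :=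
  (EuclideanSpace.equiv (Fin 2) ℝ).symm fun i => x ⟨i.1, lt_of_lt_of_le i.2 hn⟩

/-- The projection `x ↦ x'` onto the remaining `n - 2` coordinates. -/
def prC {n : ℕ} (hn : 2 ≤ n) (x : Euc n) : Euc (n - 2) :=
  (EuclideanSpace.equiv (Fin (n - 2)) ℝ).symm fun i => x ⟨i.1 + 2, by have := i.2; omega⟩

/-- The circle `∂B((0,x'),r) ∩ Π_{x'}`, for `p = (r, x')`. -/
def circFiber {n : ℕ} (hn : 2 ≤ n) (p : ℝ × Euc (n - 2)) : Set (Euc n) :=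
  {y : Euc n | prC hn y = p.2 ∧ ‖pr12 hn y‖ = p.1}

/-- The circular slice `E_{(r,x')}`, for `p = (r, x')`. -/
def cslice {n : ℕ} (hn : 2 ≤ n) (E : Set (Euc n)) (p : ℝ × Euc (n - 2)) : Set (Euc n) :=
  E ∩ circFiber hn p

/-- `E` is circularly `ℓ`-distributed. -/
def CircDistrib {n : ℕ} (hn : 2 ≤ n) (ℓ : ℝ × Euc (n - 2) → ℝ) (E : Set (Euc n)) : Prop :=
  ∀ᵐ p ∂(volume.restrict ((Ioi (0:ℝ)) ×ˢ (univ : Set (Euc (n - 2))))),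
    μH[(1:ℝ)] (cslice hn E p) = ENNReal.ofReal (ℓ p)

/-- The circular symmetral `F^ℓ`. -/
def circSymm {n : ℕ} (hn : 2 ≤ n) (ℓ : ℝ × Euc (n - 2) → ℝ) : Set (Euc n) :=
  {x : Euc n | pr12 hn x ≠ 0 ∧
    Real.arccos ⟪hatv (pr12 hn x), e1 2 (by norm_num)⟫
      < ℓ (‖pr12 hn x‖, prC hn x) / (2 * ‖pr12 hn x‖)}

/-- `Φ₁₂(B × S¹)`, for `B ⊆ (0,∞) × ℝ^{n-2}`. -/
def cylSet {n : ℕ} (hn : 2 ≤ n) (B : Set (ℝ × Euc (n - 2))) : Set (Euc n) :=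
  {x : Euc n | pr12 hn x ≠ 0 ∧ (‖pr12 hn x‖, prC hn x) ∈ B}

/-- The component `ν₁₂∥^E(x) = ν₁₂^E(x) - (ν^E(x)·x̂₁₂)x̂₁₂` of the normal. -/
def nu12par {n : ℕ} (hn : 2 ≤ n) (E : Set (Euc n)) (x : Euc n) : Euc 2 :=
  pr12 hn (mtNormal E x) - ⟪pr12 hn (mtNormal E x), hatv (pr12 hn x)⟫ • hatv (pr12 hn x)

/-- Density (with value `t`) at `x` of a subset `A` of the circle `circFiber hn p`,
with respect to the measure `H¹` on that circle. -/
def CircDensityAt {n : ℕ} (hn : 2 ≤ n) (A : Set (Euc n)) (p : ℝ × Euc (n - 2)) (x : Euc n)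
    (t : ℝ≥0∞) : Prop :=
  Tendsto (fun ρ : ℝ => μH[(1:ℝ)] (A ∩ ball x ρ) / μH[(1:ℝ)] (circFiber hn p ∩ ball x ρ))
    (𝓝[>] (0:ℝ)) (𝓝 t)

/-- The essential boundary, within the circle `circFiber hn p`, of a subset `A`. -/
def circEssBoundary {n : ℕ} (hn : 2 ≤ n) (A : Set (Euc n)) (p : ℝ × Euc (n - 2)) :
    Set (Euc n) :=
  {x | x ∈ circFiber hn p ∧ ¬ CircDensityAt hn A p x 0 ∧ ¬ CircDensityAt hn A p x 1}

/-- `f` has locally bounded variation on the open set `Ω`: on every open `U` compactly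
contained in `Ω` the distributional gradient of `f` has finite total variation. -/
def BVlocOn {W : Type*} [NormedAddCommGroup W] [NormedSpace ℝ W] [MeasureSpace W]
    (f : W → ℝ) (Ω : Set W) : Prop :=
  LocallyIntegrableOn f Ω volume ∧
    ∀ U : Set W, IsOpen U → IsCompact (closure U) → closure U ⊆ Ω →
      ∃ C : ℝ, ∀ g : W → W, ContDiff ℝ 1 g → HasCompactSupport g → tsupport g ⊆ U →
        (∀ x, ‖g x‖ ≤ 1) →
        (∫ x in U, f x * LinearMap.trace ℝ W (fderiv ℝ g x).toLinearMap) ≤ C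

/-- `f ∈ W^{1,1}_loc(Ω)` for `Ω ⊆ (0,∞) × ℝ^m`: `f` has a locally integrable weak
gradient `(g1, g2)` on `Ω`. -/
def W11locProd {m : ℕ} (f : ℝ × Euc m → ℝ) (Ω : Set (ℝ × Euc m)) : Prop :=
  ∃ (g1 : ℝ × Euc m → ℝ) (g2 : ℝ × Euc m → Euc m),
    LocallyIntegrableOn f Ω volume ∧ LocallyIntegrableOn g1 Ω volume ∧
      LocallyIntegrableOn g2 Ω volume ∧
      ∀ φ : ℝ × Euc m → ℝ, ContDiff ℝ 1 φ → HasCompactSupport φ → tsupport φ ⊆ Ω →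
        ∀ y : ℝ × Euc m,
          (∫ x in Ω, f x * fderiv ℝ φ x y) = -∫ x in Ω, φ x * (g1 x * y.1 + ⟪g2 x, y.2⟫)

/-- A pair of mutually singular measures `(σp, σm)` supported in `Ω₀ = (0,∞) × ℝ^m`,
locally finite there, representing the partial distributional derivative
`D_r ξ = σp - σm` of `ξ` in the radial variable. -/
def RepDerivR {m : ℕ} (ξ : ℝ × Euc m → ℝ) (σp σm : Measure (ℝ × Euc m)) : Prop :=
  σp ((Ioi (0:ℝ)) ×ˢ (univ : Set (Euc m)))ᶜ = 0 ∧
    σm ((Ioi (0:ℝ)) ×ˢ (univ : Set (Euc m)))ᶜ = 0 ∧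
    (∀ K : Set (ℝ × Euc m), K ⊆ (Ioi (0:ℝ)) ×ˢ univ → IsCompact K → σp K < ⊤ ∧ σm K < ⊤) ∧
    σp.MutuallySingular σm ∧
    ∀ φ : ℝ × Euc m → ℝ, ContDiff ℝ 1 φ → HasCompactSupport φ →
      tsupport φ ⊆ (Ioi (0:ℝ)) ×ˢ (univ : Set (Euc m)) →
      (∫ x in (Ioi (0:ℝ)) ×ˢ (univ : Set (Euc m)), ξ x * fderiv ℝ φ x ((1:ℝ), (0 : Euc m)))
        = (∫ x, φ x ∂σm) - ∫ x, φ x ∂σp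

/-- A polar representation `(τ, h)` (with `‖h‖ = 1` `τ`-a.e.) of the distributional
gradient `D_{x'} f = h τ` of `f` in the `x'` variables, on `Ω₀ = (0,∞) × ℝ^m`. -/
def RepDerivX {m : ℕ} (f : ℝ × Euc m → ℝ) (τ : Measure (ℝ × Euc m))
    (h : ℝ × Euc m → Euc m) : Prop :=
  τ ((Ioi (0:ℝ)) ×ˢ (univ : Set (Euc m)))ᶜ = 0 ∧
    (∀ K : Set (ℝ × Euc m), K ⊆ (Ioi (0:ℝ)) ×ˢ univ → IsCompact K → τ K < ⊤) ∧
    (∀ᵐ x ∂τ, ‖h x‖ = 1) ∧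
    ∀ φ : ℝ × Euc m → ℝ, ContDiff ℝ 1 φ → HasCompactSupport φ →
      tsupport φ ⊆ (Ioi (0:ℝ)) ×ˢ (univ : Set (Euc m)) →
      ∀ y : Euc m,
        (∫ x in (Ioi (0:ℝ)) ×ˢ (univ : Set (Euc m)), f x * fderiv ℝ φ x ((0:ℝ), y))
          = -∫ x, φ x * ⟪h x, y⟫ ∂τ

/-- The barycentre function `b_E(r) = r^{1-n} ∫_{E_r} x̂ dH^{n-1}`. -/
def bary (n : ℕ) (E : Set (Euc n)) (r : ℝ) : Euc n :=
  (r ^ (n - 1))⁻¹ • ∫ x in E ∩ sphere (0 : Euc n) r, hatv x ∂μH[(n : ℝ) - 1]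

/-- The average direction `d_E(r)` of the slice `E_r`. -/
def avgDir (n : ℕ) (α : ℝ → ℝ) (E : Set (Euc n)) (r : ℝ) : Euc n :=
  (omegaBall (n - 1) * Real.sin (α r) ^ (n - 1) * r ^ (n - 1))⁻¹ •
    ∫ x in E ∩ sphere (0 : Euc n) r, hatv x ∂μH[(n : ℝ) - 1]

end


/-! ## Part 1 -/
open MeasureTheory Metric Set Filter
open scoped ENNReal NNReal Topology RealInnerProductSpace

/-- Angle to the axis `p`. -/
noncomputable def ang {n : ℕ} (p x : Euc n) : ℝ := Real.arccos ⟪hatv x, p⟫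

lemma norm_hatv {n : ℕ} {x : Euc n} (hx : x ≠ 0) : ‖hatv x‖ = 1 := by
  unfold hatv
  rw [norm_smul, norm_inv, norm_norm]
  exact inv_mul_cancel₀ (norm_ne_zero_iff.mpr hx)

lemma smul_hatv {n : ℕ} (x : Euc n) : ‖x‖ • hatv x = x := by
  unfold hatv
  by_cases hx : x = 0
  · simp [hx]
  · rw [smul_smul, mul_inv_cancel₀ (norm_ne_zero_iff.mpr hx), one_smul]

lemma hatv_smul {n : ℕ} {x : Euc n} {c : ℝ} (hc : 0 < c) : hatv (c • x) = hatv x := by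
  unfold hatv
  rw [norm_smul, Real.norm_of_nonneg hc.le, smul_smul, mul_inv, mul_comm c⁻¹, mul_assoc,
    inv_mul_cancel₀ hc.ne', mul_one]

lemma hatv_of_norm_one {n : ℕ} {x : Euc n} (hx : ‖x‖ = 1) : hatv x = x := by
  unfold hatv; simp [hx]

lemma ang_smul {n : ℕ} (p : Euc n) {x : Euc n} {c : ℝ} (hc : 0 < c) :
    ang p (c • x) = ang p x := by
  unfold ang; rw [hatv_smul hc]

lemma ang_hatv {n : ℕ} (p : Euc n) {x : Euc n} (hx : x ≠ 0) : ang p (hatv x) = ang p x := by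
  unfold hatv
  exact ang_smul p (inv_pos.mpr (norm_pos_iff.mpr hx))

lemma ang_eq_angle {n : ℕ} {p : Euc n} (hp : ‖p‖ = 1) (x : Euc n) :
    ang p x = InnerProductGeometry.angle x p := by
  unfold ang hatv InnerProductGeometry.angle
  rw [real_inner_smul_left, hp, mul_one, div_eq_inv_mul]

lemma ang_nonneg {n : ℕ} (p x : Euc n) : 0 ≤ ang p x := Real.arccos_nonneg _
lemma ang_le_pi {n : ℕ} (p x : Euc n) : ang p x ≤ Real.pi := Real.arccos_le_pi _

lemma cos_ang {n : ℕ} {p : Euc n} (hp : ‖p‖ = 1) {x : Euc n} :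
    ‖x‖ * Real.cos (ang p x) = ⟪x, p⟫ := by
  rw [ang_eq_angle hp]
  have := InnerProductGeometry.cos_angle_mul_norm_mul_norm x p
  rw [hp] at this
  linarith

lemma angle_le_chord {n : ℕ} {x y : Euc n} (hx : ‖x‖ = 1) (hy : ‖y‖ = 1) :
    InnerProductGeometry.angle x y ≤ Real.pi / 2 * ‖x - y‖ := by
  set a := InnerProductGeometry.angle x y with ha
  have h0 : 0 ≤ a := InnerProductGeometry.angle_nonneg x y
  have h1 : a ≤ Real.pi := InnerProductGeometry.angle_le_pi x y
  have hc : Real.cos a = ⟪x, y⟫ := by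
    have := InnerProductGeometry.cos_angle_mul_norm_mul_norm x y
    rw [hx, hy] at this
    linarith
  have hs : 2 / Real.pi * (a / 2) ≤ Real.sin (a / 2) :=
    Real.mul_le_sin (by linarith) (by linarith)
  have hn : ‖x - y‖ ^ 2 = (2 * Real.sin (a / 2)) ^ 2 := by
    rw [norm_sub_sq_real, hx, hy, ← hc]
    have := Real.cos_sq (a/2)
    have h2 := Real.sin_sq_add_cos_sq (a/2)
    rw [show 2 * (a/2) = a by ring] at this
    nlinarith
  have hn' : ‖x - y‖ = 2 * Real.sin (a / 2) := by
    refine (pow_left_inj₀ (norm_nonneg _) ?_ two_ne_zero).mp hn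
    have : 0 ≤ 2 / Real.pi * (a / 2) := by positivity
    linarith
  rw [hn']
  have hpi := Real.pi_pos
  have : Real.pi / 2 * (2 * (2 / Real.pi * (a / 2))) = a := by field_simp
  calc a = Real.pi / 2 * (2 * (2 / Real.pi * (a / 2))) := this.symm
    _ ≤ _ := by gcongr

lemma ang_lip {n : ℕ} {p : Euc n} (hp : ‖p‖ = 1) {x y : Euc n} (hx : ‖x‖ = 1) (hy : ‖y‖ = 1) :
    |ang p x - ang p y| ≤ Real.pi / 2 * ‖x - y‖ := by
  rw [ang_eq_angle hp, ang_eq_angle hp, abs_le]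
  have h1 := InnerProductGeometry.angle_le_angle_add_angle x y p
  have h2 := InnerProductGeometry.angle_le_angle_add_angle y x p
  have h3 := angle_le_chord hx hy
  rw [InnerProductGeometry.angle_comm y x] at h2
  constructor <;> linarith

lemma hatv_lip {n : ℕ} {x : Euc n} (hx : x ≠ 0) (y : Euc n) :
    ‖hatv x - hatv y‖ ≤ 2 / ‖x‖ * ‖x - y‖ := by
  have hx' : 0 < ‖x‖ := norm_pos_iff.mpr hx
  have h : ‖x‖ • (hatv x - hatv y) = (x - y) + (‖y‖ - ‖x‖) • hatv y := by
    rw [smul_sub, smul_hatv, sub_smul, smul_hatv]; abel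
  have hy : ‖hatv y‖ ≤ 1 := by
    by_cases h : y = 0
    · simp [h, hatv]
    · exact (norm_hatv h).le
  have h2 : ‖x‖ * ‖hatv x - hatv y‖ ≤ 2 * ‖x - y‖ := by
    rw [← Real.norm_of_nonneg hx'.le, ← norm_smul, h]
    refine (norm_add_le _ _).trans ?_
    rw [norm_smul, Real.norm_eq_abs]
    have h3 : |‖y‖ - ‖x‖| ≤ ‖x - y‖ := by
      rw [norm_sub_rev]; exact abs_norm_sub_norm_le y x
    nlinarith [abs_nonneg (‖y‖ - ‖x‖), norm_nonneg (hatv y), norm_nonneg (x-y)]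
  rw [div_mul_eq_mul_div, le_div_iff₀ hx']
  linarith

lemma ang_lip2 {n : ℕ} {p : Euc n} (hp : ‖p‖ = 1) {x y : Euc n} (hx : x ≠ 0) (hy : y ≠ 0) :
    |ang p x - ang p y| ≤ Real.pi / ‖x‖ * ‖x - y‖ := by
  rw [← ang_hatv p hx, ← ang_hatv p hy]
  refine (ang_lip hp (norm_hatv hx) (norm_hatv hy)).trans ?_
  have := hatv_lip hx y
  calc _ ≤ Real.pi / 2 * (2 / ‖x‖ * ‖x - y‖) := by gcongr
    _ = _ := by ring

lemma measurable_hatv {n : ℕ} : Measurable (hatv : Euc n → Euc n) := by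
  unfold hatv; fun_prop

lemma measurable_ang {n : ℕ} (p : Euc n) : Measurable (ang p) := by
  unfold ang
  exact Real.measurable_arccos.comp (measurable_hatv.inner_const)

lemma continuousAt_ang {n : ℕ} (p : Euc n) {x : Euc n} (hx : x ≠ 0) :
    ContinuousAt (ang p) x := by
  unfold ang hatv
  have : ‖x‖ ≠ 0 := norm_ne_zero_iff.mpr hx
  refine Real.continuous_arccos.continuousAt.comp ?_
  fun_prop (disch := assumption)

lemma sphSymm_eq {n : ℕ} (α : ℝ → ℝ) (p : Euc n) :
    sphSymm n α p = {x : Euc n | x ≠ 0 ∧ ang p x < α ‖x‖} := rfl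

lemma measurableSet_sphSymm {n : ℕ} {α : ℝ → ℝ} (hα : Measurable α) (p : Euc n) :
    MeasurableSet (sphSymm n α p) := by
  rw [sphSymm_eq]
  refine (measurableSet_singleton (0 : Euc n)).compl.inter ?_
  exact measurableSet_lt (measurable_ang p) (hα.comp measurable_norm)

/-- Point of the unit sphere at angle `t` from `p` in direction `σ`. -/
lemma ang_polar {n : ℕ} {p σ : Euc n} (hp : ‖p‖ = 1) (hσ : ‖σ‖ = 1) (h : ⟪p, σ⟫ = 0) {t : ℝ}
    (h0 : 0 ≤ t) (h1 : t ≤ Real.pi) :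
    ‖Real.cos t • p + Real.sin t • σ‖ = 1 ∧ ang p (Real.cos t • p + Real.sin t • σ) = t := by
  have hn : ‖Real.cos t • p + Real.sin t • σ‖ = 1 := by
    have : ‖Real.cos t • p + Real.sin t • σ‖ ^ 2 = 1 := by
      rw [norm_add_sq_real, norm_smul, norm_smul, inner_smul_left, inner_smul_right, h, hp, hσ]
      simp
    nlinarith [norm_nonneg (Real.cos t • p + Real.sin t • σ)]
  refine ⟨hn, ?_⟩
  unfold ang
  rw [hatv_of_norm_one hn, inner_add_left, inner_smul_left, inner_smul_left,
    real_inner_comm, real_inner_comm, real_inner_self_eq_norm_sq, hp]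
  rw [real_inner_comm, h]
  simpa using Real.arccos_cos h0 h1

/-- Decomposition of a nonzero vector. -/
lemma exists_polar {n : ℕ} {p : Euc n} (hp : ‖p‖ = 1) {x : Euc n} (hx : x ≠ 0)
    (h0 : 0 < ang p x) (h1 : ang p x < Real.pi) :
    ∃ σ : Euc n, ‖σ‖ = 1 ∧ ⟪p, σ⟫ = 0 ∧
      hatv x = Real.cos (ang p x) • p + Real.sin (ang p x) • σ := by
  have hs : 0 < Real.sin (ang p x) := Real.sin_pos_of_pos_of_lt_pi h0 h1
  have hn := norm_hatv hx
  have hc : Real.cos (ang p x) = ⟪hatv x, p⟫ := by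
    have := cos_ang hp (x := hatv x)
    rw [hn, ang_hatv p hx] at this; linarith
  set c := Real.cos (ang p x)
  set s := Real.sin (ang p x)
  have hsc : s ^ 2 + c ^ 2 = 1 := Real.sin_sq_add_cos_sq _
  refine ⟨s⁻¹ • (hatv x - c • p), ?_, ?_, ?_⟩
  · have : ‖hatv x - c • p‖ ^ 2 = s ^ 2 := by
      rw [norm_sub_sq_real, inner_smul_right, ← hc, norm_smul, hp, hn, mul_one,
        Real.norm_eq_abs, sq_abs]; linarith
    have h2 : ‖hatv x - c • p‖ = s := (pow_left_inj₀ (norm_nonneg _) hs.le two_ne_zero).mp this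
    rw [norm_smul, h2, norm_inv, Real.norm_of_nonneg hs.le, inv_mul_cancel₀ hs.ne']
  · rw [inner_smul_right, inner_sub_right, inner_smul_right, real_inner_comm, ← hc,
      real_inner_self_eq_norm_sq, hp]; ring
  · rw [smul_smul, mul_inv_cancel₀ hs.ne', one_smul]; abel


/-! ## Part 2 -/
open MeasureTheory Metric Set Filter
open scoped ENNReal NNReal Topology RealInnerProductSpace

lemma polar_vol {n : ℕ} {S : Set ℝ} (hS : MeasurableSet S) {U : Set (Euc n)}
    (hU : MeasurableSet U) :
    volume {y : Euc n | y ≠ 0 ∧ ‖y‖ ∈ S ∧ hatv y ∈ U} =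
      (volume : Measure (Euc n)).toSphere (Subtype.val ⁻¹' U) *
        ∫⁻ s in S ∩ Ioi 0, ENNReal.ofReal (s ^ (n - 1)) := by
  have h := (volume : Measure (Euc n)).measurePreserving_homeomorphUnitSphereProd
  have hm : MeasurableSet ((Subtype.val ⁻¹' U : Set (sphere (0:Euc n) 1)) ×ˢ
      (Subtype.val ⁻¹' S : Set (Ioi (0:ℝ)))) :=
    (measurable_subtype_coe hU).prod (measurable_subtype_coe hS)
  have h1 := h.measure_preimage hm.nullMeasurableSet
  rw [Measure.prod_prod, (MeasurableEmbedding.subtype_coe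
    (measurableSet_singleton (0 : Euc n)).compl).comap_apply] at h1
  · have h2 : (Subtype.val '' ((homeomorphUnitSphereProd (Euc n)) ⁻¹'
        ((Subtype.val ⁻¹' U : Set (sphere (0:Euc n) 1)) ×ˢ
      (Subtype.val ⁻¹' S : Set (Ioi (0:ℝ)))))) = {y : Euc n | y ≠ 0 ∧ ‖y‖ ∈ S ∧ hatv y ∈ U} := by
      ext y
      simp only [mem_image, mem_preimage, mem_prod, Subtype.exists, exists_and_right,
        exists_eq_right, mem_setOf_eq]
      simp only [homeomorphUnitSphereProd_apply_fst_coe, homeomorphUnitSphereProd_apply_snd_coe]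
      constructor
      · rintro ⟨hy, h1, h2⟩
        exact ⟨hy, h2, h1⟩
      · rintro ⟨hy, h1, h2⟩
        exact ⟨hy, h2, h1⟩
    rw [h2] at h1
    rw [h1]
    congr 1
    rw [Measure.volumeIoiPow, withDensity_apply _ (measurable_subtype_coe hS)]
    rw [setLIntegral_subtype measurableSet_Ioi _ fun a : ℝ ↦ ENNReal.ofReal (a ^ (Module.finrank ℝ (Euc n) - 1))]
    simp [inter_comm]

lemma vol_norm_null {n : ℕ} (hn : 2 ≤ n) {N : Set ℝ} (hN : volume N = 0) :
    volume {y : Euc n | ‖y‖ ∈ N} = 0 := by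
  have : Nonempty (Fin n) := ⟨⟨0, by omega⟩⟩
  have h := polar_vol (n := n) (measurableSet_toMeasurable volume N) MeasurableSet.univ
  have h0 : ∫⁻ s in toMeasurable volume N ∩ Ioi 0, ENNReal.ofReal (s ^ (n - 1)) = 0 := by
    apply setLIntegral_measure_zero
    exact measure_mono_null inter_subset_left ((measure_toMeasurable N).trans hN)
  rw [h0, mul_zero] at h
  have h1 : volume ({0} : Set (Euc n)) = 0 := measure_singleton _
  refine measure_mono_null ?_ (measure_union_null h h1)
  intro y hy
  by_cases hy0 : y = 0
  · right; exact hy0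
  · left; exact ⟨hy0, subset_toMeasurable _ _ hy, mem_univ _⟩

lemma vol_ball {n : ℕ} (hn : 2 ≤ n) (x : Euc n) {ρ : ℝ} (hρ : 0 ≤ ρ) :
    volume (ball x ρ) = ENNReal.ofReal (ρ ^ n) * volume (ball (0 : Euc n) 1) := by
  have : Nonempty (Fin n) := ⟨⟨0, by omega⟩⟩
  have := Measure.addHaar_ball (volume : Measure (Euc n)) x hρ
  simpa using this

lemma ae_norm {n : ℕ} (hn : 2 ≤ n) {I : Set ℝ} {P : ℝ → Prop}
    (h : ∀ᵐ r ∂(volume.restrict I), P r) (hI : MeasurableSet I) :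
    ∀ᵐ y : Euc n, ‖y‖ ∈ I → P ‖y‖ := by
  rw [ae_restrict_iff' hI] at h
  have := vol_norm_null (n := n) hn (N := {r | ¬ (r ∈ I → P r)}) h
  exact this

/-- Lower bound of the surface measure of small caps. -/
lemma toSphere_ball_lower {n : ℕ} (hn : 2 ≤ n) :
    ∃ c : ℝ, 0 < c ∧ ∀ (ω : Euc n), ‖ω‖ = 1 → ∀ δ : ℝ, 0 < δ → δ ≤ 1 →
      ENNReal.ofReal (c * δ ^ (n - 1)) ≤
        (volume : Measure (Euc n)).toSphere (Subtype.val ⁻¹' (ball ω δ)) := by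
  obtain ⟨V, hV, hVe⟩ : ∃ V : ℝ, 0 < V ∧ volume (ball (0 : Euc n) 1) = ENNReal.ofReal V := by
    refine ⟨(volume (ball (0 : Euc n) 1)).toReal, ENNReal.toReal_pos ?_ ?_, ?_⟩
    · exact (measure_ball_pos _ _ one_pos).ne'
    · exact measure_ball_lt_top.ne
    · exact (ENNReal.ofReal_toReal measure_ball_lt_top.ne).symm
  refine ⟨V * (1/8)^n / 2, by positivity, ?_⟩
  intro ω hω δ hδ hδ1
  have h := polar_vol (n := n) (S := Ioo (1 - δ) (1 + δ)) measurableSet_Ioo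
    (measurableSet_ball (x := ω) (ε := δ))
  have hsub : ball ω (δ / 4) ⊆
      {y : Euc n | y ≠ 0 ∧ ‖y‖ ∈ Ioo (1 - δ) (1 + δ) ∧ hatv y ∈ ball ω δ} := by
    intro y hy
    rw [mem_ball, dist_eq_norm] at hy
    have h1 : |‖y‖ - ‖ω‖| ≤ ‖y - ω‖ := abs_norm_sub_norm_le y ω
    rw [hω, abs_le] at h1
    refine ⟨?_, ⟨by linarith, by linarith⟩, ?_⟩
    · rintro rfl
      rw [norm_zero] at h1; linarith
    · have hω0 : ω ≠ 0 := by rintro rfl; simp at hω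
      have h2 := hatv_lip hω0 y
      rw [hω, hatv_of_norm_one hω, norm_sub_rev ω y] at h2
      rw [mem_ball, dist_eq_norm, norm_sub_rev]
      linarith
  have h3 := measure_mono (μ := (volume : Measure (Euc n))) hsub
  rw [h, vol_ball hn _ (by positivity), hVe, ← ENNReal.ofReal_mul (by positivity)] at h3
  have h4 : ∫⁻ s in Ioo (1 - δ) (1 + δ) ∩ Ioi 0, ENNReal.ofReal (s ^ (n - 1)) ≤
      ENNReal.ofReal (2 ^ (n - 1) * (2 * δ)) := by
    calc _ ≤ ∫⁻ s in Ioo (1 - δ) (1 + δ) ∩ Ioi 0, ENNReal.ofReal (2 ^ (n - 1)) := by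
          apply setLIntegral_mono' (measurableSet_Ioo.inter measurableSet_Ioi)
          rintro s ⟨hs, hs0⟩
          apply ENNReal.ofReal_le_ofReal
          exact pow_le_pow_left₀ (le_of_lt hs0) (by linarith [hs.2]) _
      _ ≤ _ := by
          rw [setLIntegral_const, ENNReal.ofReal_mul (by positivity)]
          gcongr
          refine (measure_mono inter_subset_left).trans ?_
          rw [Real.volume_Ioo]
          apply ENNReal.ofReal_le_ofReal; linarith
  set T := (volume : Measure (Euc n)).toSphere (Subtype.val ⁻¹' (ball ω δ))
  have h5 : ENNReal.ofReal ((δ / 4) ^ n * V) ≤ T * ENNReal.ofReal (2 ^ (n - 1) * (2 * δ)) :=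
    h3.trans (by gcongr)
  have hpos : (0:ℝ) < 2 ^ (n - 1) * (2 * δ) := by positivity
  have h6 : ENNReal.ofReal ((δ / 4) ^ n * V) / ENNReal.ofReal (2 ^ (n - 1) * (2 * δ)) ≤ T :=
    ENNReal.div_le_of_le_mul h5
  rw [← ENNReal.ofReal_div_of_pos hpos] at h6
  refine le_trans (ENNReal.ofReal_le_ofReal ?_) h6
  obtain ⟨m, rfl⟩ : ∃ m, n = m + 1 := ⟨n - 1, by omega⟩
  rw [le_div_iff₀ hpos, Nat.add_sub_cancel, div_pow, div_pow]
  have : V * (1 ^ (m+1) / 8 ^ (m+1)) / 2 * δ ^ m * (2 ^ m * (2 * δ)) = δ ^ (m+1) / (8^(m+1) / 2^(m+1)) * V / 2 := by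
    rw [one_pow]; field_simp; ring
  rw [this, ← div_pow]
  norm_num
  have : 0 ≤ δ ^ (m+1) / 4 ^ (m+1) * V := by positivity
  linarith

/-- Upper bound of the surface measure of small caps. -/
lemma toSphere_ball_upper {n : ℕ} (hn : 2 ≤ n) :
    ∃ c : ℝ, 0 < c ∧ ∀ (ω : Euc n), ‖ω‖ = 1 → ∀ δ : ℝ, 0 < δ →
        (volume : Measure (Euc n)).toSphere (Subtype.val ⁻¹' (ball ω δ)) ≤
      ENNReal.ofReal (c * δ ^ (n - 1)) := by
  obtain ⟨V, hV, hVe⟩ : ∃ V : ℝ, 0 < V ∧ volume (ball (0 : Euc n) 1) = ENNReal.ofReal V := by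
    refine ⟨(volume (ball (0 : Euc n) 1)).toReal, ENNReal.toReal_pos ?_ ?_, ?_⟩
    · exact (measure_ball_pos _ _ one_pos).ne'
    · exact measure_ball_lt_top.ne
    · exact (ENNReal.ofReal_toReal measure_ball_lt_top.ne).symm
  refine ⟨V * 2 ^ n, by positivity, ?_⟩
  intro ω hω δ hδ
  have h := polar_vol (n := n) (S := Ioo 1 (1 + δ)) measurableSet_Ioo
    (measurableSet_ball (x := ω) (ε := δ))
  have hsub : {y : Euc n | y ≠ 0 ∧ ‖y‖ ∈ Ioo 1 (1 + δ) ∧ hatv y ∈ ball ω δ} ⊆ ball ω (2 * δ) := by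
    rintro y ⟨hy0, hy, hyb⟩
    rw [mem_ball, dist_eq_norm] at *
    have h1 : y - hatv y = (‖y‖ - 1) • hatv y := by
      rw [sub_smul, smul_hatv, one_smul]
    have h2 : ‖y - hatv y‖ < δ := by
      rw [h1, norm_smul, norm_hatv hy0, mul_one, Real.norm_eq_abs, abs_lt]
      constructor <;> linarith [hy.1, hy.2]
    calc ‖y - ω‖ = ‖(y - hatv y) + (hatv y - ω)‖ := by congr 1; abel
      _ ≤ _ := norm_add_le _ _
      _ < 2 * δ := by linarith
  have h3 := measure_mono (μ := (volume : Measure (Euc n))) hsub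
  rw [h, vol_ball hn _ (by positivity), hVe, ← ENNReal.ofReal_mul (by positivity)] at h3
  have h4 : ENNReal.ofReal δ ≤ ∫⁻ s in Ioo 1 (1 + δ) ∩ Ioi 0, ENNReal.ofReal (s ^ (n - 1)) := by
    have he : Ioo 1 (1 + δ) ∩ Ioi 0 = Ioo 1 (1 + δ) := by
      apply inter_eq_left.mpr
      intro s hs
      exact lt_trans one_pos hs.1
    rw [he]
    calc ENNReal.ofReal δ = ∫⁻ s in Ioo 1 (1 + δ), 1 := by
          rw [setLIntegral_const, Real.volume_Ioo]; simp
      _ ≤ _ := by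
          apply setLIntegral_mono' measurableSet_Ioo
          intro s hs
          rw [← ENNReal.ofReal_one]
          apply ENNReal.ofReal_le_ofReal
          exact one_le_pow₀ hs.1.le
  set T := (volume : Measure (Euc n)).toSphere (Subtype.val ⁻¹' (ball ω δ))
  have h5 : T * ENNReal.ofReal δ ≤ ENNReal.ofReal ((2 * δ) ^ n * V) :=
    le_trans (by gcongr) h3
  rw [← ENNReal.le_div_iff_mul_le (Or.inl (by simpa using hδ)) (Or.inl ENNReal.ofReal_ne_top),
    ← ENNReal.ofReal_div_of_pos hδ] at h5
  refine h5.trans (ENNReal.ofReal_le_ofReal (le_of_eq ?_))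
  obtain ⟨m, rfl⟩ : ∃ m, n = m + 1 := ⟨n - 1, by omega⟩
  rw [Nat.add_sub_cancel, mul_pow]
  field_simp
  ring

lemma sector_lower {n : ℕ} (hn : 2 ≤ n) {p : Euc n} (hp : ‖p‖ = 1) {x : Euc n} (hx : x ≠ 0)
    (h0 : 0 < ang p x) (h1 : ang p x < Real.pi) :
    ∃ c c1 ρ0 : ℝ, 0 < c ∧ 0 < c1 ∧ 0 < ρ0 ∧ ∀ ε : ℝ, (ε = 1 ∨ ε = -1) →
      ∀ ρ : ℝ, 0 < ρ → ρ < ρ0 → ∀ S : Set ℝ, MeasurableSet S →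
      ENNReal.ofReal (c * ρ ^ (n - 1)) * volume (S ∩ closedBall ‖x‖ (ρ / 4)) ≤
      volume ({y : Euc n | y ≠ 0 ∧ ‖y‖ ∈ S ∧ c1 * ρ < ε * (ang p y - ang p x)} ∩ ball x ρ) := by
  obtain ⟨c, hc, hcap⟩ := toSphere_ball_lower hn
  obtain ⟨σ, hσ, hpσ, hxσ⟩ := exists_polar hp hx h0 h1
  set r := ‖x‖ with hr
  set θ := ang p x with hθ
  have hr0 : 0 < r := norm_pos_iff.mpr hx
  refine ⟨c * (1 / (16 * r)) ^ (n - 1) * (r / 2) ^ (n - 1), 1 / (50 * r),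
    min (min (r * θ) (r * (Real.pi - θ))) r, by positivity, by positivity, ?_, ?_⟩
  · have : 0 < Real.pi - θ := by linarith
    positivity
  intro ε hε ρ hρ hρ0 S hS
  have hρ1 : ρ < r * θ := hρ0.trans_le ((min_le_left _ _).trans (min_le_left _ _))
  have hρ2 : ρ < r * (Real.pi - θ) := hρ0.trans_le ((min_le_left _ _).trans (min_le_right _ _))
  have hρ3 : ρ < r := hρ0.trans_le (min_le_right _ _)
  set t := ρ / (8 * r) with ht
  have htr : r * t = ρ / 8 := by rw [ht]; field_simp
  have ht0 : 0 < t := by positivity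
  have ht1 : t < θ := by
    rw [ht, div_lt_iff₀ (by positivity)]; nlinarith
  have ht2 : t < Real.pi - θ := by
    rw [ht, div_lt_iff₀ (by positivity)]; nlinarith
  have ht3 : t < 1 := by
    rw [ht, div_lt_iff₀ (by positivity)]; nlinarith
  have hεt : |ε * t| = t := by
    rcases hε with rfl | rfl
    · rw [one_mul, abs_of_pos ht0]
    · rw [neg_one_mul, abs_neg, abs_of_pos ht0]
  have hεε : ε * ε = 1 := by rcases hε with rfl | rfl <;> norm_num
  have hεa : |ε| = 1 := by rcases hε with rfl | rfl <;> norm_num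
  have hab := abs_le.mp hεt.le
  obtain ⟨hω, hωa⟩ := ang_polar hp hσ hpσ (t := θ + ε * t) (by linarith) (by linarith)
  set ω := Real.cos (θ + ε * t) • p + Real.sin (θ + ε * t) • σ with hωdef
  have hωx : ‖ω - hatv x‖ ≤ 2 * t := by
    have e : ω - hatv x = (Real.cos (θ + ε * t) - Real.cos θ) • p +
        (Real.sin (θ + ε * t) - Real.sin θ) • σ := by
      rw [hxσ, hωdef, sub_smul, sub_smul]; abel
    have hc1 : |Real.cos (θ + ε * t) - Real.cos θ| ≤ t := by
      have := Real.lipschitzWith_cos.dist_le_mul (θ + ε * t) θ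
      rw [Real.dist_eq, Real.dist_eq] at this
      simpa [hεt] using this
    have hs1 : |Real.sin (θ + ε * t) - Real.sin θ| ≤ t := by
      have := Real.lipschitzWith_sin.dist_le_mul (θ + ε * t) θ
      rw [Real.dist_eq, Real.dist_eq] at this
      simpa [hεt] using this
    rw [e]
    refine (norm_add_le _ _).trans ?_
    rw [norm_smul, norm_smul, hp, hσ, Real.norm_eq_abs, Real.norm_eq_abs]
    linarith
  have hsub : {y : Euc n | y ≠ 0 ∧ ‖y‖ ∈ S ∩ closedBall r (ρ / 4) ∧ hatv y ∈ ball ω (t / 2)} ⊆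
      {y : Euc n | y ≠ 0 ∧ ‖y‖ ∈ S ∧ 1 / (50 * r) * ρ < ε * (ang p y - θ)} ∩ ball x ρ := by
    rintro y ⟨hy0, ⟨hyS, hyr⟩, hyω⟩
    rw [mem_ball, dist_eq_norm] at hyω
    rw [mem_closedBall, Real.dist_eq] at hyr
    refine ⟨⟨hy0, hyS, ?_⟩, ?_⟩
    · have h2 := ang_lip hp (norm_hatv hy0) hω
      rw [hωa, ang_hatv p hy0] at h2
      have h3 : |ε * (ang p y - (θ + ε * t))| ≤ Real.pi / 2 * ‖hatv y - ω‖ := by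
        rw [abs_mul, hεa, one_mul]; exact h2
      have h4 : ε * (ang p y - (θ + ε * t)) = ε * (ang p y - θ) - t := by
        linear_combination (-t) * hεε
      rw [h4] at h3
      have h5 := (abs_le.mp h3).1
      have hpi := Real.pi_lt_d2
      have hpi0 := Real.pi_pos
      have h6 : Real.pi / 2 * ‖hatv y - ω‖ ≤ 1.575 * (t / 2) := by
        apply mul_le_mul _ hyω.le (norm_nonneg _) (by norm_num)
        norm_num at hpi ⊢
        linarith
      have h7 : 1 / (50 * r) * ρ = 8 / 50 * t := by rw [ht]; field_simp
      rw [h7]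
      nlinarith
    · rw [mem_ball, dist_eq_norm]
      have h2 : y - x = (‖y‖ - r) • hatv y + r • (hatv y - hatv x) := by
        rw [sub_smul, smul_hatv, smul_sub, hr, smul_hatv x]; abel
      rw [h2]
      refine (norm_add_le _ _).trans_lt ?_
      rw [norm_smul, norm_smul, norm_hatv hy0, Real.norm_eq_abs, Real.norm_of_nonneg hr0.le]
      have h3 : ‖hatv y - hatv x‖ ≤ t / 2 + 2 * t := by
        calc ‖hatv y - hatv x‖ = ‖(hatv y - ω) + (ω - hatv x)‖ := by congr 1; abel
          _ ≤ _ := norm_add_le _ _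
          _ ≤ _ := by linarith
      nlinarith
  refine le_trans ?_ (measure_mono hsub)
  have hSm : MeasurableSet (S ∩ closedBall r (ρ / 4)) := hS.inter measurableSet_closedBall
  rw [polar_vol hSm measurableSet_ball]
  have hcap' := hcap ω hω (t / 2) (by positivity) (by linarith)
  have hinteg : ENNReal.ofReal ((r / 2) ^ (n - 1)) * volume (S ∩ closedBall r (ρ / 4)) ≤
      ∫⁻ s in S ∩ closedBall r (ρ / 4) ∩ Ioi 0, ENNReal.ofReal (s ^ (n - 1)) := by
    have he : S ∩ closedBall r (ρ / 4) ∩ Ioi 0 = S ∩ closedBall r (ρ / 4) := by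
      apply inter_eq_left.mpr
      rintro s ⟨_, hs⟩
      rw [mem_closedBall, Real.dist_eq, abs_le] at hs
      show 0 < s
      linarith [hs.1]
    rw [he, ← setLIntegral_const]
    apply setLIntegral_mono' hSm
    rintro s ⟨_, hs⟩
    rw [mem_closedBall, Real.dist_eq, abs_le] at hs
    apply ENNReal.ofReal_le_ofReal
    exact pow_le_pow_left₀ (by positivity) (by linarith [hs.1]) _
  have e : c * (1 / (16 * r)) ^ (n - 1) * (r / 2) ^ (n - 1) * ρ ^ (n - 1) =
      (c * (t / 2) ^ (n - 1)) * (r / 2) ^ (n - 1) := by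
    rw [ht, show ρ / (8 * r) / 2 = 1 / (16 * r) * ρ by field_simp; norm_num, mul_pow]; ring
  rw [e, ENNReal.ofReal_mul (by positivity), mul_assoc]
  gcongr

lemma shell_upper {n : ℕ} (hn : 2 ≤ n) {x : Euc n} (hx : x ≠ 0) :
    ∃ C : ℝ, 0 < C ∧ ∀ ρ : ℝ, 0 < ρ → ρ < ‖x‖ → ∀ S : Set ℝ, MeasurableSet S →
      volume ({y : Euc n | ‖y‖ ∈ S} ∩ ball x ρ) ≤
      ENNReal.ofReal (C * ρ ^ (n - 1)) * volume (S ∩ closedBall ‖x‖ ρ) := by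
  obtain ⟨c, hc, hcap⟩ := toSphere_ball_upper hn
  set r := ‖x‖ with hr
  have hr0 : 0 < r := norm_pos_iff.mpr hx
  refine ⟨c * (3 / r) ^ (n - 1) * (2 * r) ^ (n - 1), by positivity, ?_⟩
  intro ρ hρ hρr S hS
  have hsub : {y : Euc n | ‖y‖ ∈ S} ∩ ball x ρ ⊆
    {y : Euc n | y ≠ 0 ∧ ‖y‖ ∈ S ∩ closedBall r ρ ∧ hatv y ∈ ball (hatv x) (3 / r * ρ)} := by
    rintro y ⟨hyS, hy⟩
    rw [mem_ball, dist_eq_norm] at hy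
    have h2 : |‖y‖ - r| ≤ ‖y - x‖ := abs_norm_sub_norm_le y x
    refine ⟨?_, ⟨hyS, ?_⟩, ?_⟩
    · rintro rfl
      rw [norm_zero, abs_le] at h2
      linarith
    · rw [mem_closedBall, Real.dist_eq]; linarith
    · rw [mem_ball, dist_eq_norm, norm_sub_rev]
      refine (hatv_lip hx y).trans_lt ?_
      rw [norm_sub_rev, ← hr]
      calc 2 / r * ‖y - x‖ ≤ 2 / r * ρ := by gcongr
        _ < 3 / r * ρ := by gcongr; norm_num
  refine (measure_mono hsub).trans ?_
  have hSm : MeasurableSet (S ∩ closedBall r ρ) := hS.inter measurableSet_closedBall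
  rw [polar_vol hSm measurableSet_ball]
  have hcap' := hcap (hatv x) (norm_hatv hx) (3 / r * ρ) (by positivity)
  have hinteg : ∫⁻ s in S ∩ closedBall r ρ ∩ Ioi 0, ENNReal.ofReal (s ^ (n - 1)) ≤
      ENNReal.ofReal ((2 * r) ^ (n - 1)) * volume (S ∩ closedBall r ρ) := by
    calc _ ≤ ∫⁻ s in S ∩ closedBall r ρ ∩ Ioi 0, ENNReal.ofReal ((2 * r) ^ (n - 1)) := by
          apply setLIntegral_mono' (hSm.inter measurableSet_Ioi)
          rintro s ⟨⟨_, hs⟩, hs0⟩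
          rw [mem_closedBall, Real.dist_eq, abs_le] at hs
          apply ENNReal.ofReal_le_ofReal
          exact pow_le_pow_left₀ (le_of_lt hs0) (by linarith [hs.2]) _
      _ ≤ _ := by
          rw [setLIntegral_const]
          exact mul_le_mul' le_rfl (measure_mono inter_subset_left)
  have e : c * (3 / r) ^ (n - 1) * (2 * r) ^ (n - 1) * ρ ^ (n - 1) =
      (c * (3 / r * ρ) ^ (n - 1)) * (2 * r) ^ (n - 1) := by
    rw [mul_pow (3/r)]; ring
  rw [e, ENNReal.ofReal_mul (by positivity), mul_assoc]
  gcongr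


/-! ## Part 3 -/
open MeasureTheory Metric Set Filter
open scoped ENNReal NNReal Topology RealInnerProductSpace

/-- `S ⊆ ℝ` has density zero at `x` (quantitative form). -/
def D0 (S : Set ℝ) (x : ℝ) : Prop :=
  ∀ ε : ℝ, 0 < ε → ∀ᶠ ρ in 𝓝[>] (0:ℝ), volume (S ∩ closedBall x ρ) ≤ ENNReal.ofReal (ε * ρ)

lemma D0.mono {S T : Set ℝ} {x : ℝ} (h : D0 T x) (hST : S ⊆ T) : D0 S x := by
  intro ε hε
  filter_upwards [h ε hε] with ρ hρ
  exact (measure_mono (inter_subset_inter_left _ hST)).trans hρ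

lemma D0_ae {M : Set ℝ} (hM : MeasurableSet M) : ∀ᵐ x : ℝ, x ∉ M → D0 M x := by
  filter_upwards [Besicovitch.ae_tendsto_measure_inter_div_of_measurableSet volume hM] with x hx hxM
  rw [indicator_of_notMem hxM] at hx
  intro ε hε
  have h1 : ∀ᶠ ρ in 𝓝[>] (0:ℝ), volume (M ∩ closedBall x ρ) / volume (closedBall x ρ) <
      ENNReal.ofReal (ε / 2) :=
    hx.eventually_lt_const (ENNReal.ofReal_pos.mpr (by positivity))
  filter_upwards [h1, self_mem_nhdsWithin] with ρ h hρ
  have hρ : 0 < ρ := hρ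
  rw [Real.volume_closedBall] at h
  have := (ENNReal.div_le_iff (ENNReal.ofReal_pos.mpr (by positivity)).ne'
    ENNReal.ofReal_ne_top).mp h.le
  rw [← ENNReal.ofReal_mul (by positivity)] at this
  convert this using 2
  ring

lemma intIntegrable_ind {S : Set ℝ} (hS : MeasurableSet S) (a b : ℝ) :
    IntervalIntegrable (S.indicator (fun _ => (1:ℝ))) volume a b := by
  rw [intervalIntegrable_iff]
  exact (integrableOn_const (by simp)).indicator hS

lemma D0.hasDerivAt {S : Set ℝ} (hS : MeasurableSet S) {x : ℝ} (h : D0 S x) (a : ℝ) :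
    HasDerivAt (fun y => ∫ t in a..y, S.indicator (fun _ => (1:ℝ)) t) 0 x := by
  rw [hasDerivAt_iff_isLittleO, Asymptotics.isLittleO_iff]
  intro ε hε
  have h1 := h ε hε
  rw [eventually_nhdsWithin_iff, Metric.eventually_nhds_iff] at h1
  obtain ⟨δ, hδ, h1⟩ := h1
  rw [Metric.eventually_nhds_iff]
  refine ⟨δ, hδ, fun y hy => ?_⟩
  simp only [smul_zero, sub_zero]
  rw [intervalIntegral.integral_interval_sub_left (intIntegrable_ind hS _ _)
    (intIntegrable_ind hS _ _)]
  rcases eq_or_ne y x with rfl | hyx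
  · simp
  have hpos : 0 < |y - x| := abs_pos.mpr (sub_ne_zero.mpr hyx)
  have h2 := h1 (y := |y - x|) (by rw [Real.dist_eq] at *; simpa using hy) hpos
  have h3 : ‖∫ t in x..y, S.indicator (fun _ => (1:ℝ)) t‖ ≤ (volume (S ∩ closedBall x |y-x|)).toReal := by
    rw [intervalIntegral.norm_intervalIntegral_eq]
    rw [setIntegral_indicator hS, setIntegral_const, smul_eq_mul, mul_one, Real.norm_eq_abs,
      abs_of_nonneg measureReal_nonneg]
    refine measureReal_mono ?_ ?_
    · rintro t ⟨ht, htS⟩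
      refine ⟨htS, ?_⟩
      rw [mem_closedBall, Real.dist_eq]
      have := abs_sub_left_of_mem_uIcc (uIoc_subset_uIcc ht)
      exact this
    · exact measure_ne_top_of_subset inter_subset_right
        (by rw [Real.volume_closedBall]; exact ENNReal.ofReal_ne_top)
  refine h3.trans ?_
  rw [Real.norm_eq_abs]
  exact ENNReal.toReal_le_of_le_ofReal (by positivity) h2

lemma D0.hasDerivAt_compl {S : Set ℝ} (hS : MeasurableSet S) {x : ℝ} (h : D0 Sᶜ x) (a : ℝ) :
    HasDerivAt (fun y => ∫ t in a..y, S.indicator (fun _ => (1:ℝ)) t) 1 x := by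
  have h1 := h.hasDerivAt hS.compl a
  have h2 := ((hasDerivAt_id x).sub_const a).sub h1
  rw [sub_zero] at h2
  refine h2.congr_of_eventuallyEq (Eventually.of_forall fun y => ?_)
  simp only [Pi.sub_apply, id]
  have : (y - a) = ∫ t in a..y, (1:ℝ) := by simp
  rw [this, ← intervalIntegral.integral_sub (by simp) (intIntegrable_ind hS.compl _ _)]
  congr 1
  ext t
  by_cases ht : t ∈ S <;> simp [ht]

lemma darboux_aux {S : Set ℝ} (hS : MeasurableSet S) {r1 r2 : ℝ} (h12 : r1 < r2)
    (h1 : D0 S r1) (h2 : D0 Sᶜ r2) : ∃ r ∈ Ioo r1 r2, ¬ D0 S r ∧ ¬ D0 Sᶜ r := by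
  by_contra! hc
  classical
  set f := (fun y => ∫ t in r1..y, S.indicator (fun _ => (1:ℝ)) t) with hf
  have hex : ∀ x ∈ Icc r1 r2, D0 S x ∨ D0 Sᶜ x := by
    intro x hx
    rcases eq_or_lt_of_le hx.1 with rfl | h
    · left; exact h1
    rcases eq_or_lt_of_le hx.2 with rfl | h'
    · right; exact h2
    by_cases hd : D0 S x
    · left; exact hd
    · right; exact hc x ⟨h, h'⟩ hd
  have hder : ∀ x ∈ Icc r1 r2, HasDerivAt f (if D0 S x then 0 else 1) x := by
    intro x hx
    split_ifs with hd
    · exact hd.hasDerivAt hS r1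
    · exact ((hex x hx).resolve_left hd).hasDerivAt_compl hS r1
  have hnot : ¬ D0 S r2 := by
    intro hd
    have := (hd.hasDerivAt hS r1).unique (h2.hasDerivAt_compl hS r1)
    norm_num at this
  obtain ⟨x, hx, hx2⟩ := exists_hasDerivWithinAt_eq_of_gt_of_lt h12.le
    (fun x hx => (hder x hx).hasDerivWithinAt) (m := 1/2) (by simp [h1]) (by simp [hnot]; norm_num)
  simp only at hx2
  split_ifs at hx2 <;> norm_num at hx2

lemma darboux {S : Set ℝ} (hS : MeasurableSet S) {r1 r2 : ℝ} (h12 : r1 < r2)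
    (h : (D0 S r1 ∧ D0 Sᶜ r2) ∨ (D0 Sᶜ r1 ∧ D0 S r2)) : ∃ r ∈ Ioo r1 r2, ¬ D0 S r ∧ ¬ D0 Sᶜ r := by
  rcases h with ⟨h1, h2⟩ | ⟨h1, h2⟩
  · exact darboux_aux hS h12 h1 h2
  · obtain ⟨r, hr, ha, hb⟩ := darboux_aux hS.compl h12 h1 (by rwa [compl_compl])
    rw [compl_compl] at hb
    exact ⟨r, hr, hb, ha⟩

/-- Points of approximate continuity. -/
def ApGood (α : ℝ → ℝ) (r : ℝ) : Prop :=
  ∀ q : ℚ, (α r ≤ q → D0 {s | (q:ℝ) < α s} r) ∧ ((q:ℝ) < α r → D0 {s | α s ≤ q} r)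

lemma apGood_ae {α : ℝ → ℝ} (hα : Measurable α) : ∀ᵐ r : ℝ, ApGood α r := by
  unfold ApGood
  rw [ae_all_iff]
  intro q
  filter_upwards [D0_ae (measurableSet_lt measurable_const hα : MeasurableSet {s | (q:ℝ) < α s}),
    D0_ae (measurableSet_le hα measurable_const : MeasurableSet {s | α s ≤ (q:ℝ)})] with r h1 h2
  refine ⟨fun h => h1 (by simpa using h), fun h => h2 (by simpa using h)⟩

lemma ApGood.lt {α : ℝ → ℝ} {r t : ℝ} (h : ApGood α r) (ht : α r < t) : D0 {s | t < α s} r := by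
  obtain ⟨q, h1, h2⟩ := exists_rat_btwn ht
  refine ((h q).1 h1.le).mono fun s hs => ?_
  exact h2.trans hs

lemma ApGood.gt {α : ℝ → ℝ} {r t : ℝ} (h : ApGood α r) (ht : t < α r) : D0 {s | α s ≤ t} r := by
  obtain ⟨q, h1, h2⟩ := exists_rat_btwn ht
  refine ((h q).2 h2).mono fun s hs => ?_
  exact (le_trans hs h1.le)


/-! ## Part 4 -/
open MeasureTheory Metric Set Filter
open scoped ENNReal NNReal Topology RealInnerProductSpace

/-- The orthogonal complement of the plane spanned by `p` and `σ`. -/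
noncomputable abbrev Wsp {n : ℕ} (p σ : Euc n) : Submodule ℝ (Euc n) := (Submodule.span ℝ {p, σ})ᗮ

lemma mem_Wsp {n : ℕ} {p σ y : Euc n} : y ∈ Wsp p σ ↔ ⟪p, y⟫ = 0 ∧ ⟪σ, y⟫ = 0 := by
  rw [Submodule.mem_orthogonal]
  constructor
  · intro h
    exact ⟨h p (Submodule.subset_span (by simp)), h σ (Submodule.subset_span (by simp))⟩
  · rintro ⟨h1, h2⟩ u hu
    obtain ⟨a, b, rfl⟩ := Submodule.mem_span_pair.mp hu
    rw [inner_add_left, inner_smul_left, inner_smul_left, h1, h2]; simp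

lemma finrank_Wsp {n : ℕ} {p σ : Euc n} (hp : ‖p‖ = 1) (hσ : ‖σ‖ = 1) (h : ⟪p, σ⟫ = 0) :
    Module.finrank ℝ (Wsp p σ) + 2 = n := by
  have hli : LinearIndependent ℝ ![p, σ] := by
    rw [LinearIndependent.pair_iff]
    intro s t hst
    have h1 : ⟪p, s • p + t • σ⟫ = 0 := by rw [hst, inner_zero_right]
    have h2 : ⟪σ, s • p + t • σ⟫ = 0 := by rw [hst, inner_zero_right]
    rw [inner_add_right, inner_smul_right, inner_smul_right, h, real_inner_self_eq_norm_sq, hp] at h1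
    rw [inner_add_right, inner_smul_right, inner_smul_right, real_inner_comm, h, real_inner_self_eq_norm_sq, hσ] at h2
    constructor <;> linarith
  have h1 := finrank_span_eq_card hli
  have h2 := Submodule.finrank_add_finrank_orthogonal (Submodule.span ℝ {p, σ})
  rw [Matrix.range_cons, Matrix.range_cons, Matrix.range_empty, union_empty] at h1
  rw [show ({p} ∪ {σ} : Set (Euc n)) = {p, σ} from rfl] at h1
  rw [h1, finrank_euclideanSpace_fin, Fintype.card_fin] at h2
  show Module.finrank ℝ (Submodule.span ℝ {p, σ})ᗮ + 2 = n
  omega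

lemma chart_meas {n : ℕ} {p σ : Euc n} (hp : ‖p‖ = 1) (hσ : ‖σ‖ = 1) (h : ⟪p, σ⟫ = 0) :
    ∃ c : ℝ≥0, c ≠ 0 ∧ ∀ (T : Set ℝ) (B : Set (Wsp p σ)),
      μH[(n:ℝ) - 1] (T ×ˢ B) = c * (volume T * volume B) := by
  have hf : ((Module.finrank ℝ (ℝ × Wsp p σ) : ℕ) : ℝ) = (n:ℝ) - 1 := by
    have := finrank_Wsp hp hσ h
    have h3 : ((Module.finrank ℝ (Wsp p σ) + 2 : ℕ) : ℝ) = n := by exact_mod_cast this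
    rw [Module.finrank_prod, Module.finrank_self, ← h3]; push_cast; ring
  have h1 : (μH[(n:ℝ) - 1] : Measure (ℝ × Wsp p σ)).IsAddHaarMeasure := by
    rw [← hf]; exact isAddHaarMeasure_hausdorffMeasure
  obtain ⟨c, h2⟩ : ∃ c : ℝ≥0, (μH[(n:ℝ) - 1] : Measure (ℝ × Wsp p σ)) =
      c • ((volume : Measure ℝ).prod (volume : Measure (Wsp p σ))) :=
    ⟨_, Measure.isAddLeftInvariant_eq_smul _ _⟩
  refine ⟨c, ?_, fun T B => ?_⟩
  · rintro rfl
    rw [zero_smul] at h2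
    exact NeZero.ne (μH[(n:ℝ) - 1] : Measure (ℝ × Wsp p σ)) h2
  · rw [h2, Measure.smul_apply, Measure.prod_prod]
    rfl

lemma norm_sig_add {n : ℕ} {p σ : Euc n} (hσ : ‖σ‖ = 1) (y : Wsp p σ) :
    ‖σ + (y : Euc n)‖ ^ 2 = 1 + ‖y‖ ^ 2 := by
  have := (mem_Wsp.mp y.2).2
  rw [norm_add_sq_real, this, hσ]; simp

lemma one_le_sig {n : ℕ} {p σ : Euc n} (hσ : ‖σ‖ = 1) (y : Wsp p σ) : 1 ≤ ‖σ + (y : Euc n)‖ := by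
  have := norm_sig_add hσ y
  nlinarith [sq_nonneg ‖y‖, norm_nonneg (σ + (y : Euc n))]

lemma sig_ne {n : ℕ} {p σ : Euc n} (hσ : ‖σ‖ = 1) (y : Wsp p σ) : σ + (y : Euc n) ≠ 0 := by
  rw [← norm_pos_iff]; linarith [one_le_sig hσ y]

lemma inner_p_N {n : ℕ} {p σ : Euc n} (h : ⟪p, σ⟫ = 0) (y : Wsp p σ) :
    ⟪p, hatv (σ + (y : Euc n))⟫ = 0 := by
  unfold hatv
  rw [inner_smul_right, inner_add_right, h, (mem_Wsp.mp y.2).1]; simp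

lemma exists_perp {n : ℕ} (hn : 2 ≤ n) {p : Euc n} (hp : ‖p‖ = 1) :
    ∃ σ : Euc n, ‖σ‖ = 1 ∧ ⟪p, σ⟫ = 0 := by
  have h := Submodule.finrank_add_finrank_orthogonal (Submodule.span ℝ {p})
  have hp0 : p ≠ 0 := by rintro rfl; simp at hp
  rw [finrank_span_singleton hp0] at h
  simp at h
  have : Nontrivial (Submodule.span ℝ {p})ᗮ := Module.nontrivial_of_finrank_pos (R := ℝ) (by omega)
  obtain ⟨y, hy⟩ := exists_ne (0 : (Submodule.span ℝ {p})ᗮ)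
  have hy0 : (y : Euc n) ≠ 0 := by simpa using hy
  refine ⟨hatv y, norm_hatv hy0, ?_⟩
  unfold hatv
  rw [inner_smul_right, Submodule.mem_orthogonal_singleton_iff_inner_right.mp y.2, mul_zero]

/-- The rotated graph over a parameter set. -/
def rotGraph {n : ℕ} (p : Euc n) (T : Set ℝ) (R Θ : ℝ → ℝ) : Set (Euc n) :=
  {x | x ≠ 0 ∧ 0 < ang p x ∧ ang p x < Real.pi ∧ ∃ t ∈ T, ‖x‖ = R t ∧ ang p x = Θ t}

/-- Chart of the rotated graph. -/
noncomputable def chartU {n : ℕ} (p σ : Euc n) (R Θ : ℝ → ℝ) (z : ℝ × Wsp p σ) : Euc n :=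
  R z.1 • (Real.cos (Θ z.1) • p + Real.sin (Θ z.1) • hatv (σ + (z.2 : Euc n)))

lemma chartU_lip {n : ℕ} {p σ : Euc n} (hp : ‖p‖ = 1) (hσ : ‖σ‖ = 1)
    {R Θ : ℝ → ℝ} {T : Set ℝ} {L : ℝ≥0} {M : ℝ} (hM : 0 ≤ M) (hR : ∀ t ∈ T, |R t| ≤ M)
    (hRL : LipschitzOnWith L R T) (hTL : LipschitzOnWith L Θ T) (B : Set (Wsp p σ)) :
    LipschitzOnWith (2 * L + M.toNNReal * (2 * L + 2)) (chartU p σ R Θ) (T ×ˢ B) := by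
  refine LipschitzOnWith.of_dist_le_mul ?_
  rintro ⟨t, y⟩ ⟨ht, -⟩ ⟨s, z⟩ ⟨hs, -⟩
  simp only at ht hs
  have hR1 := hRL.dist_le_mul t ht s hs
  have hT1 := hTL.dist_le_mul t ht s hs
  rw [Real.dist_eq] at hR1 hT1
  have hd1 : dist t s ≤ dist (t, y) (s, z) := le_max_left _ _
  have hd2 : dist y z ≤ dist (t, y) (s, z) := le_max_right _ _
  set d := dist (t, y) (s, z)
  have hN : ‖hatv (σ + (y : Euc n)) - hatv (σ + (z : Euc n))‖ ≤ 2 * d := by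
    refine (hatv_lip (sig_ne hσ y) _).trans ?_
    have e : σ + (y : Euc n) - (σ + (z : Euc n)) = ((y - z : Wsp p σ) : Euc n) := by
      push_cast; abel
    rw [e, ← Submodule.coe_norm, ← dist_eq_norm]
    have : 2 / ‖σ + (y : Euc n)‖ ≤ 2 := by
      rw [div_le_iff₀ (by linarith [one_le_sig hσ y])]; linarith [one_le_sig hσ y]
    have h0 : 0 ≤ d := dist_nonneg
    gcongr
  have hNy := norm_hatv (sig_ne hσ y)
  have hNz := norm_hatv (sig_ne hσ z)
  have hc : |Real.cos (Θ t) - Real.cos (Θ s)| ≤ |Θ t - Θ s| := by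
    have := Real.lipschitzWith_cos.dist_le_mul (Θ t) (Θ s)
    rw [Real.dist_eq, Real.dist_eq] at this; simpa using this
  have hs' : |Real.sin (Θ t) - Real.sin (Θ s)| ≤ |Θ t - Θ s| := by
    have := Real.lipschitzWith_sin.dist_le_mul (Θ t) (Θ s)
    rw [Real.dist_eq, Real.dist_eq] at this; simpa using this
  unfold chartU
  simp only
  set Ny := hatv (σ + (y : Euc n))
  set Nz := hatv (σ + (z : Euc n))
  rw [dist_eq_norm]
  have e : R t • (Real.cos (Θ t) • p + Real.sin (Θ t) • Ny) - R s • (Real.cos (Θ s) • p + Real.sin (Θ s) • Nz)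
      = ((R t - R s) * Real.cos (Θ t)) • p + ((R t - R s) * Real.sin (Θ t)) • Ny
        + (R s * (Real.cos (Θ t) - Real.cos (Θ s))) • p + (R s * (Real.sin (Θ t) - Real.sin (Θ s))) • Ny
        + (R s * Real.sin (Θ s)) • (Ny - Nz) := by
    module
  rw [e]
  have hLd : |R t - R s| ≤ L * d := hR1.trans (by gcongr)
  have hLd2 : |Θ t - Θ s| ≤ L * d := hT1.trans (by gcongr)
  have hRs := hR s hs
  have hd0 : 0 ≤ d := dist_nonneg
  have hc1 := Real.abs_cos_le_one (Θ t)
  have hs1 := Real.abs_sin_le_one (Θ t)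
  have hs2 := Real.abs_sin_le_one (Θ s)
  have a1 : ‖((R t - R s) * Real.cos (Θ t)) • p‖ ≤ (L * d) * 1 := by
    rw [norm_smul, hp, mul_one, Real.norm_eq_abs, abs_mul]; gcongr
  have a2 : ‖((R t - R s) * Real.sin (Θ t)) • Ny‖ ≤ (L * d) * 1 := by
    rw [norm_smul, hNy, mul_one, Real.norm_eq_abs, abs_mul]; gcongr
  have a3 : ‖(R s * (Real.cos (Θ t) - Real.cos (Θ s))) • p‖ ≤ M * (L * d) := by
    rw [norm_smul, hp, mul_one, Real.norm_eq_abs, abs_mul]; gcongr; linarith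
  have a4 : ‖(R s * (Real.sin (Θ t) - Real.sin (Θ s))) • Ny‖ ≤ M * (L * d) := by
    rw [norm_smul, hNy, mul_one, Real.norm_eq_abs, abs_mul]; gcongr; linarith
  have a5 : ‖(R s * Real.sin (Θ s)) • (Ny - Nz)‖ ≤ (M * 1) * (2 * d) := by
    rw [norm_smul, Real.norm_eq_abs, abs_mul]; gcongr
  refine (norm_add_le _ _).trans ((add_le_add_left ((norm_add_le _ _).trans (add_le_add_left
    ((norm_add_le _ _).trans (add_le_add_left (norm_add_le _ _) _)) _)) _).trans ?_)
  push_cast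
  rw [Real.coe_toNNReal _ hM]
  nlinarith

lemma finite_cover {n : ℕ} :
    ∃ t : Finset (Euc n), (∀ σ ∈ t, ‖σ‖ = 1) ∧ ∀ x : Euc n, ‖x‖ = 1 → ∃ σ ∈ t, (1/2 : ℝ) < ⟪x, σ⟫ := by
  have hc : IsCompact (sphere (0 : Euc n) 1) := isCompact_sphere _ _
  obtain ⟨t, ht, hcov⟩ := hc.elim_nhds_subcover (fun σ => {x | (1/2:ℝ) < ⟪x, σ⟫}) (by
    intro x hx
    refine IsOpen.mem_nhds (isOpen_lt continuous_const (by fun_prop)) ?_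
    have : ‖x‖ = 1 := by simpa using hx
    simp only [mem_setOf_eq]
    rw [real_inner_self_eq_norm_sq, this]; norm_num)
  refine ⟨t, fun σ hσ => by simpa using ht σ hσ, fun x hx => ?_⟩
  have := hcov (show x ∈ sphere (0 : Euc n) 1 by simpa using hx)
  simpa using this

lemma rotGraph_piece {n : ℕ} (hn : 2 ≤ n) {p σ : Euc n} (hp : ‖p‖ = 1) (hσ : ‖σ‖ = 1)
    (hpσ : ⟪p, σ⟫ = 0) (L : ℝ≥0) (M : ℝ) (hM : 0 ≤ M) :
    ∃ C : ℝ≥0, ∀ (T : Set ℝ) (R Θ : ℝ → ℝ), (∀ t ∈ T, |R t| ≤ M) → LipschitzOnWith L R T →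
      LipschitzOnWith L Θ T →
      μH[(n:ℝ) - 1] {x : Euc n | ∃ t ∈ T, ∃ τ : Euc n, ‖τ‖ = 1 ∧ ⟪p, τ⟫ = 0 ∧ (1/4 : ℝ) < ⟪τ, σ⟫ ∧
        x = R t • (Real.cos (Θ t) • p + Real.sin (Θ t) • τ)} ≤ C * volume T := by
  obtain ⟨c, hc, hch⟩ := chart_meas hp hσ hpσ
  have hn1 : (0:ℝ) ≤ (n:ℝ) - 1 := by
    have : (2:ℝ) ≤ n := by exact_mod_cast hn
    linarith
  set K : ℝ≥0 := 2 * L + M.toNNReal * (2 * L + 2)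
  have hB : volume (closedBall (0 : Wsp p σ) 4) < ⊤ := measure_closedBall_lt_top
  refine ⟨K ^ ((n:ℝ) - 1) * (c * (volume (closedBall (0 : Wsp p σ) 4)).toNNReal), ?_⟩
  intro T R Θ hR hRL hTL
  have hlip : LipschitzOnWith K _ _ := chartU_lip hp hσ hM hR hRL hTL (closedBall (0 : Wsp p σ) 4)
  have h1 := hlip.hausdorffMeasure_image_le hn1
  rw [hch] at h1
  refine (measure_mono ?_).trans (h1.trans (le_of_eq ?_))
  · rintro x ⟨t, ht, τ, hτ, hpτ, hτσ, rfl⟩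
    set s := ⟪τ, σ⟫ with hs
    have hs0 : 0 < s := by linarith
    have hy : s⁻¹ • (τ - s • σ) ∈ Wsp p σ := by
      rw [mem_Wsp]
      constructor
      · rw [inner_smul_right, inner_sub_right, inner_smul_right, hpτ, hpσ]; simp
      · rw [inner_smul_right, inner_sub_right, inner_smul_right, real_inner_comm, ← hs,
          real_inner_self_eq_norm_sq, hσ]; simp
    refine ⟨(t, ⟨_, hy⟩), ⟨ht, ?_⟩, ?_⟩
    · rw [mem_closedBall, dist_zero_right, Submodule.coe_norm, norm_smul, norm_inv,
        Real.norm_of_nonneg hs0.le]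
      have h3 : ‖τ - s • σ‖ ^ 2 ≤ 1 := by
        rw [norm_sub_sq_real, inner_smul_right, ← hs, hτ, norm_smul, hσ, Real.norm_of_nonneg hs0.le]
        nlinarith
      have h4 : ‖τ - s • σ‖ ≤ 1 := by nlinarith [norm_nonneg (τ - s • σ)]
      have h5 : s⁻¹ ≤ 4 := by
        rw [inv_le_comm₀ hs0 (by norm_num)]; linarith
      calc s⁻¹ * ‖τ - s • σ‖ ≤ 4 * 1 := by gcongr
        _ = 4 := by norm_num
    · unfold chartU
      simp only
      have e : σ + s⁻¹ • (τ - s • σ) = s⁻¹ • τ := by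
        rw [smul_sub, smul_smul, inv_mul_cancel₀ hs0.ne', one_smul]; abel
      rw [e, hatv_smul (inv_pos.mpr hs0), hatv_of_norm_one hτ]
  · push_cast
    rw [ENNReal.coe_toNNReal hB.ne, ENNReal.coe_rpow_of_nonneg _ hn1]
    ring

/-- Upper bound: rotated Lipschitz curves. -/
lemma rotGraph_upper {n : ℕ} (hn : 2 ≤ n) {p : Euc n} (hp : ‖p‖ = 1) (L : ℝ≥0) (M : ℝ)
    (hM : 0 ≤ M) :
    ∃ C : ℝ≥0, ∀ (T : Set ℝ) (R Θ : ℝ → ℝ), (∀ t ∈ T, |R t| ≤ M) → LipschitzOnWith L R T →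
      LipschitzOnWith L Θ T → μH[(n:ℝ) - 1] (rotGraph p T R Θ) ≤ C * volume T := by
  classical
  obtain ⟨F, hF1, hF⟩ := finite_cover (n := n)
  -- project the directions
  have key : ∀ σ ∈ F, ∃ C : ℝ≥0, ∀ (T : Set ℝ) (R Θ : ℝ → ℝ), (∀ t ∈ T, |R t| ≤ M) →
      LipschitzOnWith L R T → LipschitzOnWith L Θ T →
      μH[(n:ℝ) - 1] {x : Euc n | ∃ t ∈ T, ∃ τ : Euc n, ‖τ‖ = 1 ∧ ⟪p, τ⟫ = 0 ∧ (1/2 : ℝ) < ⟪τ, σ⟫ ∧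
        x = R t • (Real.cos (Θ t) • p + Real.sin (Θ t) • τ)} ≤ C * volume T := by
    intro σ hσF
    have hσ := hF1 σ hσF
    set b := ⟪p, σ⟫ with hb
    by_cases h0 : σ - b • p = 0
    · refine ⟨0, fun T R Θ _ _ _ => ?_⟩
      have : {x : Euc n | ∃ t ∈ T, ∃ τ : Euc n, ‖τ‖ = 1 ∧ ⟪p, τ⟫ = 0 ∧ (1/2 : ℝ) < ⟪τ, σ⟫ ∧
        x = R t • (Real.cos (Θ t) • p + Real.sin (Θ t) • τ)} = ∅ := by
        rw [eq_empty_iff_forall_notMem]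
        rintro x ⟨t, ht, τ, hτ, hpτ, hh, -⟩
        rw [sub_eq_zero.mp h0, inner_smul_right, real_inner_comm, hpτ] at hh
        norm_num at hh
      rw [this]; simp
    · have hσ1 := norm_hatv h0
      have hpo : ⟪p, σ - b • p⟫ = 0 := by
        rw [inner_sub_right, inner_smul_right, real_inner_self_eq_norm_sq, hp, ← hb]; ring
      have hpo2 : ⟪p, hatv (σ - b • p)⟫ = 0 := by
        unfold hatv; rw [inner_smul_right, hpo, mul_zero]
      obtain ⟨C, hC⟩ := rotGraph_piece hn hp hσ1 hpo2 L M hM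
      refine ⟨C, fun T R Θ h1 h2 h3 => (measure_mono ?_).trans (hC T R Θ h1 h2 h3)⟩
      rintro x ⟨t, ht, τ, hτ, hpτ, hh, hx⟩
      refine ⟨t, ht, τ, hτ, hpτ, ?_, hx⟩
      unfold hatv
      rw [inner_smul_right, inner_sub_right, inner_smul_right, real_inner_comm p τ, hpτ, mul_zero,
        sub_zero]
      have hle : ‖σ - b • p‖ ≤ 2 := by
        refine (norm_sub_le _ _).trans ?_
        rw [norm_smul, hp, hσ]
        have := abs_real_inner_le_norm p σ
        rw [hp, hσ] at this
        rw [Real.norm_eq_abs]; linarith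
      have hpos := norm_pos_iff.mpr h0
      rw [inv_mul_eq_div, lt_div_iff₀ hpos]
      nlinarith
  choose! C hC using key
  refine ⟨∑ σ ∈ F, C σ, fun T R Θ h1 h2 h3 => ?_⟩
  have hsub : rotGraph p T R Θ ⊆ ⋃ σ ∈ F, {x : Euc n | ∃ t ∈ T, ∃ τ : Euc n, ‖τ‖ = 1 ∧ ⟪p, τ⟫ = 0 ∧
      (1/2 : ℝ) < ⟪τ, σ⟫ ∧ x = R t • (Real.cos (Θ t) • p + Real.sin (Θ t) • τ)} := by
    rintro x ⟨hx0, ha, hb, t, ht, hr, hθ⟩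
    obtain ⟨τ, hτ, hpτ, hxe⟩ := exists_polar hp hx0 ha hb
    obtain ⟨σ, hσF, hσ⟩ := hF τ hτ
    refine mem_biUnion hσF ⟨t, ht, τ, hτ, hpτ, hσ, ?_⟩
    rw [← hr, ← hθ, ← hxe, smul_hatv]
  refine (measure_mono hsub).trans ((measure_biUnion_finset_le _ _).trans ?_)
  push_cast
  rw [Finset.sum_mul]
  exact Finset.sum_le_sum fun σ hσ => hC σ hσ T R Θ h1 h2 h3

/-- Lower bound for rotated sets of angles. -/
lemma rot_lower {n : ℕ} (hn : 2 ≤ n) {p : Euc n} (hp : ‖p‖ = 1) {ε : ℝ} (hε : 0 < ε) :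
    ∃ c : ℝ≥0, c ≠ 0 ∧ ∀ T : Set ℝ, T ⊆ Icc ε (Real.pi - ε) →
      c * volume T ≤ μH[(n:ℝ) - 1] {x : Euc n | ‖x‖ = 1 ∧ ang p x ∈ T} := by
  by_cases hε2 : ε ≤ Real.pi - ε
  swap
  · refine ⟨1, one_ne_zero, fun T hT => ?_⟩
    have : T = ∅ := by
      rw [eq_empty_iff_forall_notMem]
      intro t ht
      have := hT ht
      exact hε2 (this.1.trans this.2)
    rw [this]; simp
  obtain ⟨σ, hσ, hpσ⟩ := exists_perp hn hp
  obtain ⟨c, hc, hch⟩ := chart_meas hp hσ hpσ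
  have hn1 : (0:ℝ) ≤ (n:ℝ) - 1 := by
    have : (2:ℝ) ≤ n := by exact_mod_cast hn
    linarith
  have hsε : 0 < Real.sin ε := Real.sin_pos_of_pos_of_lt_pi hε (by linarith)
  set c0 := Real.sin ε / 2 with hc0
  have hc0p : 0 < c0 := by positivity
  set P := (Wsp p σ).orthogonalProjectionOnto with hP
  set Ψ : Euc n → ℝ × Wsp p σ := fun x => (ang p x, (⟪x, σ⟫)⁻¹ • P x) with hΨ
  set K : ℝ≥0 := ⟨max (Real.pi / 2) (1 / c0 + 1 / c0 ^ 2), by positivity⟩ with hK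
  have hK0 : 0 < K := by
    have : 0 < Real.pi / 2 := by positivity
    rw [← NNReal.coe_pos]
    exact lt_of_lt_of_le this (le_max_left _ _)
  have hlip : LipschitzOnWith K Ψ {x : Euc n | ‖x‖ = 1 ∧ c0 ≤ ⟪x, σ⟫} := by
    refine LipschitzOnWith.of_dist_le_mul ?_
    rintro x ⟨hx, hxs⟩ y ⟨hy, hys⟩
    rw [Prod.dist_eq, dist_eq_norm x y]
    refine max_le ?_ ?_
    · rw [Real.dist_eq]
      refine (ang_lip hp hx hy).trans ?_
      gcongr
      exact le_max_left _ _
    · simp only [hΨ]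
      rw [dist_eq_norm]
      have hxs0 : 0 < ⟪x, σ⟫ := by linarith
      have hys0 : 0 < ⟪y, σ⟫ := by linarith
      have e : (⟪x, σ⟫)⁻¹ • P x - (⟪y, σ⟫)⁻¹ • P y =
          (⟪x, σ⟫)⁻¹ • P (x - y) + ((⟪x, σ⟫)⁻¹ * (⟪y, σ⟫)⁻¹ * ⟪y - x, σ⟫) • P y := by
        rw [map_sub, smul_sub, inner_sub_left]
        have : (⟪x, σ⟫)⁻¹ * (⟪y, σ⟫)⁻¹ * (⟪y, σ⟫ - ⟪x, σ⟫) = (⟪x, σ⟫)⁻¹ - (⟪y, σ⟫)⁻¹ := by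
          field_simp
        rw [this, sub_smul]; abel
      rw [e]
      refine (norm_add_le _ _).trans ?_
      rw [norm_smul, norm_smul, norm_mul, norm_mul, norm_inv, norm_inv, Real.norm_of_nonneg hxs0.le,
        Real.norm_of_nonneg hys0.le]
      have h1 : ‖P (x - y)‖ ≤ ‖x - y‖ := Submodule.norm_orthogonalProjectionOnto_apply_le _ _
      have h2 : ‖P y‖ ≤ 1 := hy ▸ Submodule.norm_orthogonalProjectionOnto_apply_le _ _
      have h3 : ‖⟪y - x, σ⟫‖ ≤ ‖x - y‖ := by
        have := abs_real_inner_le_norm (y - x) σ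
        rw [hσ, mul_one, norm_sub_rev] at this; exact this
      have h4 : (⟪x, σ⟫)⁻¹ ≤ 1 / c0 := by rw [one_div]; gcongr
      have h5 : (⟪y, σ⟫)⁻¹ ≤ 1 / c0 := by rw [one_div]; gcongr
      calc _ ≤ 1 / c0 * ‖x - y‖ + (1 / c0 * (1 / c0) * ‖x - y‖) * 1 := by gcongr
        _ = (1 / c0 + 1 / c0 ^ 2) * ‖x - y‖ := by ring
        _ ≤ _ := by gcongr; exact le_max_right _ _
  set b := volume (closedBall (0 : Wsp p σ) 1) with hb
  have hb1 : b ≠ ⊤ := measure_closedBall_lt_top.ne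
  have hb0 : b ≠ 0 := (measure_closedBall_pos _ _ one_pos).ne'
  refine ⟨(K ^ ((n:ℝ) - 1))⁻¹ * (c * b.toNNReal), ?_, fun T hT => ?_⟩
  · have : b.toNNReal ≠ 0 := by
      rw [Ne, ENNReal.toNNReal_eq_zero_iff]; tauto
    have := (NNReal.rpow_pos (p := (n:ℝ) - 1) hK0).ne'
    positivity
  have h1 := (hlip.mono (s := {x : Euc n | (‖x‖ = 1 ∧ c0 ≤ ⟪x, σ⟫) ∧ ang p x ∈ T})
    (fun x hx => hx.1)).hausdorffMeasure_image_le hn1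
  have hsub : T ×ˢ closedBall (0 : Wsp p σ) 1 ⊆
      Ψ '' {x : Euc n | (‖x‖ = 1 ∧ c0 ≤ ⟪x, σ⟫) ∧ ang p x ∈ T} := by
    rintro ⟨t, y⟩ ⟨ht, hy⟩
    simp only at ht hy
    rw [mem_closedBall, dist_zero_right] at hy
    have htI := hT ht
    have hN := norm_hatv (sig_ne hσ y)
    have hpN := inner_p_N hpσ y
    obtain ⟨hx1, hxa⟩ := ang_polar hp hN hpN (t := t) (by linarith [htI.1]) (by linarith [htI.2])
    have hq1 := one_le_sig hσ y
    have hq2 : ‖σ + (y : Euc n)‖ ≤ 2 := by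
      refine (norm_add_le _ _).trans ?_
      rw [hσ, ← Submodule.coe_norm]; linarith
    have hst : Real.sin ε ≤ Real.sin t := by
      by_cases h : t ≤ Real.pi / 2
      · exact Real.sin_le_sin_of_le_of_le_pi_div_two (by linarith) h htI.1
      · rw [← Real.sin_pi_sub t]
        exact Real.sin_le_sin_of_le_of_le_pi_div_two (by linarith) (by linarith) (by linarith [htI.2])
    set q := ‖σ + (y : Euc n)‖ with hq
    have hin : ⟪Real.cos t • p + Real.sin t • hatv (σ + (y : Euc n)), σ⟫ = Real.sin t * q⁻¹ := by
      unfold hatv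
      rw [inner_add_left, inner_smul_left, inner_smul_left, inner_smul_left, inner_add_left, hpσ,
        real_inner_self_eq_norm_sq, hσ, real_inner_comm, (mem_Wsp.mp y.2).2]
      simp [hq]
    have hPx : P (Real.cos t • p + Real.sin t • hatv (σ + (y : Euc n))) = (Real.sin t * q⁻¹) • y := by
      have hPp : P p = 0 := Submodule.orthogonalProjectionOnto_orthogonal_apply_eq_zero
        (Submodule.subset_span (by simp))
      have hPs : P σ = 0 := Submodule.orthogonalProjectionOnto_orthogonal_apply_eq_zero
        (Submodule.subset_span (by simp))
      have hPy : P (y : Euc n) = y := Submodule.orthogonalProjectionOnto_mem_subspace_eq_self y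
      unfold hatv
      rw [map_add, map_smul, map_smul, map_smul, map_add, hPp, hPs, hPy, ← hq, smul_smul]
      simp
    have hsp : 0 < Real.sin t := hsε.trans_le hst
    refine ⟨_, ⟨⟨hx1, ?_⟩, ?_⟩, ?_⟩
    · rw [hin, hc0, div_eq_mul_inv]; gcongr
    · rw [hxa]; exact ht
    · simp only [hΨ]
      rw [hxa, hin, hPx, smul_smul, inv_mul_cancel₀ (by positivity), one_smul]
  have h2 := (measure_mono hsub).trans h1
  rw [hch] at h2
  have h3 : (c : ℝ≥0∞) * (volume T * b) ≤ (K:ℝ≥0∞) ^ ((n:ℝ) - 1) *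
      μH[(n:ℝ) - 1] {x : Euc n | ‖x‖ = 1 ∧ ang p x ∈ T} := by
    refine h2.trans (mul_le_mul' le_rfl (measure_mono ?_))
    rintro x ⟨⟨h, -⟩, h'⟩
    exact ⟨h, h'⟩
  have hKp : (K ^ ((n:ℝ) - 1)) ≠ 0 := (NNReal.rpow_pos hK0).ne'
  push_cast
  rw [ENNReal.coe_toNNReal hb1, ENNReal.coe_inv hKp, mul_assoc,
    ENNReal.inv_mul_le_iff (by exact_mod_cast hKp) ENNReal.coe_ne_top, ENNReal.coe_rpow_of_nonneg _ hn1]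
  refine le_trans (le_of_eq ?_) h3
  ring


/-! ## Part 5 -/
open MeasureTheory Metric Set Filter
open scoped ENNReal NNReal Topology RealInnerProductSpace

lemma dim_pos {n : ℕ} (hn : 2 ≤ n) : (1:ℝ) ≤ (n:ℝ) - 1 := by
  have : (2:ℝ) ≤ n := by exact_mod_cast hn
  linarith

lemma axis_null {n : ℕ} (hn : 2 ≤ n) {p : Euc n} (hp : ‖p‖ = 1) {N : Set ℝ} (hN : volume N = 0) :
    μH[(n:ℝ) - 1] {x : Euc n | x ≠ 0 ∧ ‖x‖ ∈ N ∧ (ang p x = 0 ∨ ang p x = Real.pi)} = 0 := by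
  have h1 : ∀ q : Euc n, ‖q‖ = 1 → μH[(n:ℝ) - 1] ((fun r : ℝ => r • q) '' N) = 0 := by
    intro q hq
    have hl : LipschitzOnWith 1 (fun r : ℝ => r • q) N := by
      refine LipschitzOnWith.of_dist_le_mul fun a _ b _ => ?_
      rw [dist_eq_norm, ← sub_smul, norm_smul, hq, Real.dist_eq, Real.norm_eq_abs]; simp
    have h2 := hl.hausdorffMeasure_image_le (d := 1) zero_le_one
    rw [hausdorffMeasure_real, hN, mul_zero, nonpos_iff_eq_zero] at h2
    exact nonpos_iff_eq_zero.mp ((Measure.hausdorffMeasure_mono (dim_pos hn) _).trans h2.le)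
  refine measure_mono_null ?_ (measure_union_null (h1 p hp) (h1 (-p) (by rwa [norm_neg])))
  rintro x ⟨hx0, hxN, h | h⟩
  · left
    refine ⟨‖x‖, hxN, ?_⟩
    rw [ang_eq_angle hp, InnerProductGeometry.angle_eq_zero_iff] at h
    obtain ⟨-, r, hr, h⟩ := h
    have e : x = r⁻¹ • p := by rw [h, smul_smul, inv_mul_cancel₀ hr.ne', one_smul]
    have : ‖x‖ = r⁻¹ := by rw [e, norm_smul, hp, mul_one, Real.norm_of_nonneg (inv_pos.mpr hr).le]
    simp only
    rw [this, ← e]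
  · right
    refine ⟨‖x‖, hxN, ?_⟩
    rw [ang_eq_angle hp, InnerProductGeometry.angle_eq_pi_iff] at h
    obtain ⟨-, r, hr, h⟩ := h
    have e : x = (-r)⁻¹ • (-p) := by
      rw [h, inv_neg, neg_smul, smul_neg, neg_neg, smul_smul, inv_mul_cancel₀ hr.ne, one_smul]
    have : ‖x‖ = (-r)⁻¹ := by
      rw [e, norm_smul, norm_neg, hp, mul_one, Real.norm_of_nonneg (inv_pos.mpr (by linarith)).le]
    simp only
    rw [this, ← e]

lemma ne_zero_of_norm_one {n : ℕ} {x : Euc n} (hx : ‖x‖ = 1) : x ≠ 0 := by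
  rintro rfl; simp at hx

lemma band_upper {n : ℕ} (hn : 2 ≤ n) {p : Euc n} (hp : ‖p‖ = 1) :
    ∃ C : ℝ≥0, ∀ T : Set ℝ, μH[(n:ℝ) - 1] {x : Euc n | ‖x‖ = 1 ∧ ang p x ∈ T} ≤ C * volume T := by
  obtain ⟨C, hC⟩ := rotGraph_upper hn hp 1 1 zero_le_one
  refine ⟨C, fun T => ?_⟩
  have h1 := hC T (fun _ => 1) id (by simp) (LipschitzWith.const' _ |>.lipschitzOnWith)
    (LipschitzWith.id.lipschitzOnWith)
  have h2 := axis_null hn hp (N := {1}) (by simp)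
  have hsub : {x : Euc n | ‖x‖ = 1 ∧ ang p x ∈ T} ⊆ rotGraph p T (fun _ => 1) id ∪
      {x : Euc n | x ≠ 0 ∧ ‖x‖ ∈ ({1} : Set ℝ) ∧ (ang p x = 0 ∨ ang p x = Real.pi)} := by
    rintro x ⟨hx, hxT⟩
    have hx0 := ne_zero_of_norm_one hx
    by_cases ha : ang p x = 0 ∨ ang p x = Real.pi
    · right; exact ⟨hx0, hx, ha⟩
    · left
      push Not at ha
      exact ⟨hx0, lt_of_le_of_ne (ang_nonneg _ _) (Ne.symm ha.1), lt_of_le_of_ne (ang_le_pi _ _) ha.2,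
        ang p x, hxT, hx, rfl⟩
  refine (measure_mono hsub).trans ((measure_union_le _ _).trans ?_)
  rw [h2, add_zero]; exact h1

/-- Measure of the cap of angle `β` of the unit sphere. -/
noncomputable def Gf {n : ℕ} (p : Euc n) (β : ℝ) : ℝ :=
  (μH[(n:ℝ) - 1] {x : Euc n | ‖x‖ = 1 ∧ ang p x < β}).toReal

lemma sph_finite {n : ℕ} (hn : 2 ≤ n) {p : Euc n} (hp : ‖p‖ = 1) :
    μH[(n:ℝ) - 1] {x : Euc n | ‖x‖ = 1} < ⊤ := by
  obtain ⟨C, hC⟩ := band_upper hn hp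
  have := hC (Icc 0 Real.pi)
  rw [Real.volume_Icc] at this
  refine lt_of_le_of_lt (measure_mono ?_) (this.trans_lt (ENNReal.mul_lt_top ENNReal.coe_lt_top ENNReal.ofReal_lt_top))
  intro x hx
  exact ⟨hx, ang_nonneg _ _, ang_le_pi _ _⟩

lemma sph_sub_finite {n : ℕ} (hn : 2 ≤ n) {p : Euc n} (hp : ‖p‖ = 1) (P : Euc n → Prop) :
    μH[(n:ℝ) - 1] {x : Euc n | ‖x‖ = 1 ∧ P x} < ⊤ :=
  (measure_mono (fun _ h => h.1)).trans_lt (sph_finite hn hp)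

lemma meas_band {n : ℕ} (p : Euc n) {T : Set ℝ} (hT : MeasurableSet T) :
    MeasurableSet {x : Euc n | ‖x‖ = 1 ∧ ang p x ∈ T} :=
  (measurable_norm (measurableSet_singleton 1)).inter (measurable_ang p hT)

lemma Gf_sub {n : ℕ} (hn : 2 ≤ n) {p : Euc n} (hp : ‖p‖ = 1) {a b : ℝ} (hab : a ≤ b) :
    Gf p b - Gf p a = (μH[(n:ℝ) - 1] {x : Euc n | ‖x‖ = 1 ∧ ang p x ∈ Ico a b}).toReal := by
  have hd : {x : Euc n | ‖x‖ = 1 ∧ ang p x < b} =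
      {x : Euc n | ‖x‖ = 1 ∧ ang p x < a} ∪ {x : Euc n | ‖x‖ = 1 ∧ ang p x ∈ Ico a b} := by
    ext x
    simp only [mem_setOf_eq, mem_union, mem_Ico]
    constructor
    · rintro ⟨h1, h2⟩
      rcases lt_or_ge (ang p x) a with h | h
      · left; exact ⟨h1, h⟩
      · right; exact ⟨h1, h, h2⟩
    · rintro (⟨h1, h2⟩ | ⟨h1, h2, h3⟩)
      · exact ⟨h1, by linarith⟩
      · exact ⟨h1, h3⟩
  have hdis : Disjoint {x : Euc n | ‖x‖ = 1 ∧ ang p x < a} {x : Euc n | ‖x‖ = 1 ∧ ang p x ∈ Ico a b} := by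
    rw [Set.disjoint_left]
    rintro x ⟨_, h⟩ ⟨_, h', _⟩
    linarith
  unfold Gf
  rw [hd, measure_union hdis (meas_band p measurableSet_Ico),
    ENNReal.toReal_add (sph_sub_finite hn hp _).ne (sph_sub_finite hn hp _).ne]
  ring

lemma Gf_mono {n : ℕ} (hn : 2 ≤ n) {p : Euc n} (hp : ‖p‖ = 1) : Monotone (Gf p) := by
  intro a b hab
  have := Gf_sub hn hp hab
  have h2 : 0 ≤ (μH[(n:ℝ) - 1] {x : Euc n | ‖x‖ = 1 ∧ ang p x ∈ Ico a b}).toReal := ENNReal.toReal_nonneg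
  linarith

lemma Gf_lip {n : ℕ} (hn : 2 ≤ n) {p : Euc n} (hp : ‖p‖ = 1) :
    ∃ C : ℝ≥0, LipschitzWith C (Gf p) := by
  obtain ⟨C, hC⟩ := band_upper hn hp
  refine ⟨C, LipschitzWith.of_le_add_mul C fun x y => ?_⟩
  rcases le_total x y with h | h
  · have := Gf_mono hn hp h
    have : 0 ≤ C * dist x y := by positivity
    linarith
  · have h1 := Gf_sub hn hp h
    have h2 := hC (Ico y x)
    rw [Real.volume_Ico, ← ENNReal.ofReal_coe_nnreal, ← ENNReal.ofReal_mul (by positivity)] at h2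
    have h3 := ENNReal.toReal_le_of_le_ofReal (mul_nonneg C.2 (by linarith)) h2
    rw [Real.dist_eq, abs_of_nonneg (by linarith)]
    linarith!

lemma Gf_lower {n : ℕ} (hn : 2 ≤ n) {p : Euc n} (hp : ‖p‖ = 1) {ε : ℝ} (hε : 0 < ε) :
    ∃ c : ℝ, 0 < c ∧ ∀ a b : ℝ, ε ≤ a → a ≤ b → b ≤ Real.pi - ε → c * (b - a) ≤ Gf p b - Gf p a := by
  obtain ⟨c, hc, hlo⟩ := rot_lower hn hp hε
  refine ⟨c, by positivity, fun a b ha hab hb => ?_⟩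
  rw [Gf_sub hn hp hab]
  have h1 := hlo (Ico a b) (fun t ht => ⟨by linarith [ht.1], by linarith [ht.2]⟩)
  rw [Real.volume_Ico, ← ENNReal.ofReal_coe_nnreal, ← ENNReal.ofReal_mul (by positivity)] at h1
  exact (ENNReal.ofReal_le_iff_le_toReal (sph_sub_finite hn hp _).ne).mp h1

lemma Gf_strict {n : ℕ} (hn : 2 ≤ n) {p : Euc n} (hp : ‖p‖ = 1) {a b : ℝ} (h0 : 0 ≤ a)
    (hab : a < b) (hb : b ≤ Real.pi) : Gf p a < Gf p b := by
  set a' := (2 * a + b) / 3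
  set b' := (a + 2 * b) / 3
  have h1 : a < a' := by simp only [a']; linarith
  have h2 : a' < b' := by simp only [a', b']; linarith
  have h3 : b' < b := by simp only [b']; linarith
  obtain ⟨c, hc, hlo⟩ := Gf_lower hn hp (ε := min a' (Real.pi - b')) (lt_min (by linarith) (by linarith))
  have h4 := hlo a' b' (min_le_left _ _) h2.le (by linarith [min_le_right a' (Real.pi - b')])
  have h5 := Gf_mono hn hp h1.le
  have h6 := Gf_mono hn hp h3.le
  nlinarith

lemma circle_null {n : ℕ} (hn : 2 ≤ n) {p : Euc n} (hp : ‖p‖ = 1) {T : Set ℝ} (hT : volume T = 0) :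
    μH[(n:ℝ) - 1] {x : Euc n | ‖x‖ = 1 ∧ ang p x ∈ T} = 0 := by
  obtain ⟨C, hC⟩ := band_upper hn hp
  have := hC T
  rw [hT, mul_zero] at this
  exact nonpos_iff_eq_zero.mp this

lemma Gf_sub_le {n : ℕ} (hn : 2 ≤ n) {p : Euc n} (hp : ‖p‖ = 1) {a b : ℝ} (hab : a ≤ b) :
    ENNReal.ofReal (Gf p b - Gf p a) ≤ μH[(n:ℝ) - 1] {x : Euc n | ‖x‖ = 1 ∧ ang p x ∈ Ioo a b} := by
  rw [Gf_sub hn hp hab, ENNReal.ofReal_toReal (sph_sub_finite hn hp _).ne]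
  have h := circle_null hn hp (T := {a}) (by simp)
  refine (measure_mono (t := {x : Euc n | ‖x‖ = 1 ∧ ang p x ∈ Ioo a b} ∪
    {x : Euc n | ‖x‖ = 1 ∧ ang p x ∈ ({a} : Set ℝ)}) ?_).trans ((measure_union_le _ _).trans ?_)
  · rintro x ⟨h1, h2, h3⟩
    rcases eq_or_lt_of_le h2 with h | h
    · right; exact ⟨h1, h.symm⟩
    · left; exact ⟨h1, h, h3⟩
  · rw [h, add_zero]

lemma Gf_of_nonpos {n : ℕ} {p : Euc n} {a : ℝ} (h : a ≤ 0) : Gf p a = 0 := by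
  unfold Gf
  have : {x : Euc n | ‖x‖ = 1 ∧ ang p x < a} = ∅ := by
    rw [eq_empty_iff_forall_notMem]
    rintro x ⟨_, h2⟩
    linarith [ang_nonneg p x]
  rw [this]; simp

lemma Gf_of_ge {n : ℕ} (hn : 2 ≤ n) {p : Euc n} (hp : ‖p‖ = 1) {a : ℝ} (h : Real.pi ≤ a) :
    Gf p a = Gf p Real.pi := by
  have h1 := Gf_sub hn hp h
  have h2 := circle_null hn hp (T := {Real.pi}) (by simp)
  have h3 : {x : Euc n | ‖x‖ = 1 ∧ ang p x ∈ Ico Real.pi a} ⊆ {x : Euc n | ‖x‖ = 1 ∧ ang p x ∈ ({Real.pi} : Set ℝ)} := by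
    rintro x ⟨h1, h2, h3⟩
    exact ⟨h1, le_antisymm (ang_le_pi _ _) h2⟩
  rw [measure_mono_null h3 h2] at h1
  simp at h1; linarith

lemma exists_Ginv {n : ℕ} (hn : 2 ≤ n) {p : Euc n} (hp : ‖p‖ = 1) :
    ∃ H : ℝ → ℝ, Continuous H ∧ (∀ β ∈ Icc 0 Real.pi, H (Gf p β) = β) ∧
      ∀ y ∈ Icc 0 (Gf p Real.pi), H y ∈ Icc 0 Real.pi ∧ Gf p (H y) = y := by
  set E : ℝ → ℝ := fun β => Gf p β + max 0 (β - Real.pi) + min 0 β with hE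
  have hpi := Real.pi_pos
  obtain ⟨C, hC⟩ := Gf_lip hn hp
  have hEc : Continuous E := by
    have := hC.continuous
    fun_prop
  have hEm : StrictMono E := by
    intro x y hxy
    simp only [hE]
    have h1 := Gf_mono hn hp hxy.le
    have h2 : max 0 (x - Real.pi) ≤ max 0 (y - Real.pi) := max_le_max le_rfl (by linarith)
    have h3 : min 0 x ≤ min 0 y := min_le_min le_rfl hxy.le
    rcases le_or_gt y 0 with hy | hy
    · rw [min_eq_right hy, min_eq_right (hxy.le.trans hy)]; linarith
    rcases le_or_gt Real.pi x with hx | hx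
    · rw [max_eq_right (by linarith), max_eq_right (by linarith)]; linarith
    have h4 := Gf_strict hn hp (a := max x 0) (b := min y Real.pi) (le_max_right _ _)
      (max_lt (lt_min hxy hx) (lt_min hy hpi)) (min_le_right _ _)
    have h5 := Gf_mono hn hp (le_max_left x 0)
    have h6 := Gf_mono hn hp (min_le_left y Real.pi)
    linarith
  have hEs : Function.Surjective E := by
    refine hEc.surjective ?_ ?_
    · refine tendsto_atTop_mono' _ (f₁ := fun β => β - Real.pi) ?_ ?_
      · filter_upwards [eventually_ge_atTop (0:ℝ)] with β hβ
        simp only [hE]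
        rw [min_eq_left hβ]
        have := le_max_right 0 (β - Real.pi)
        have h : 0 ≤ Gf p β := ENNReal.toReal_nonneg
        linarith
      · exact tendsto_atTop_add_const_right _ _ tendsto_id
    · suffices h : E ≤ᶠ[atBot] id from tendsto_atBot_mono' _ h tendsto_id
      filter_upwards [eventually_le_atBot (0:ℝ)] with β hβ
      simp only [hE]
      rw [min_eq_right hβ, max_eq_left (by linarith), Gf_of_nonpos hβ, id]
      linarith
  have hEI : ∀ β ∈ Icc 0 Real.pi, E β = Gf p β := by
    intro β hβ
    simp only [hE]
    rw [min_eq_left hβ.1, max_eq_left (by linarith [hβ.2])]; ring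
  set e := hEm.orderIsoOfSurjective E hEs with he
  have hes : ∀ y, E (e.symm y) = y := fun y => e.apply_symm_apply y
  have hes2 : ∀ y, e.symm (E y) = y := fun y => e.symm_apply_apply y
  refine ⟨e.symm, e.symm.continuous, ?_, ?_⟩
  · intro β hβ
    rw [← hEI β hβ, hes2]
  · intro y hy
    have hmem : e.symm y ∈ Icc 0 Real.pi := by
      constructor
      · rw [← hEm.le_iff_le, hes, hEI 0 ⟨le_rfl, hpi.le⟩, Gf_of_nonpos le_rfl]; exact hy.1
      · rw [← hEm.le_iff_le, hes, hEI _ ⟨hpi.le, le_rfl⟩]; exact hy.2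
    exact ⟨hmem, by rw [← hEI _ hmem, hes]⟩

open scoped Pointwise in
lemma cap_scale {n : ℕ} (hn : 2 ≤ n) {p : Euc n} (hp : ‖p‖ = 1) {r : ℝ} (hr : 0 < r) (β : ℝ) :
    μH[(n:ℝ) - 1] (capSet p r β) = ENNReal.ofReal (r ^ (n - 1) * Gf p β) := by
  have e : capSet p r β = r • {x : Euc n | ‖x‖ = 1 ∧ ang p x < β} := by
    ext x
    rw [Set.mem_smul_set_iff_inv_smul_mem₀ hr.ne']
    simp only [capSet, mem_setOf_eq, mem_sphere, dist_zero_right]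
    rw [norm_smul, norm_inv, Real.norm_of_nonneg hr.le, ang_smul p (inv_pos.mpr hr)]
    unfold ang
    rw [inv_mul_eq_one₀ hr.ne']
    constructor
    · rintro ⟨h1, h2⟩; exact ⟨h1.symm, h2⟩
    · rintro ⟨h1, h2⟩; exact ⟨h1.symm, h2⟩
  rw [e, Measure.hausdorffMeasure_smul₀ (by linarith [dim_pos hn]) hr.ne', ENNReal.ofReal_mul (by positivity)]
  unfold Gf
  rw [ENNReal.ofReal_toReal (sph_sub_finite hn hp _).ne]
  rw [ENNReal.smul_def, smul_eq_mul]
  congr 1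
  rw [show (n:ℝ) - 1 = ((n - 1 : ℕ) : ℝ) by rw [Nat.cast_sub (by omega)]; simp, NNReal.rpow_natCast,
    ENNReal.ofReal]
  congr 1
  rw [Real.toNNReal_pow hr.le]
  congr 1
  exact (Real.toNNReal_eq_nnnorm_of_nonneg hr.le).symm


/-! ## Part 6 -/
open MeasureTheory Metric Set Filter
open scoped ENNReal NNReal Topology RealInnerProductSpace

/-- `A` has density zero at `x` (quantitative form). -/
def Z0 {n : ℕ} (A : Set (Euc n)) (x : Euc n) : Prop :=
  ∀ ε : ℝ, 0 < ε → ∀ᶠ ρ in 𝓝[>] (0:ℝ), volume (A ∩ ball x ρ) ≤ ENNReal.ofReal (ε * ρ ^ n)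

lemma unit_vol {n : ℕ} : ∃ V : ℝ, 0 < V ∧ volume (ball (0 : Euc n) 1) = ENNReal.ofReal V := by
  refine ⟨(volume (ball (0 : Euc n) 1)).toReal, ENNReal.toReal_pos ?_ ?_, ?_⟩
  · exact (measure_ball_pos _ _ one_pos).ne'
  · exact measure_ball_lt_top.ne
  · exact (ENNReal.ofReal_toReal measure_ball_lt_top.ne).symm

lemma Z0_iff {n : ℕ} (hn : 2 ≤ n) {A : Set (Euc n)} {x : Euc n} :
    Z0 A x ↔ Tendsto (fun ρ : ℝ => volume (A ∩ ball x ρ) / volume (ball x ρ)) (𝓝[>] (0:ℝ)) (𝓝 0) := by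
  obtain ⟨V, hV, hVe⟩ := unit_vol (n := n)
  constructor
  · intro h
    rw [ENNReal.tendsto_nhds_zero]
    intro ε hε
    obtain ⟨e, he0, hee⟩ : ∃ e : ℝ, 0 < e ∧ ENNReal.ofReal e ≤ ε := by
      rcases eq_or_ne ε ⊤ with rfl | ht
      · exact ⟨1, one_pos, le_top⟩
      · exact ⟨ε.toReal, ENNReal.toReal_pos hε.ne' ht, ENNReal.ofReal_toReal_le⟩
    filter_upwards [h (e * V) (by positivity), self_mem_nhdsWithin] with ρ h1 h2
    have h2 : 0 < ρ := h2
    refine le_trans ?_ hee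
    rw [vol_ball hn x h2.le, hVe, ← ENNReal.ofReal_mul (by positivity)]
    rw [ENNReal.div_le_iff (ENNReal.ofReal_pos.mpr (by positivity)).ne' ENNReal.ofReal_ne_top,
      ← ENNReal.ofReal_mul he0.le]
    convert h1 using 2; ring
  · intro h ε hε
    have h1 := h.eventually_le_const (u := ENNReal.ofReal (ε / V)) (ENNReal.ofReal_pos.mpr (by positivity))
    filter_upwards [h1, self_mem_nhdsWithin] with ρ h1 h2
    have h2 : 0 < ρ := h2
    rw [vol_ball hn x h2.le, hVe, ← ENNReal.ofReal_mul (by positivity),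
      ENNReal.div_le_iff (ENNReal.ofReal_pos.mpr (by positivity)).ne' ENNReal.ofReal_ne_top,
      ← ENNReal.ofReal_mul (by positivity)] at h1
    convert h1 using 2; field_simp

lemma Z0.mono {n : ℕ} {A B : Set (Euc n)} {x : Euc n} (h : Z0 B x) (hAB : A ⊆ B) : Z0 A x := by
  intro ε hε
  filter_upwards [h ε hε] with ρ hρ
  exact (measure_mono (inter_subset_inter_left _ hAB)).trans hρ

lemma Z0.union {n : ℕ} {A B : Set (Euc n)} {x : Euc n} (hA : Z0 A x) (hB : Z0 B x) :
    Z0 (A ∪ B) x := by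
  intro ε hε
  filter_upwards [hA (ε/2) (by positivity), hB (ε/2) (by positivity), self_mem_nhdsWithin] with ρ h1 h2 h3
  have h3 : 0 < ρ := h3
  rw [union_inter_distrib_right]
  refine (measure_union_le _ _).trans ((add_le_add h1 h2).trans ?_)
  rw [← ENNReal.ofReal_add (by positivity) (by positivity)]
  apply ENNReal.ofReal_le_ofReal; linarith

lemma Z0_of_null {n : ℕ} {A : Set (Euc n)} {x : Euc n} (h : volume A = 0) : Z0 A x := by
  intro ε hε
  filter_upwards with ρ
  rw [measure_mono_null inter_subset_left h]; exact zero_le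

lemma dens0_iff {n : ℕ} (hn : 2 ≤ n) {E : Set (Euc n)} {x : Euc n} : DensityAt E x 0 ↔ Z0 E x :=
  (Z0_iff hn).symm

lemma dens1_iff {n : ℕ} (hn : 2 ≤ n) {E : Set (Euc n)} (hE : MeasurableSet E) {x : Euc n} :
    DensityAt E x 1 ↔ Z0 Eᶜ x := by
  rw [Z0_iff hn]
  have hne : Nonempty (Fin n) := ⟨⟨0, by omega⟩⟩
  have hsum : ∀ ρ : ℝ, 0 < ρ → volume (E ∩ ball x ρ) / volume (ball x ρ) +
      volume (Eᶜ ∩ ball x ρ) / volume (ball x ρ) = 1 := by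
    intro ρ hρ
    rw [← ENNReal.add_div, inter_comm E, inter_comm Eᶜ]
    rw [show ball x ρ ∩ Eᶜ = ball x ρ \ E from rfl, measure_inter_add_diff _ hE]
    exact ENNReal.div_self (measure_ball_pos _ _ hρ).ne' measure_ball_lt_top.ne
  have hf : ∀ ρ : ℝ, 0 < ρ → volume (E ∩ ball x ρ) / volume (ball x ρ) ≠ ⊤ := by
    intro ρ hρ h
    have := hsum ρ hρ
    rw [h, top_add] at this; exact ENNReal.top_ne_one this
  have hg : ∀ ρ : ℝ, 0 < ρ → volume (Eᶜ ∩ ball x ρ) / volume (ball x ρ) ≠ ⊤ := by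
    intro ρ hρ h
    have := hsum ρ hρ
    rw [h, add_top] at this; exact ENNReal.top_ne_one this
  constructor
  · intro h
    have h1 : Tendsto (fun ρ : ℝ => 1 - volume (E ∩ ball x ρ) / volume (ball x ρ)) (𝓝[>] (0:ℝ)) (𝓝 (1 - 1)) :=
      ENNReal.Tendsto.sub tendsto_const_nhds h (by simp)
    rw [tsub_self] at h1
    refine h1.congr' ?_
    filter_upwards [self_mem_nhdsWithin] with ρ hρ
    rw [← hsum ρ hρ]
    exact ENNReal.add_sub_cancel_left (hf ρ hρ)
  · intro h
    have h1 : Tendsto (fun ρ : ℝ => 1 - volume (Eᶜ ∩ ball x ρ) / volume (ball x ρ)) (𝓝[>] (0:ℝ)) (𝓝 (1 - 0)) :=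
      ENNReal.Tendsto.sub tendsto_const_nhds h (by simp)
    rw [tsub_zero] at h1
    refine h1.congr' ?_
    filter_upwards [self_mem_nhdsWithin] with ρ hρ
    rw [← hsum ρ hρ]
    exact ENNReal.add_sub_cancel_right (hg ρ hρ)

lemma mtn_iff {n : ℕ} (hn : 2 ≤ n) {E : Set (Euc n)} {x ν : Euc n} :
    HasMTNormal E x ν ↔ ‖ν‖ = 1 ∧ Z0 {y | y ∈ E ∧ 0 < ⟪y - x, ν⟫} x ∧ Z0 {y | y ∉ E ∧ ⟪y - x, ν⟫ < 0} x := by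
  unfold HasMTNormal
  rw [Z0_iff hn, Z0_iff hn]

lemma not_Z0_of_ball {n : ℕ} (hn : 2 ≤ n) {A : Set (Euc n)} {x z : Euc n} {k : ℝ} (hk : 0 < k)
    (h : ∀ ρ : ℝ, 0 < ρ → ball (x + ρ • z) (k * ρ) ⊆ A ∩ ball x ρ) : ¬ Z0 A x := by
  intro hZ
  obtain ⟨V, hV, hVe⟩ := unit_vol (n := n)
  obtain ⟨ρ, h1, h2⟩ := ((hZ (k ^ n * V / 2) (by positivity)).and self_mem_nhdsWithin).exists
  have h2 : 0 < ρ := h2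
  have h3 := (measure_mono (h ρ h2)).trans h1
  rw [vol_ball hn _ (by positivity), hVe, ← ENNReal.ofReal_mul (by positivity),
    ENNReal.ofReal_le_ofReal_iff (by positivity), mul_pow] at h3
  have : 0 < k ^ n * ρ ^ n * V := by positivity
  nlinarith

lemma inner_lt_ball {n : ℕ} {x z y u : Euc n} {k ρ : ℝ} (hu : ‖u‖ = 1)
    (hy : y ∈ ball (x + ρ • z) (k * ρ)) : |⟪y - x, u⟫ - ρ * ⟪z, u⟫| < k * ρ := by
  rw [mem_ball, dist_eq_norm] at hy
  have e : ⟪y - x, u⟫ - ρ * ⟪z, u⟫ = ⟪y - (x + ρ • z), u⟫ := by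
    rw [← sub_sub, inner_sub_left (y - x), inner_smul_left]; simp
  rw [e]
  refine (abs_real_inner_le_norm _ _).trans_lt ?_
  rw [hu, mul_one]; exact hy

lemma ball_shift_sub {n : ℕ} {x z : Euc n} {k ρ : ℝ} (hρ : 0 < ρ) (h : ‖z‖ + k ≤ 1) :
    ball (x + ρ • z) (k * ρ) ⊆ ball x ρ := by
  apply ball_subset_ball'
  rw [dist_eq_norm, add_sub_cancel_left, norm_smul, Real.norm_of_nonneg hρ.le]
  nlinarith

lemma half_not_Z0 {n : ℕ} (hn : 2 ≤ n) {x u : Euc n} (hu : ‖u‖ = 1) :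
    ¬ Z0 {y : Euc n | 0 < ⟪y - x, u⟫} x := by
  refine not_Z0_of_ball hn (z := (1/2 : ℝ) • u) (k := 1/2) (by norm_num) fun ρ hρ => ?_
  refine subset_inter (fun y hy => ?_) (ball_shift_sub hρ ?_)
  · have := inner_lt_ball hu hy
    rw [inner_smul_left, real_inner_self_eq_norm_sq, hu, abs_lt] at this
    simp only [mem_setOf_eq]
    simp at this
    linarith [this.1]
  · rw [norm_smul, hu]; norm_num

lemma red_sub_ess {n : ℕ} (hn : 2 ≤ n) {E : Set (Euc n)} (hE : MeasurableSet E) {x ν : Euc n}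
    (h : HasMTNormal E x ν) : x ∈ essBoundary E := by
  rw [mtn_iff hn] at h
  obtain ⟨h0, h1, h2⟩ := h
  constructor
  · rw [dens0_iff hn]
    intro hz
    refine half_not_Z0 hn (x := x) (u := -ν) (by rwa [norm_neg]) ((hz.union h2).mono ?_)
    intro y hy
    simp only [mem_setOf_eq, inner_neg_right] at hy
    by_cases hyE : y ∈ E
    · left; exact hyE
    · right; exact ⟨hyE, by linarith⟩
  · rw [dens1_iff hn hE]
    intro hz
    refine half_not_Z0 hn (x := x) (u := ν) h0 ((hz.union h1).mono ?_)
    intro y hy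
    by_cases hyE : y ∈ E
    · right; exact ⟨hyE, hy⟩
    · left; exact hyE

lemma mtn_unique {n : ℕ} (hn : 2 ≤ n) {E : Set (Euc n)} {x ν1 ν2 : Euc n}
    (h1 : HasMTNormal E x ν1) (h2 : HasMTNormal E x ν2) : ν1 = ν2 := by
  rw [mtn_iff hn] at h1 h2
  obtain ⟨hn1, ha1, hb1⟩ := h1
  obtain ⟨hn2, ha2, hb2⟩ := h2
  by_contra hne
  set c := ⟪ν1, ν2⟫ with hc
  have hc1 : c < 1 := by
    refine lt_of_le_of_ne ?_ ?_
    · have := real_inner_le_norm ν1 ν2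
      rwa [hn1, hn2, one_mul] at this
    · intro h
      exact hne ((inner_eq_one_iff_of_norm_eq_one hn1 hn2).mp h)
  have hc2 : -1 ≤ c := by
    have := abs_real_inner_le_norm ν1 ν2
    rw [hn1, hn2, one_mul] at this
    exact (abs_le.mp this).1
  refine not_Z0_of_ball hn (A := {y | y ∉ E ∧ ⟪y - x, ν1⟫ < 0} ∪ {y | y ∈ E ∧ 0 < ⟪y - x, ν2⟫})
    (z := (1/4 : ℝ) • (ν2 - ν1)) (k := (1 - c) / 4) (by linarith) (fun ρ hρ => ?_) (hb1.union ha2)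
  refine subset_inter (fun y hy => ?_) (ball_shift_sub hρ ?_)
  · have e1 := inner_lt_ball hn1 hy
    have e2 := inner_lt_ball hn2 hy
    rw [inner_smul_left, inner_sub_left ν2 ν1 ν1, real_inner_self_eq_norm_sq, hn1, real_inner_comm ν1 ν2, ← hc, abs_lt] at e1
    rw [inner_smul_left, inner_sub_left ν2 ν1 ν2, real_inner_self_eq_norm_sq, hn2, ← hc, abs_lt] at e2
    simp only [conj_trivial] at e1 e2
    by_cases hyE : y ∈ E
    · right; exact ⟨hyE, by nlinarith [e2.1]⟩
    · left; exact ⟨hyE, by nlinarith [e1.2]⟩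
  · have : ‖ν2 - ν1‖ ≤ 2 := (norm_sub_le _ _).trans (by rw [hn1, hn2]; norm_num)
    rw [norm_smul]
    have h14 : ‖(1/4:ℝ)‖ = 1/4 := by norm_num
    rw [h14]
    linarith

lemma mtNormal_eq {n : ℕ} (hn : 2 ≤ n) {E : Set (Euc n)} {x ν : Euc n} (h : HasMTNormal E x ν) :
    mtNormal E x = ν := by
  have hex : ∃ ν, HasMTNormal E x ν := ⟨ν, h⟩
  unfold mtNormal
  rw [dif_pos hex]
  exact mtn_unique hn hex.choose_spec h

/-- Points with radial normal. -/
lemma bad_iff {n : ℕ} (hn : 2 ≤ n) {E : Set (Euc n)} {x : Euc n} (hx : x ≠ 0) :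
    (x ∈ redBoundary E ∧ nuPar E x = 0) ↔ (HasMTNormal E x (hatv x) ∨ HasMTNormal E x (-hatv x)) := by
  have hh := norm_hatv hx
  constructor
  · rintro ⟨⟨ν, hν⟩, h0⟩
    unfold nuPar at h0
    rw [mtNormal_eq hn hν] at h0
    have e := sub_eq_zero.mp h0
    set c := ⟪ν, hatv x⟫
    have h1 : |c| = 1 := by
      have := congrArg norm e
      rw [hν.1, norm_smul, hh, mul_one, Real.norm_eq_abs] at this
      exact this.symm
    rcases (abs_eq zero_le_one).mp h1 with h | h
    · left; rw [h, one_smul] at e; rwa [← e]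
    · right; rw [h, neg_one_smul] at e; rwa [← e]
  · rintro (h | h)
    · refine ⟨⟨_, h⟩, ?_⟩
      unfold nuPar
      rw [mtNormal_eq hn h, real_inner_self_eq_norm_sq, hh]; simp
    · refine ⟨⟨_, h⟩, ?_⟩
      unfold nuPar
      rw [mtNormal_eq hn h, inner_neg_left, real_inner_self_eq_norm_sq, hh]; simp


/-! ## Part 7 -/
open MeasureTheory Metric Set Filter
open scoped ENNReal NNReal Topology RealInnerProductSpace

lemma Z0_of_ae {n : ℕ} {A : Set (Euc n)} {x : Euc n} {P : Euc n → Prop}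
    (h : ∀ᵐ y, P y → y ∉ A) (hP : ∀ᶠ y in 𝓝 x, P y) : Z0 A x := by
  intro ε hε
  obtain ⟨δ, hδ, hb⟩ := Metric.eventually_nhds_iff_ball.mp hP
  filter_upwards [Ioo_mem_nhdsGT hδ] with ρ hρ
  have : volume (A ∩ ball x ρ) = 0 := by
    refine measure_mono_null ?_ h
    rintro y ⟨h1, h2⟩ h3
    exact h3 (hb y (ball_subset_ball hρ.2.le h2)) h1
  rw [this]; exact zero_le

lemma D0_of_sector {n : ℕ} (hn : 2 ≤ n) {p : Euc n} (hp : ‖p‖ = 1) {x : Euc n} (hx : x ≠ 0)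
    (h0 : 0 < ang p x) (h1 : ang p x < Real.pi) {A : Set (Euc n)} (hA : Z0 A x) {S : Set ℝ}
    (hS : MeasurableSet S) {e : ℝ} (he : e = 1 ∨ e = -1)
    (hsub : ∀ y : Euc n, y ≠ 0 → ‖y‖ ∈ S → 0 < e * (ang p y - ang p x) → y ∈ A) :
    D0 S ‖x‖ := by
  obtain ⟨c, c1, ρ0, hc, hc1, hρ0, H⟩ := sector_lower hn hp hx h0 h1
  intro ε hε
  have h4 : Tendsto (fun ρ : ℝ => 4 * ρ) (𝓝[>] 0) (𝓝[>] 0) := by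
    refine tendsto_nhdsWithin_iff.mpr ⟨?_, ?_⟩
    · have : Tendsto (fun ρ : ℝ => 4 * ρ) (𝓝 0) (𝓝 (4 * 0)) := (continuous_const.mul continuous_id).tendsto 0
      rw [mul_zero] at this
      exact this.mono_left nhdsWithin_le_nhds
    · filter_upwards [self_mem_nhdsWithin] with ρ hρ
      exact mul_pos (by norm_num : (0:ℝ) < 4) hρ
  filter_upwards [h4.eventually (hA (c * ε / 4) (by positivity)), h4.eventually (Ioo_mem_nhdsGT hρ0)] with ρ h2 h3
  have hρ : 0 < ρ := by linarith [h3.1]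
  have h5 := H e he (4 * ρ) h3.1 h3.2 S hS
  rw [mul_div_cancel_left₀ _ (by norm_num : (4:ℝ) ≠ 0)] at h5
  have h6 : ENNReal.ofReal (c * (4 * ρ) ^ (n - 1)) * volume (S ∩ closedBall ‖x‖ ρ) ≤
      ENNReal.ofReal (c * (4 * ρ) ^ (n - 1)) * ENNReal.ofReal (ε * ρ) := by
    refine h5.trans ((measure_mono (inter_subset_inter_left _ ?_)).trans (h2.trans (le_of_eq ?_)))
    · rintro y ⟨a, b, d⟩
      exact hsub y a b (lt_trans (by positivity) d)
    · rw [← ENNReal.ofReal_mul (by positivity)]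
      congr 1
      obtain ⟨m, rfl⟩ : ∃ m, n = m + 1 := ⟨n - 1, by omega⟩
      simp only [Nat.add_sub_cancel, pow_succ]; ring
  exact (ENNReal.mul_le_mul_iff_right (ENNReal.ofReal_pos.mpr (by positivity)).ne' ENNReal.ofReal_ne_top).mp h6

lemma D1a {n : ℕ} (hn : 2 ≤ n) {p : Euc n} (hp : ‖p‖ = 1) {α : ℝ → ℝ} (hα : Measurable α)
    {x : Euc n} (hx : x ≠ 0)
    (h0 : 0 < ang p x) (h1 : ang p x < Real.pi) (hZ : Z0 (sphSymm n α p) x) :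
    D0 {s | ang p x < α s} ‖x‖ := by
  refine D0_of_sector hn hp hx h0 h1 hZ (measurableSet_lt measurable_const hα) (Or.inr rfl) ?_
  intro y hy hs h
  rw [sphSymm_eq]
  exact ⟨hy, lt_trans (by linarith) (show ang p x < α ‖y‖ from hs)⟩

lemma D1b {n : ℕ} (hn : 2 ≤ n) {p : Euc n} (hp : ‖p‖ = 1) {α : ℝ → ℝ} (hα : Measurable α)
    {x : Euc n} (hx : x ≠ 0)
    (h0 : 0 < ang p x) (h1 : ang p x < Real.pi) (hZ : Z0 (sphSymm n α p)ᶜ x) :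
    D0 {s | ang p x < α s}ᶜ ‖x‖ := by
  refine D0_of_sector hn hp hx h0 h1 hZ (measurableSet_lt measurable_const hα).compl (Or.inl rfl) ?_
  intro y hy hs h
  rw [sphSymm_eq]
  rintro ⟨_, h3⟩
  exact hs (lt_trans (by linarith) h3)

lemma D2 {n : ℕ} (hn : 2 ≤ n) {p : Euc n} {α β : ℝ → ℝ} (hα : Measurable α)
    {I : Set ℝ} (hI : IsOpen I) (hae : ∀ᵐ s ∂(volume.restrict I), β s = α s)
    {x : Euc n} (hx : x ≠ 0) (hxI : ‖x‖ ∈ I) (hβ : ContinuousAt β ‖x‖)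
    (hess : x ∈ essBoundary (sphSymm n α p)) : ang p x = β ‖x‖ := by
  have hae' := ae_norm hn hae hI.measurableSet
  have c1 : ContinuousAt (fun y : Euc n => β ‖y‖) x := hβ.comp (f := fun y : Euc n => ‖y‖) continuous_norm.continuousAt
  have c2 := continuousAt_ang p hx
  have hIe : ∀ᶠ y in 𝓝 x, ‖y‖ ∈ I := continuous_norm.continuousAt.eventually (hI.mem_nhds hxI)
  have h0 : ∀ᶠ y in 𝓝 x, y ≠ 0 := isOpen_ne.mem_nhds hx
  rcases lt_trichotomy (ang p x) (β ‖x‖) with h | h | h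
  · exfalso
    refine hess.2 ((dens1_iff hn (measurableSet_sphSymm hα p)).mpr ?_)
    refine Z0_of_ae (P := fun y => ‖y‖ ∈ I ∧ y ≠ 0 ∧ ang p y < β ‖y‖) ?_ (hIe.and (h0.and (c2.eventually_lt c1 h)))
    filter_upwards [hae'] with y hy ⟨a, b, d⟩ hF
    rw [hy a] at d
    exact hF (by rw [sphSymm_eq]; exact ⟨b, d⟩)
  · exact h
  · exfalso
    refine hess.1 ((dens0_iff hn).mpr ?_)
    refine Z0_of_ae (P := fun y => ‖y‖ ∈ I ∧ β ‖y‖ < ang p y) ?_ (hIe.and (c1.eventually_lt c2 h))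
    filter_upwards [hae'] with y hy ⟨a, d⟩ hF
    rw [hy a] at d
    rw [sphSymm_eq] at hF
    exact lt_asymm d hF.2

lemma D5a {n : ℕ} (hn : 2 ≤ n) {x : Euc n} (hx : x ≠ 0) {S : Set ℝ} (hS : MeasurableSet S)
    (h : D0 S ‖x‖) : Z0 {y : Euc n | ‖y‖ ∈ S} x := by
  obtain ⟨C, hC, H⟩ := shell_upper hn hx
  intro ε hε
  filter_upwards [h (ε / C) (by positivity), Ioo_mem_nhdsGT (norm_pos_iff.mpr hx)] with ρ h1 h2
  refine (H ρ h2.1 h2.2 S hS).trans ((mul_le_mul_right h1 _).trans (le_of_eq ?_))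
  have := h2.1
  rw [← ENNReal.ofReal_mul (by positivity)]
  congr 1
  obtain ⟨m, rfl⟩ : ∃ m, n = m + 1 := ⟨n - 1, by omega⟩
  simp only [Nat.add_sub_cancel, pow_succ]; field_simp

lemma line_null {n : ℕ} (hn : 2 ≤ n) (p : Euc n) : volume ((ℝ ∙ p : Submodule ℝ (Euc n)) : Set (Euc n)) = 0 := by
  apply MeasureTheory.Measure.addHaar_submodule
  intro h
  have h1 : Module.finrank ℝ (ℝ ∙ p : Submodule ℝ (Euc n)) ≤ 1 := by
    simpa using finrank_span_le_card (R := ℝ) ({p} : Set (Euc n))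
  rw [h, finrank_top, finrank_euclideanSpace_fin] at h1
  omega

lemma hyper_null {n : ℕ} {u : Euc n} (hu : ‖u‖ = 1) : volume {z : Euc n | ⟪z, u⟫ = 0} = 0 := by
  have : {z : Euc n | ⟪z, u⟫ = 0} = (((ℝ ∙ u)ᗮ : Submodule ℝ (Euc n)) : Set (Euc n)) := by
    ext z
    simp only [mem_setOf_eq, SetLike.mem_coe, Submodule.mem_orthogonal_singleton_iff_inner_left]
  rw [this]
  apply MeasureTheory.Measure.addHaar_submodule
  intro h
  have : u ∈ ((ℝ ∙ u)ᗮ : Submodule ℝ (Euc n)) := by rw [h]; trivial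
  rw [Submodule.mem_orthogonal_singleton_iff_inner_left, real_inner_self_eq_norm_sq, hu] at this
  norm_num at this

lemma D5b {n : ℕ} (hn : 2 ≤ n) {p : Euc n} (hp : ‖p‖ = 1) {α : ℝ → ℝ} (hα : Measurable α) {x : Euc n} (hx : x ≠ 0)
    (h : D0 {s | α s < Real.pi} ‖x‖) : Z0 (sphSymm n α p)ᶜ x := by
  refine ((D5a hn hx (measurableSet_lt hα measurable_const) h).union
    (Z0_of_null (line_null hn p))).mono ?_
  intro y hy
  rw [sphSymm_eq] at hy
  by_cases hy0 : y = 0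
  · right; rw [hy0]; exact Submodule.zero_mem _
  by_cases hpi : ang p y = Real.pi
  · right
    have hin : ⟪hatv y, p⟫ ≤ -1 := Real.arccos_eq_pi.mp hpi
    have h2 : ⟪hatv y, p⟫ = -1 := by
      refine le_antisymm hin ?_
      have := abs_real_inner_le_norm (hatv y) p
      rw [norm_hatv hy0, hp, one_mul] at this
      exact (abs_le.mp this).1
    have h3 : hatv y = -p := by
      have : ⟪hatv y, -p⟫ = 1 := by rw [inner_neg_right, h2]; norm_num
      exact (inner_eq_one_iff_of_norm_eq_one (norm_hatv hy0) (by rwa [norm_neg])).mp this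
    have h4 := smul_hatv y
    rw [h3] at h4
    rw [← h4]
    exact Submodule.smul_mem _ _ (Submodule.neg_mem _ (Submodule.mem_span_singleton_self p))
  · left
    have h5 : ang p y < Real.pi := lt_of_le_of_ne (ang_le_pi p y) hpi
    have h6 : ¬ ang p y < α ‖y‖ := fun h => hy ⟨hy0, h⟩
    exact lt_of_le_of_lt (not_lt.mp h6) h5

lemma D5c {n : ℕ} (hn : 2 ≤ n) {p : Euc n} {α : ℝ → ℝ} (hα : Measurable α) {x : Euc n} (hx : x ≠ 0)
    (h : D0 {s | 0 < α s} ‖x‖) : Z0 (sphSymm n α p) x := by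
  refine (D5a hn hx (measurableSet_lt measurable_const hα) h).mono ?_
  intro y hy
  rw [sphSymm_eq] at hy
  exact lt_of_le_of_lt (ang_nonneg p y) hy.2

lemma inner_hat_le {n : ℕ} {x : Euc n} (hx : x ≠ 0) (y : Euc n) : ⟪y - x, hatv x⟫ ≤ ‖y‖ - ‖x‖ := by
  have hh := norm_hatv hx
  have h1 : ⟪x, hatv x⟫ = ‖x‖ := by
    conv_lhs => rw [← smul_hatv x]
    have e : hatv (‖x‖ • hatv x) = hatv x := by rw [smul_hatv]
    rw [e, inner_smul_left, real_inner_self_eq_norm_sq, hh]; simp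
  rw [inner_sub_left, h1]
  have := real_inner_le_norm y (hatv x)
  rw [hh, mul_one] at this
  linarith

lemma inner_hat_ge {n : ℕ} {x : Euc n} (hx : x ≠ 0) {y : Euc n} {ρ : ℝ} (hρ : ρ < ‖x‖) (hy : y ∈ ball x ρ) :
    ‖y‖ - ‖x‖ ≤ ⟪y - x, hatv x⟫ + ρ ^ 2 / (2 * ‖x‖) := by
  have hh := norm_hatv hx
  have hR := norm_pos_iff.mpr hx
  rw [mem_ball, dist_eq_norm] at hy
  have h0 : 0 ≤ ‖y - x‖ := norm_nonneg _
  set t := ⟪y - x, hatv x⟫ with ht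
  have hxx : ⟪y - x, x⟫ = ‖x‖ * t := by
    conv_lhs => rw [← smul_hatv x]
    rw [inner_smul_right]
    have e : ‖x‖ • hatv x = x := smul_hatv x
    rw [e]
  have h1 : ‖y‖ ^ 2 = ‖x‖ ^ 2 + 2 * (‖x‖ * t) + ‖y - x‖ ^ 2 := by
    have := norm_add_sq_real (y - x) x
    rw [sub_add_cancel, hxx] at this
    linarith
  have ht2 : |t| ≤ ‖y - x‖ := by
    have := abs_real_inner_le_norm (y - x) (hatv x)
    rwa [hh, mul_one] at this
  have ht3 := (abs_le.mp ht2).1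
  set R := ‖x‖
  set q := ρ ^ 2 / (2 * R) with hq
  have hqR : ρ ^ 2 = 2 * R * q := by rw [hq]; field_simp
  have hq0 : 0 ≤ q := by positivity
  have hpos : 0 ≤ R + t + q := by linarith
  have h2 : ‖y‖ ^ 2 ≤ (R + t + q) ^ 2 := by
    have : ‖y - x‖ ^ 2 ≤ ρ ^ 2 := by gcongr
    nlinarith [sq_nonneg (t + q)]
  have := abs_le_of_sq_le_sq h2 hpos
  rw [abs_of_nonneg (norm_nonneg y)] at this
  linarith

lemma slab {n : ℕ} (hn : 2 ≤ n) {u : Euc n} (hu : ‖u‖ = 1) {ε : ℝ} (hε : 0 < ε) :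
    ∃ δ : ℝ, 0 < δ ∧ ∀ (x : Euc n) (ρ : ℝ), 0 < ρ →
      volume ({y : Euc n | |⟪y - x, u⟫| ≤ δ * ρ} ∩ ball x ρ) ≤ ENNReal.ofReal (ε * ρ ^ n) := by
  set s : ℕ → Set (Euc n) := fun k => {z : Euc n | |⟪z, u⟫| ≤ 1 / ((k:ℝ) + 1)} ∩ ball 0 1 with hs
  have hm : ∀ k, MeasurableSet (s k) := fun k =>
    ((isClosed_le (by fun_prop) continuous_const).measurableSet).inter measurableSet_ball
  have hanti : Antitone s := by
    intro i j hij
    refine inter_subset_inter_left _ fun z hz => ?_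
    have hz : |⟪z, u⟫| ≤ 1 / ((j:ℝ) + 1) := hz
    have hij : (i:ℝ) ≤ j := by exact_mod_cast hij
    exact hz.trans (one_div_le_one_div_of_le (by positivity) (by linarith))
  have hT := tendsto_measure_iInter_atTop (μ := (volume : Measure (Euc n))) (fun k => (hm k).nullMeasurableSet) hanti
    ⟨0, ((measure_mono inter_subset_right).trans_lt measure_ball_lt_top).ne⟩
  have hz : volume (⋂ k, s k) = 0 := by
    refine measure_mono_null ?_ (hyper_null hu)
    intro z hz
    rw [mem_iInter] at hz
    have h1 : ∀ k : ℕ, |⟪z, u⟫| ≤ 1 / ((k:ℝ) + 1) := fun k => (hz k).1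
    have h2 : |⟪z, u⟫| ≤ 0 := ge_of_tendsto' tendsto_one_div_add_atTop_nhds_zero_nat h1
    exact abs_nonpos_iff.mp h2
  rw [hz] at hT
  obtain ⟨k, hk⟩ := (hT.eventually_le_const (u := ENNReal.ofReal ε) (ENNReal.ofReal_pos.mpr hε)).exists
  refine ⟨1 / ((k:ℝ) + 1), by positivity, fun x ρ hρ => ?_⟩
  have hsub : {y : Euc n | |⟪y - x, u⟫| ≤ 1 / ((k:ℝ) + 1) * ρ} ∩ ball x ρ ⊆ AffineMap.homothety x ρ '' ((fun z => x + z) '' s k) := by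
    rintro y ⟨h1, h2⟩
    refine ⟨x + ρ⁻¹ • (y - x), ⟨ρ⁻¹ • (y - x), ⟨?_, ?_⟩, rfl⟩, ?_⟩
    · simp only [mem_setOf_eq] at h1 ⊢
      rw [inner_smul_left, abs_mul]
      simp only [conj_trivial, abs_inv, abs_of_pos hρ]
      rw [inv_mul_le_iff₀ hρ, mul_comm]; exact h1
    · rw [mem_ball_zero_iff, norm_smul, norm_inv, Real.norm_of_nonneg hρ.le, inv_mul_lt_iff₀ hρ, mul_one]
      rwa [mem_ball, dist_eq_norm] at h2
    · rw [AffineMap.homothety_apply]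
      simp [hρ.ne']
  refine (measure_mono hsub).trans ?_
  rw [MeasureTheory.Measure.addHaar_image_homothety, finrank_euclideanSpace_fin, abs_of_pos (by positivity)]
  rw [image_add_left, measure_preimage_add, mul_comm ε, ENNReal.ofReal_mul (by positivity)]
  exact mul_le_mul_right hk _

lemma radial_normal {n : ℕ} (hn : 2 ≤ n) {p : Euc n} (hp : ‖p‖ = 1) {α : ℝ → ℝ} {x : Euc n} (hx : x ≠ 0)
    {e : ℝ} (he : e = 1 ∨ e = -1)
    (hst : ∀ Λ : ℝ, 0 < Λ → ∃ η > 0, ∀ᵐ s : ℝ, (s ∈ Ioo ‖x‖ (‖x‖ + η) → Λ * (s - ‖x‖) ≤ e * (α s - ang p x)) ∧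
      (s ∈ Ioo (‖x‖ - η) ‖x‖ → e * (α s - ang p x) ≤ - (Λ * (‖x‖ - s)))) :
    HasMTNormal (sphSymm n α p) x ((-e) • hatv x) := by
  have hh := norm_hatv hx
  have hR := norm_pos_iff.mpr hx
  have hee : |e| = 1 := by rcases he with h | h <;> simp [h]
  have key : ∀ ε : ℝ, 0 < ε → ∃ δ > 0, (∀ ρ : ℝ, 0 < ρ → volume ({y : Euc n | |⟪y - x, hatv x⟫| ≤ δ * ρ} ∩ ball x ρ) ≤ ENNReal.ofReal (ε * ρ ^ n)) ∧
      ∀ᶠ ρ in 𝓝[>] (0:ℝ), ∀ᵐ y : Euc n, y ∈ ball x ρ → δ * ρ < |⟪y - x, hatv x⟫| → 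
        0 < e * ⟪y - x, hatv x⟫ * (α ‖y‖ - ang p y) := by
    intro ε hε
    obtain ⟨δ, hδ, H⟩ := slab hn hh hε
    refine ⟨δ, hδ, H x, ?_⟩
    obtain ⟨η, hη, hs⟩ := hst (2 * (Real.pi / ‖x‖) / δ + 1) (by positivity)
    have hs' := ae_norm hn (I := univ) (by rwa [Measure.restrict_univ]) MeasurableSet.univ
    filter_upwards [Ioo_mem_nhdsGT (lt_min hη (lt_min hR (by positivity : 0 < ‖x‖ * δ)))] with ρ hρ
    have hρ0 : 0 < ρ := hρ.1
    have hρ1 : ρ < η := hρ.2.trans_le (min_le_left _ _)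
    have hρ2 : ρ < ‖x‖ := hρ.2.trans_le ((min_le_right _ _).trans (min_le_left _ _))
    have hρ3 : ρ < ‖x‖ * δ := hρ.2.trans_le ((min_le_right _ _).trans (min_le_right _ _))
    filter_upwards [hs'] with y hy hyb ht
    obtain ⟨hy1, hy2⟩ := hy (mem_univ _)
    have hyb' : ‖y - x‖ < ρ := by rwa [mem_ball, dist_eq_norm] at hyb
    have hy0 : y ≠ 0 := by
      rintro rfl
      rw [zero_sub, norm_neg] at hyb'; linarith
    have hang : |ang p x - ang p y| ≤ Real.pi / ‖x‖ * ρ :=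
      (ang_lip2 hp hx hy0).trans (by rw [norm_sub_rev]; gcongr)
    have hle := inner_hat_le hx y
    have hge := inner_hat_ge hx hρ2 hyb
    have hq : ρ ^ 2 / (2 * ‖x‖) ≤ δ * ρ / 2 := by
      rw [div_le_div_iff₀ (by positivity) (by norm_num)]
      nlinarith
    have hnn : |‖y‖ - ‖x‖| < ρ := (abs_norm_sub_norm_le y x).trans_lt hyb'
    rw [abs_lt] at hnn
    rw [abs_le] at hang
    have hΛ : Real.pi / ‖x‖ * ρ < (2 * (Real.pi / ‖x‖) / δ + 1) * (δ * ρ / 2) := by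
      have : (2 * (Real.pi / ‖x‖) / δ + 1) * (δ * ρ / 2) = Real.pi / ‖x‖ * ρ + δ * ρ / 2 := by
        field_simp
      rw [this]; have : 0 < δ * ρ := by positivity
      linarith
    set t := ⟪y - x, hatv x⟫
    set Λ := 2 * (Real.pi / ‖x‖) / δ + 1 with hΛd
    have hΛ0 : 0 < Λ := by positivity
    have hδρ : 0 < δ * ρ := by positivity
    rcases lt_abs.mp ht with h | h
    · have h3 := hy1 ⟨by linarith, by linarith⟩
      have h4 : Λ * (δ * ρ / 2) ≤ Λ * (‖y‖ - ‖x‖) := by gcongr; linarith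
      have : 0 < e * (α ‖y‖ - ang p y) := by rcases he with he | he <;> rw [he] at h3 ⊢ <;> linarith
      have h5 : 0 < t := by linarith
      nlinarith [mul_pos this h5]
    · have h3 := hy2 ⟨by linarith, by linarith⟩
      have h4 : Λ * (δ * ρ / 2) ≤ Λ * (‖x‖ - ‖y‖) := by gcongr; linarith
      have : e * (α ‖y‖ - ang p y) < 0 := by rcases he with he | he <;> rw [he] at h3 ⊢ <;> linarith
      have h5 : t < 0 := by linarith
      nlinarith [mul_pos_of_neg_of_neg this h5]
  rw [mtn_iff hn]
  refine ⟨by rw [norm_smul, hh, norm_neg, Real.norm_eq_abs, hee, one_mul], ?_, ?_⟩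
  · intro ε hε
    obtain ⟨δ, hδ, H1, H2⟩ := key ε hε
    filter_upwards [H2, self_mem_nhdsWithin] with ρ h2 hρ
    refine le_trans (measure_mono_ae ?_) (H1 ρ hρ)
    filter_upwards [h2] with y hy hyA
    obtain ⟨⟨hyF, hyi⟩, hyb⟩ := hyA
    refine ⟨?_, hyb⟩
    by_contra hc
    have h3 := hy hyb (not_le.mp hc)
    rw [sphSymm_eq] at hyF
    rw [inner_smul_right] at hyi
    have := hyF.2
    nlinarith [mul_pos hyi (sub_pos.mpr this)]
  · intro ε hε
    obtain ⟨δ, hδ, H1, H2⟩ := key ε hε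
    filter_upwards [H2, self_mem_nhdsWithin, Ioo_mem_nhdsGT hR] with ρ h2 hρ hρR
    refine le_trans (measure_mono_ae ?_) (H1 ρ hρ)
    filter_upwards [h2] with y hy hyA
    obtain ⟨⟨hyF, hyi⟩, hyb⟩ := hyA
    refine ⟨?_, hyb⟩
    by_contra hc
    have h3 := hy hyb (not_le.mp hc)
    have hy0 : y ≠ 0 := by
      rintro rfl
      rw [mem_ball, dist_eq_norm, zero_sub, norm_neg] at hyb; linarith [hρR.2]
    rw [sphSymm_eq] at hyF
    rw [inner_smul_right] at hyi
    have : ¬ ang p y < α ‖y‖ := fun h => hyF ⟨hy0, h⟩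
    nlinarith [mul_nonneg (sub_nonneg.mpr hyi.le) (sub_nonneg.mpr (not_lt.mp this))]

lemma no_radial {n : ℕ} (hn : 2 ≤ n) {p : Euc n} (hp : ‖p‖ = 1) {α β : ℝ → ℝ}
    {I : Set ℝ} (hI : IsOpen I) (hae : ∀ᵐ s ∂(volume.restrict I), β s = α s)
    {x : Euc n} (hx : x ≠ 0) (hxI : ‖x‖ ∈ I) (h0 : 0 < ang p x) (h1 : ang p x < Real.pi)
    (hβ : β ‖x‖ = ang p x) {Λ : ℝ} (hΛ : 0 < Λ) (hlip : ∀ᶠ s in 𝓝 ‖x‖, |β s - β ‖x‖| ≤ Λ * |s - ‖x‖|)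
    (hrad : HasMTNormal (sphSymm n α p) x (hatv x) ∨ HasMTNormal (sphSymm n α p) x (-hatv x)) : False := by
  have hR := norm_pos_iff.mpr hx
  obtain ⟨c, c1, ρ0, hc, hc1, hρ0, H⟩ := sector_lower hn hp hx h0 h1
  obtain ⟨η, hη, hlip⟩ := Metric.eventually_nhds_iff_ball.mp (hlip.and (hI.mem_nhds hxI))
  have hae' := ae_norm hn hae hI.measurableSet
  obtain ⟨e, he, A, hZ, hA⟩ : ∃ e : ℝ, (e = 1 ∨ e = -1) ∧ ∃ A : Set (Euc n), Z0 A x ∧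
      ∀ y : Euc n, y ≠ 0 → ‖y‖ < ‖x‖ → e * (α ‖y‖ - ang p y) < 0 → y ∈ A := by
    rcases hrad with h | h
    · refine ⟨1, Or.inl rfl, _, ((mtn_iff hn).mp h).2.2, fun y hy0 hy h2 => ⟨?_, ?_⟩⟩
      · rw [sphSymm_eq]; rintro ⟨_, h3⟩; linarith
      · linarith [inner_hat_le hx y]
    · refine ⟨-1, Or.inr rfl, _, ((mtn_iff hn).mp h).2.1, fun y hy0 hy h2 => ⟨?_, ?_⟩⟩
      · rw [sphSymm_eq]; exact ⟨hy0, by linarith⟩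
      · rw [inner_neg_right]; linarith [inner_hat_le hx y]
  obtain ⟨k, hk0, hk1, hk2⟩ : ∃ k : ℝ, 0 < k ∧ k ≤ 1/4 ∧ Λ * k ≤ c1 :=
    ⟨min (1/4) (c1 / Λ), by positivity, min_le_left _ _, by
      calc Λ * min (1/4) (c1 / Λ) ≤ Λ * (c1 / Λ) := by gcongr; exact min_le_right _ _
        _ = c1 := by field_simp⟩
  obtain ⟨ρ, hZρ, hρ⟩ := ((hZ (c * k / 2) (by positivity)).and (Ioo_mem_nhdsGT (lt_min hρ0 hη))).exists
  have hρ1 : 0 < ρ := hρ.1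
  have hρ2 : ρ < ρ0 := hρ.2.trans_le (min_le_left _ _)
  have hρ3 : ρ < η := hρ.2.trans_le (min_le_right _ _)
  have h5 := H e he ρ hρ1 hρ2 (Ioo (‖x‖ - k * ρ) ‖x‖) measurableSet_Ioo
  have hsub : Ioo (‖x‖ - k * ρ) ‖x‖ ⊆ closedBall ‖x‖ (ρ / 4) := by
    intro s hs
    rw [mem_closedBall, Real.dist_eq, abs_le]
    constructor <;> nlinarith [hs.1, hs.2]
  rw [inter_eq_left.mpr hsub, Real.volume_Ioo, ← ENNReal.ofReal_mul (by positivity)] at h5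
  have h6 := h5.trans ((measure_mono_ae (t := A ∩ ball x ρ) ?_).trans hZρ)
  · rw [ENNReal.ofReal_le_ofReal_iff (by positivity)] at h6
    obtain ⟨m, rfl⟩ : ∃ m, n = m + 1 := ⟨n - 1, by omega⟩
    simp only [Nat.add_sub_cancel, pow_succ] at h6
    have : 0 < c * k * (ρ ^ m * ρ) := by positivity
    nlinarith
  · filter_upwards [hae'] with y hy hyA
    obtain ⟨⟨hy0, hys, hya⟩, hyb⟩ := hyA
    refine ⟨hA y hy0 hys.2 ?_, hyb⟩
    have hmem : ‖y‖ ∈ ball ‖x‖ η := by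
      rw [mem_ball, Real.dist_eq, abs_lt]
      constructor <;> nlinarith [hys.1, hys.2]
    obtain ⟨h7, h8⟩ := hlip _ hmem
    rw [← hy h8]
    have h9 : |‖y‖ - ‖x‖| ≤ k * ρ := by rw [abs_le]; constructor <;> nlinarith [hys.1, hys.2]
    have h10 : |β ‖y‖ - β ‖x‖| ≤ c1 * ρ := by
      refine h7.trans ?_
      calc Λ * |‖y‖ - ‖x‖| ≤ Λ * (k * ρ) := by gcongr
        _ = (Λ * k) * ρ := by ring
        _ ≤ c1 * ρ := by gcongr
    rw [hβ, abs_le] at h10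
    rcases he with he | he <;> rw [he] at hya ⊢ <;> linarith [h10.1, h10.2]


/-! ## Part 8 -/
open MeasureTheory Metric Set Filter
open scoped ENNReal NNReal Topology RealInnerProductSpace

lemma null_of_lip_inv {f : ℝ → ℝ} {S : Set ℝ} {K : ℝ≥0} (h : ∀ s ∈ S, ∀ t ∈ S, |s - t| ≤ K * |f s - f t|)
    (h0 : volume (f '' S) = 0) : volume S = 0 := by
  set g : ℝ → ℝ := Function.invFunOn f S
  have hg : ∀ s ∈ S, g (f s) ∈ S ∧ f (g (f s)) = f s := fun s hs =>
    ⟨Function.invFunOn_mem ⟨s, hs, rfl⟩, Function.invFunOn_eq ⟨s, hs, rfl⟩⟩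
  have hgs : ∀ s ∈ S, g (f s) = s := by
    intro s hs
    have := h _ (hg s hs).1 s hs
    rw [(hg s hs).2, sub_self, abs_zero, mul_zero] at this
    exact sub_eq_zero.mp (abs_nonpos_iff.mp this)
  have hL : LipschitzOnWith K g (f '' S) := by
    refine LipschitzOnWith.of_dist_le_mul ?_
    rintro _ ⟨s, hs, rfl⟩ _ ⟨t, ht, rfl⟩
    rw [hgs s hs, hgs t ht, Real.dist_eq, Real.dist_eq]
    exact h s hs t ht
  have := hL.hausdorffMeasure_image_le (d := 1) zero_le_one
  rw [hausdorffMeasure_real, h0, mul_zero] at this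
  refine measure_mono_null ?_ (le_antisymm this zero_le)
  intro s hs
  exact ⟨f s, ⟨s, hs, rfl⟩, hgs s hs⟩

/-- A set on which the derivative is nonzero and whose image is null is itself null. -/
lemma null_of_deriv {f : ℝ → ℝ} {T : Set ℝ} (h : ∀ t ∈ T, ∃ f' : ℝ, f' ≠ 0 ∧ HasDerivAt f f' t)
    (h0 : volume (f '' T) = 0) : volume T = 0 := by
  set P : ℕ → Set ℝ := fun k => {t ∈ T | ∀ s : ℝ, |s - t| < 1 / ((k:ℝ) + 1) → |s - t| ≤ ((k:ℝ) + 1) * |f s - f t|}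
  have hcov : T ⊆ ⋃ (k : ℕ) (q : ℚ), P k ∩ ball (q : ℝ) (1 / (2 * ((k:ℝ) + 1))) := by
    intro t ht
    obtain ⟨f', hf', hd⟩ := h t ht
    have h1 := hd.tendsto_slope.abs
    have h2 : ∀ᶠ s in 𝓝[≠] t, |f'| / 2 < |slope f t s| := h1.eventually_const_lt (by have := abs_pos.mpr hf'; linarith)
    rw [eventually_nhdsWithin_iff] at h2
    obtain ⟨δ, hδ, h3⟩ := Metric.eventually_nhds_iff.mp h2
    obtain ⟨k, hk⟩ := exists_nat_gt (max (1 / δ) (2 / |f'|))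
    have hf0 := abs_pos.mpr hf'
    have hk1 : 1 / ((k:ℝ) + 1) < δ := by
      rw [div_lt_comm₀ (by positivity) hδ]; linarith [le_max_left (1/δ) (2/|f'|)]
    have hk2 : 1 ≤ ((k:ℝ) + 1) * (|f'| / 2) := by
      have : 2 / |f'| < (k:ℝ) + 1 := by linarith [le_max_right (1/δ) (2/|f'|)]
      rw [div_lt_iff₀ hf0] at this
      linarith
    obtain ⟨q, hq1, hq2⟩ := exists_rat_btwn (show t - 1 / (2 * ((k:ℝ) + 1)) < t from by
      have : 0 < 1 / (2 * ((k:ℝ) + 1)) := by positivity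
      linarith)
    refine mem_iUnion.mpr ⟨k, mem_iUnion.mpr ⟨q, ⟨ht, fun s hs => ?_⟩, ?_⟩⟩
    · rcases eq_or_ne s t with rfl | hne
      · simp
      have h4 := h3 (y := s) (by rw [Real.dist_eq]; linarith) hne
      rw [slope_def_field, abs_div] at h4
      have h5 : 0 < |s - t| := abs_pos.mpr (sub_ne_zero.mpr hne)
      rw [lt_div_iff₀ h5] at h4
      nlinarith [abs_nonneg (f s - f t)]
    · rw [mem_ball, Real.dist_eq, abs_lt]; constructor <;> linarith
  refine measure_mono_null hcov (measure_iUnion_null fun k => measure_iUnion_null fun q => ?_)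
  refine null_of_lip_inv (f := f) (K := (k:ℝ≥0) + 1) ?_ (measure_mono_null (image_mono ?_) h0)
  · rintro s ⟨hs, hsq⟩ t ⟨ht, htq⟩
    have := ht.2 s ?_
    · exact_mod_cast this
    · rw [mem_ball, Real.dist_eq, abs_lt] at hsq htq
      have e : 1 / ((k:ℝ) + 1) = 2 * (1 / (2 * ((k:ℝ) + 1))) := by field_simp
      rw [e, abs_lt]; constructor <;> linarith [hsq.1, hsq.2, htq.1, htq.2]
  · exact fun t ht => ht.1.1

/-- `w` has infinite derivative (with a sign) at `r`. -/
def InfSlope (w : ℝ → ℝ) (r : ℝ) : Prop :=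
  ∃ e : ℝ, (e = 1 ∨ e = -1) ∧ Tendsto (fun s => e * slope w r s) (𝓝[≠] r) atTop

lemma infSlope_of {w h ψ : ℝ → ℝ} (hh : StrictMono h) (hc : Continuous h) (hψ : ∀ t, ψ (h t) = t)
    {r u' : ℝ} (hd0 : HasDerivAt ψ 0 (h r)) (hu : HasDerivAt (w ∘ ψ) u' (h r)) (hu' : u' ≠ 0) : InfSlope w r := by
  have htend : Tendsto h (𝓝[≠] r) (𝓝[≠] (h r)) := by
    refine tendsto_nhdsWithin_iff.mpr ⟨(hc.tendsto r).mono_left nhdsWithin_le_nhds, ?_⟩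
    filter_upwards [self_mem_nhdsWithin] with s hs
    exact fun h' => hs (hh.injective h')
  have h1 := hu.tendsto_slope.comp htend
  have h2 := hd0.tendsto_slope.comp htend
  have h3 : Tendsto (fun s => slope ψ (h r) (h s)) (𝓝[≠] r) (𝓝[>] 0) := by
    refine tendsto_nhdsWithin_iff.mpr ⟨h2, ?_⟩
    filter_upwards [self_mem_nhdsWithin] with s hs
    rw [slope_def_field, hψ, hψ]
    rcases lt_or_gt_of_ne (show s ≠ r from hs) with h' | h'
    · exact div_pos_of_neg_of_neg (sub_neg.mpr h') (sub_neg.mpr (hh h'))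
    · exact div_pos (sub_pos.mpr h') (sub_pos.mpr (hh h'))
  have h4 := tendsto_inv_nhdsGT_zero.comp h3
  obtain ⟨e, he, heu⟩ : ∃ e : ℝ, (e = 1 ∨ e = -1) ∧ 0 < e * u' := by
    rcases lt_or_gt_of_ne hu' with h' | h'
    · exact ⟨-1, Or.inr rfl, by linarith⟩
    · exact ⟨1, Or.inl rfl, by linarith⟩
  refine ⟨e, he, ?_⟩
  have h5 := Filter.Tendsto.pos_mul_atTop heu (h1.const_mul e) h4
  refine h5.congr' ?_
  filter_upwards [self_mem_nhdsWithin] with s hs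
  have hs : s ≠ r := hs
  have e1 : h s - h r ≠ 0 := sub_ne_zero.mpr (hh.injective.ne hs)
  have e2 : s - r ≠ 0 := sub_ne_zero.mpr hs
  simp only [Function.comp_apply, slope_def_field, hψ]
  field_simp

lemma ac_global (lam : Measure ℝ) [IsFiniteMeasure lam] (hat : ∀ r, lam {r} = 0) (w : ℝ → ℝ)
    (hw : ∀ x y, x ≤ y → |w y - w x| ≤ (lam (Icc x y)).toReal)
    (HN : ∀ D : Set ℝ, volume D = 0 → (∀ r ∈ D, InfSlope w r) → volume (w '' D) = 0) :
    ∃ g : ℝ → ℝ, (∀ x y, x ≤ y → IntegrableOn g (Ioc x y)) ∧ ∀ x y, x ≤ y → w y - w x = ∫ t in x..y, g t := by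
  haveI : NullSingletonClass lam := ⟨hat⟩
  set μ : Measure ℝ := volume + lam with hμ
  haveI : NullSingletonClass μ := ⟨fun r => by rw [hμ, Measure.add_apply, hat]; simp⟩
  haveI : IsLocallyFiniteMeasure μ := by
    refine ⟨fun x => ⟨Ioo (x - 1) (x + 1), Ioo_mem_nhds (by linarith) (by linarith), ?_⟩⟩
    rw [hμ, Measure.add_apply, Real.volume_Ioo]
    exact ENNReal.add_lt_top.mpr ⟨ENNReal.ofReal_lt_top, measure_lt_top _ _⟩
  set h : ℝ → ℝ := fun t => ∫ _ in (0:ℝ)..t, (1:ℝ) ∂μ with hh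
  have hinteg : ∀ a b : ℝ, IntervalIntegrable (fun _ => (1:ℝ)) μ a b := fun a b =>
    intervalIntegrable_const
  have hcont : Continuous h := intervalIntegral.continuous_primitive hinteg 0
  have hdiff : ∀ x y, x ≤ y → h y - h x = (μ (Ioc x y)).toReal := by
    intro x y hxy
    rw [hh]
    simp only
    rw [intervalIntegral.integral_interval_sub_left (hinteg _ _) (hinteg _ _), intervalIntegral.integral_of_le hxy]
    simp [Measure.real]
  have hfin : ∀ x y : ℝ, μ (Ioc x y) ≠ ⊤ := fun x y => measure_Ioc_lt_top.ne
  have hge : ∀ x y, x ≤ y → y - x ≤ h y - h x := by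
    intro x y hxy
    rw [hdiff x y hxy]
    have : (volume (Ioc x y)).toReal ≤ (μ (Ioc x y)).toReal := by
      refine ENNReal.toReal_mono (hfin x y) ?_
      rw [hμ, Measure.add_apply]; exact le_self_add
    rwa [Real.volume_Ioc, ENNReal.toReal_ofReal (by linarith)] at this
  have hmono : StrictMono h := fun x y hxy => by linarith [hge x y hxy.le]
  have hsurj : Function.Surjective h := by
    apply hcont.surjective
    · refine tendsto_atTop_mono' atTop ?_ (tendsto_atTop_add_const_left atTop (h 0) tendsto_id)
      filter_upwards [eventually_ge_atTop 0] with t ht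
      have := hge 0 t ht
      simp only [id]; linarith
    · refine tendsto_atBot_mono' atBot ?_ (tendsto_atBot_add_const_left atBot (h 0) tendsto_id)
      filter_upwards [eventually_le_atBot 0] with t ht
      have := hge t 0 ht
      simp only [id]; linarith
  set e : ℝ ≃o ℝ := hmono.orderIsoOfSurjective h hsurj with he
  have heh : ∀ t, e t = h t := fun t => rfl
  set ψ : ℝ → ℝ := fun t => e.symm t with hψd
  have hψh : ∀ t, ψ (h t) = t := fun t => e.symm_apply_apply t
  have hhψ : ∀ t, h (ψ t) = t := fun t => e.apply_symm_apply t
  have hψmono : Monotone ψ := e.symm.monotone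
  have hψlip : LipschitzWith 1 ψ := by
    refine LipschitzWith.of_dist_le_mul ?_
    intro s t
    wlog hst : s ≤ t generalizing s t
    · rw [dist_comm, dist_comm s]; exact this t s (le_of_not_ge hst)
    have := hge _ _ (hψmono hst)
    rw [hhψ, hhψ] at this
    rw [dist_comm, dist_comm s, Real.dist_eq, Real.dist_eq, abs_of_nonneg (by linarith [hψmono hst]), abs_of_nonneg (by linarith)]
    simpa using this
  set u : ℝ → ℝ := w ∘ ψ with hu
  have hulip : LipschitzWith 1 u := by
    refine LipschitzWith.of_dist_le_mul ?_
    intro s t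
    wlog hst : s ≤ t generalizing s t
    · rw [dist_comm, dist_comm s]; exact this t s (le_of_not_ge hst)
    have h1 := hdiff _ _ (hψmono hst)
    rw [hhψ, hhψ] at h1
    rw [dist_comm, dist_comm s, Real.dist_eq, Real.dist_eq, abs_of_nonneg (show 0 ≤ t - s by linarith), h1]
    simp only [NNReal.coe_one, one_mul]
    refine (hw _ _ (hψmono hst)).trans (ENNReal.toReal_mono (hfin _ _) ?_)
    rw [hμ, Measure.add_apply, ← measure_congr (Ioc_ae_eq_Icc (μ := lam))]
    exact le_add_self
  have hmap : Measure.map h μ = volume := by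
    symm
    refine Real.measure_ext_Ioo_rat fun a b => ?_
    rw [Measure.map_apply hcont.measurable measurableSet_Ioo]
    have : h ⁻¹' Ioo (a:ℝ) b = Ioo (ψ a) (ψ b) := by
      ext t
      constructor
      · rintro ⟨h1, h2⟩
        rw [← hhψ a, hmono.lt_iff_lt] at h1
        rw [← hhψ b, hmono.lt_iff_lt] at h2
        exact ⟨h1, h2⟩
      · rintro ⟨h1, h2⟩
        rw [← hmono.lt_iff_lt, hhψ] at h1 h2
        exact ⟨h1, h2⟩
    rw [this, measure_congr (Ioo_ae_eq_Ioc (μ := μ)), Real.volume_Ioo]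
    rcases le_total (a:ℝ) b with hab | hab
    · have := hdiff _ _ (hψmono hab)
      rw [hhψ, hhψ] at this
      rw [this, ENNReal.ofReal_toReal (hfin _ _)]
    · rw [Ioc_eq_empty (not_lt.mpr (hψmono hab)), measure_empty, ENNReal.ofReal_of_nonpos (by linarith)]
  have hemb : MeasurableEmbedding h := e.toHomeomorph.measurableEmbedding
  have hnull : ∀ T : Set ℝ, volume T = 0 → μ (h ⁻¹' T) = 0 := by
    intro T hT
    rw [← hmap] at hT
    rwa [hemb.map_apply] at hT
  have hFTC : ∀ x y, x ≤ y → w y - w x = ∫ t in Ioc x y, deriv u (h t) ∂μ := by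
    intro x y hxy
    have h1 : AbsolutelyContinuousOnInterval u (h x) (h y) :=
      (hulip.lipschitzOnWith (s := uIcc (h x) (h y))).absolutelyContinuousOnInterval
    have h2 := h1.integral_deriv_eq_sub
    rw [hu] at h2
    simp only [Function.comp_apply, hψh] at h2
    rw [← h2, intervalIntegral.integral_of_le (hmono.monotone hxy), ← hu, ← hmap, hemb.setIntegral_map]
    congr 2
    ext t
    simp only [mem_preimage, mem_Ioc, hmono.lt_iff_lt, hmono.le_iff_le]
  -- singular part
  obtain ⟨s, hsm, hs1, hs2⟩ := Measure.mutuallySingular_singularPart lam volume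
  have hzero : ∀ᵐ t ∂μ, t ∈ sᶜ → deriv u (h t) = 0 := by
    have hT1 : volume {t | ψ t ∈ sᶜ ∧ ∃ d, d ≠ 0 ∧ HasDerivAt ψ d t} = 0 := by
      refine null_of_deriv (f := ψ) (fun t ht => ht.2) (measure_mono_null ?_ hs2)
      rintro _ ⟨t, ht, rfl⟩
      exact ht.1
    have hT2 : volume {t | ψ t ∈ sᶜ ∧ HasDerivAt ψ 0 t ∧ ∃ d, d ≠ 0 ∧ HasDerivAt u d t} = 0 := by
      refine null_of_deriv (f := u) (fun t ht => ht.2.2) ?_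
      rw [hu, image_comp]
      refine HN _ (measure_mono_null ?_ hs2) ?_
      · rintro _ ⟨t, ht, rfl⟩
        exact ht.1
      · rintro _ ⟨t, ⟨_, h1, d, h2, h3⟩, rfl⟩
        refine infSlope_of (h := h) (ψ := ψ) (u' := d) hmono hcont hψh ?_ ?_ h2
        · rwa [hhψ]
        · rwa [hhψ]
    have hae : ∀ᵐ t : ℝ, ψ t ∈ sᶜ → deriv u t = 0 := by
      filter_upwards [measure_eq_zero_iff_ae_notMem.mp hT1, measure_eq_zero_iff_ae_notMem.mp hT2,
        hψlip.ae_differentiableAt_real, hulip.ae_differentiableAt_real] with t h1 h2 h3 h4 hts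
      by_contra hne
      have h5 : deriv ψ t = 0 := by
        by_contra h5
        exact h1 ⟨hts, _, h5, h3.hasDerivAt⟩
      exact h2 ⟨hts, by rw [← h5]; exact h3.hasDerivAt, _, hne, h4.hasDerivAt⟩
    refine measure_mono_null ?_ (hnull _ hae)
    intro t ht
    simp only [mem_compl_iff, mem_setOf_eq, mem_preimage] at ht ⊢
    rwa [hψh]
  set ν := μ.restrict s with hν
  have hac : ν ≪ volume := by
    refine Measure.AbsolutelyContinuous.mk fun N hNm hN => ?_
    rw [hν, Measure.restrict_apply hNm, hμ, Measure.add_apply]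
    rw [measure_mono_null inter_subset_left hN, zero_add]
    rw [← Measure.singularPart_add_rnDeriv lam volume, Measure.add_apply]
    rw [measure_mono_null inter_subset_right hs1, zero_add]
    exact withDensity_absolutelyContinuous _ _ (measure_mono_null inter_subset_left hN)
  have hbound : ∀ t, ‖deriv u t‖ ≤ 1 := by
    intro t
    have := norm_deriv_le_of_lipschitz (x₀ := t) hulip
    simpa using this
  have hmeas : Measurable fun t => deriv u (h t) := (measurable_deriv u).comp hcont.measurable
  have hintegν : ∀ x y, IntegrableOn (fun t => deriv u (h t)) (Ioc x y) ν := by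
    intro x y
    refine Measure.integrableOn_of_bounded (M := 1) ?_ hmeas.aestronglyMeasurable ?_
    · exact ((Measure.restrict_apply_le s _).trans_lt measure_Ioc_lt_top).ne
    · exact Eventually.of_forall fun t => hbound _
  refine ⟨fun t => (ν.rnDeriv volume t).toReal • deriv u (h t), ?_, ?_⟩
  · intro x y hxy
    have h1 : Integrable ((Ioc x y).indicator fun t => deriv u (h t)) ν :=
      (integrable_indicator_iff measurableSet_Ioc).mpr (hintegν x y)
    have h2 := (integrable_rnDeriv_smul_iff hac).mpr h1
    rw [← integrable_indicator_iff measurableSet_Ioc]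
    refine h2.congr (Eventually.of_forall fun t => ?_)
    by_cases ht : t ∈ Ioc x y
    · simp [ht]
    · simp [ht]
  · intro x y hxy
    rw [intervalIntegral.integral_of_le hxy, setIntegral_rnDeriv_smul hac measurableSet_Ioc, hFTC x y hxy]
    rw [hν, Measure.restrict_restrict measurableSet_Ioc]
    rw [← integral_inter_add_diff (s := Ioc x y) (t := s) hsm]
    · rw [add_eq_left]
      refine setIntegral_eq_zero_of_ae_eq_zero ?_
      filter_upwards [hzero] with t ht hts
      exact ht hts.2
    · refine Measure.integrableOn_of_bounded (M := 1) (hfin x y) hmeas.aestronglyMeasurable ?_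
      exact Eventually.of_forall fun t => hbound _


/-! ## Part 9 -/
open MeasureTheory Metric Set Filter
open scoped ENNReal NNReal Topology RealInnerProductSpace

lemma InfSlope.congr {w w' : ℝ → ℝ} {r : ℝ} (h : InfSlope w r) (he : w' =ᶠ[𝓝 r] w) : InfSlope w' r := by
  obtain ⟨e, h1, h2⟩ := h
  refine ⟨e, h1, h2.congr' ?_⟩
  have h3 : w' r = w r := he.self_of_nhds
  filter_upwards [he.filter_mono nhdsWithin_le_nhds] with s hs
  rw [slope_def_field, slope_def_field, hs, h3]

lemma not_infSlope_const {w : ℝ → ℝ} {r c : ℝ} (he : w =ᶠ[𝓝 r] fun _ => c) : ¬ InfSlope w r := by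
  intro h
  obtain ⟨e, _, h2⟩ := h.congr he.symm
  simp only [slope_def_field, sub_self, zero_div, mul_zero] at h2
  exact (not_tendsto_const_atTop (α := ℝ) 0 (𝓝[≠] r)) h2

lemma ac_local {a b : ℝ} (hab : a < b) (lam : Measure ℝ) [IsFiniteMeasure lam] (hat : ∀ r ∈ Icc a b, lam {r} = 0)
    (w : ℝ → ℝ)
    (hw : ∀ x y, a ≤ x → x ≤ y → y ≤ b → |w y - w x| ≤ (lam (Icc x y)).toReal)
    (HN : ∀ D : Set ℝ, D ⊆ Ioo a b → volume D = 0 → (∀ r ∈ D, InfSlope w r) → volume (w '' D) = 0) :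
    ∃ g : ℝ → ℝ, IntegrableOn g (Ioc a b) ∧ ∀ x y, a ≤ x → x ≤ y → y ≤ b → w y - w x = ∫ t in x..y, g t := by
  set pr : ℝ → ℝ := fun t => max a (min b t) with hpr
  have hpr_mono : Monotone pr := fun s t hst => max_le_max le_rfl (min_le_min le_rfl hst)
  have hpr_id : ∀ t, a ≤ t → t ≤ b → pr t = t := fun t h1 h2 => by
    rw [hpr]; simp only; rw [min_eq_right h2, max_eq_right h1]
  have hpr_lo : ∀ t, t ≤ a → pr t = a := fun t h1 => by
    rw [hpr]; simp only; rw [min_eq_right (by linarith), max_eq_left h1]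
  have hpr_hi : ∀ t, b ≤ t → pr t = b := fun t h1 => by
    rw [hpr]; simp only; rw [min_eq_left h1, max_eq_right hab.le]
  have hpr_mem : ∀ t, a ≤ pr t ∧ pr t ≤ b := fun t => ⟨le_max_left _ _, max_le hab.le (min_le_left _ _)⟩
  have hA1 : ∀ r, lam.restrict (Icc a b) {r} = 0 := by
    intro r
    rw [Measure.restrict_apply (measurableSet_singleton r)]
    by_cases hr : r ∈ Icc a b
    · exact measure_mono_null inter_subset_left (hat r hr)
    · rw [singleton_inter_eq_empty.mpr hr, measure_empty]
  have hA2 : ∀ x y, x ≤ y → |(w ∘ pr) y - (w ∘ pr) x| ≤ (lam.restrict (Icc a b) (Icc x y)).toReal := by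
    intro x y hxy
    simp only [Function.comp_apply]
    rcases eq_or_lt_of_le (hpr_mono hxy) with h | h
    · rw [h, sub_self, abs_zero]; exact ENNReal.toReal_nonneg
    · refine (hw _ _ (hpr_mem x).1 h.le (hpr_mem y).2).trans (ENNReal.toReal_mono (measure_ne_top _ _) ?_)
      rw [Measure.restrict_apply measurableSet_Icc]
      refine measure_mono (subset_inter (Icc_subset_Icc ?_ ?_) (Icc_subset_Icc (hpr_mem x).1 (hpr_mem y).2))
      · by_contra hc
        have : b < x := by
          by_contra hb
          rcases le_total x a with h' | h'
          · rw [hpr_lo x h'] at hc; linarith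
          · rw [hpr_id x h' (not_lt.mp hb)] at hc; linarith
        rw [hpr_hi x this.le, hpr_hi y (by linarith)] at h; linarith
      · by_contra hc
        have : y < a := by
          by_contra hb
          rcases le_total b y with h' | h'
          · rw [hpr_hi y h'] at hc; linarith
          · rw [hpr_id y (not_lt.mp hb) h'] at hc; linarith
        rw [hpr_lo y this.le, hpr_lo x (by linarith)] at h; linarith
  have hA3 : ∀ D : Set ℝ, volume D = 0 → (∀ r ∈ D, InfSlope (w ∘ pr) r) → volume ((w ∘ pr) '' D) = 0 := by
    intro D hD hinf
    have hsub : (w ∘ pr) '' D ⊆ w '' (D ∩ Ioo a b) ∪ {w a, w b} := by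
      rintro _ ⟨r, hr, rfl⟩
      simp only [Function.comp_apply]
      rcases le_or_gt r a with h1 | h1
      · right; rw [hpr_lo r h1]; left; rfl
      rcases le_or_gt b r with h2 | h2
      · right; rw [hpr_hi r h2]; right; rfl
      · left; rw [hpr_id r h1.le h2.le]; exact ⟨r, ⟨hr, h1, h2⟩, rfl⟩
    refine measure_mono_null hsub (measure_union_null (HN _ inter_subset_right (measure_mono_null inter_subset_left hD) ?_) ?_)
    · rintro r ⟨hr, h1, h2⟩
      refine (hinf r hr).congr ?_
      filter_upwards [Ioo_mem_nhds h1 h2] with s hs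
      simp only [Function.comp_apply]
      rw [hpr_id s hs.1.le hs.2.le]
    · exact ((finite_singleton (w b)).insert (w a)).measure_zero _
  obtain ⟨g, hg1, hg2⟩ := ac_global (lam.restrict (Icc a b)) hA1 (w ∘ pr) hA2 hA3
  refine ⟨g, hg1 a b hab.le, fun x y hx hxy hy => ?_⟩
  have := hg2 x y hxy
  simp only [Function.comp_apply] at this
  rwa [hpr_id x hx (hxy.trans hy), hpr_id y (hx.trans hxy) hy] at this

lemma deriv_ae {a b : ℝ} (hab : a ≤ b) {w g : ℝ → ℝ} (hg : IntegrableOn g (Ioc a b))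
    (h : ∀ x y, a ≤ x → x ≤ y → y ≤ b → w y - w x = ∫ t in x..y, g t) :
    ∀ᵐ x : ℝ, x ∈ Ioo a b → HasDerivAt w (g x) x := by
  have hi : IntervalIntegrable g volume a b := (intervalIntegrable_iff_integrableOn_Ioc_of_le hab).mpr hg
  filter_upwards [hi.ae_hasDerivAt_integral] with x hx hxab
  have hxu : x ∈ uIcc a b := by rw [uIcc_of_le hab]; exact Ioo_subset_Icc_self hxab
  have h1 := hx hxu a left_mem_uIcc
  have h2 := h1.const_add (w a)
  refine h2.congr_of_eventuallyEq ?_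
  filter_upwards [Ioo_mem_nhds hxab.1 hxab.2] with s hs
  have := h a s le_rfl hs.1.le hs.2.le
  linarith

lemma glue {I : Set ℝ} (hI : IsOpen I) {w : ℝ → ℝ}
    (h : ∀ a b, a < b → Icc a b ⊆ I → ∃ g : ℝ → ℝ, IntegrableOn g (Ioc a b) ∧
      ∀ x y, a ≤ x → x ≤ y → y ≤ b → w y - w x = ∫ t in x..y, g t) :
    LocallyIntegrableOn (deriv w) I volume ∧ ∀ a b, uIcc a b ⊆ I → w b - w a = ∫ t in a..b, deriv w t := by
  have key : ∀ a b, a < b → Icc a b ⊆ I → IntegrableOn (deriv w) (Ioc a b) ∧ w b - w a = ∫ t in a..b, deriv w t := by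
    intro a b hab hsub
    obtain ⟨g, hg1, hg2⟩ := h a b hab hsub
    have hd := deriv_ae hab.le hg1 hg2
    have hb : ∀ᵐ x : ℝ, x ≠ b := by simp [ae_iff, measure_singleton]
    have he : ∀ᵐ x : ℝ, x ∈ Ioc a b → g x = deriv w x := by
      filter_upwards [hd, hb] with x hx hxb hxab
      exact (hx ⟨hxab.1, lt_of_le_of_ne hxab.2 hxb⟩).deriv.symm
    refine ⟨hg1.congr_fun_ae ((ae_restrict_iff' measurableSet_Ioc).mpr he), ?_⟩
    rw [hg2 a b le_rfl hab.le le_rfl]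
    refine intervalIntegral.integral_congr_ae ?_
    rw [uIoc_of_le hab.le]; exact he
  constructor
  · intro x hx
    obtain ⟨δ, hδ, hb⟩ := Metric.isOpen_iff.mp hI x hx
    have hsub : Icc (x - δ/2) (x + δ/2) ⊆ I := fun y hy => hb (by
      rw [mem_ball, Real.dist_eq, abs_lt]; constructor <;> linarith [hy.1, hy.2])
    refine ⟨Ioc (x - δ/2) (x + δ/2), mem_nhdsWithin_of_mem_nhds (Ioc_mem_nhds (by linarith) (by linarith)), ?_⟩
    exact (key _ _ (by linarith) hsub).1
  · intro a b hab
    rcases lt_trichotomy a b with h1 | h1 | h1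
    · rw [uIcc_of_le h1.le] at hab
      exact (key a b h1 hab).2
    · rw [h1]; simp
    · rw [uIcc_of_ge h1.le] at hab
      rw [intervalIntegral.integral_symm, ← (key b a h1 hab).2]; ring


/-! ## Part 10 -/
open MeasureTheory Metric Set Filter
open scoped ENNReal NNReal Topology RealInnerProductSpace

noncomputable section

/-- Radial projection of the perimeter measure. -/
def lam0 {n : ℕ} (F : Set (Euc n)) : Measure ℝ :=
  Measure.map (fun x : Euc n => ‖x‖) ((μH[(n:ℝ) - 1] : Measure (Euc n)).restrict (essBoundary F))

lemma lam0_apply {n : ℕ} (F : Set (Euc n)) {B : Set ℝ} (hB : MeasurableSet B) :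
    lam0 F B = μH[(n:ℝ) - 1] (essBoundary F ∩ {x | ‖x‖ ∈ B}) := by
  unfold lam0
  rw [Measure.map_apply measurable_norm hB, Measure.restrict_apply (measurable_norm hB), inter_comm]
  rfl

lemma lam0_finite {n : ℕ} {F : Set (Euc n)} (h : perim F univ < ⊤) : IsFiniteMeasure (lam0 F) := by
  refine ⟨?_⟩
  rw [lam0_apply F MeasurableSet.univ]
  unfold perim at h
  simpa using h

lemma hat_image_le {n : ℕ} (hn : 2 ≤ n) {a : ℝ} (ha : 0 < a) : ∃ C : ℝ≥0, ∀ X : Set (Euc n),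
    (∀ x ∈ X, a ≤ ‖x‖) → μH[(n:ℝ) - 1] (hatv '' X) ≤ C * μH[(n:ℝ) - 1] X := by
  refine ⟨((2 / a).toNNReal) ^ ((n:ℝ) - 1), fun X hX => ?_⟩
  have hL : LipschitzOnWith (2 / a).toNNReal (hatv : Euc n → Euc n) X := by
    refine LipschitzOnWith.of_dist_le_mul fun x hx y hy => ?_
    have hx' := hX x hx
    have hx0 : x ≠ 0 := norm_pos_iff.mp (by linarith)
    rw [dist_eq_norm, dist_eq_norm, Real.coe_toNNReal _ (by positivity)]
    refine (hatv_lip hx0 y).trans ?_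
    gcongr
  have hd := dim_pos hn
  have := hL.hausdorffMeasure_image_le (d := (n:ℝ) - 1) (by linarith)
  rwa [← ENNReal.coe_rpow_of_nonneg _ (by linarith : (0:ℝ) ≤ (n:ℝ) - 1)] at this

lemma K_est {n : ℕ} (hn : 2 ≤ n) {p : Euc n} (hp : ‖p‖ = 1) {α : ℝ → ℝ} (hα : Measurable α)
    (hαm : ∀ r, α r ∈ Icc (0:ℝ) Real.pi) (hF : perim (sphSymm n α p) univ < ⊤) {a : ℝ} (ha : 0 < a) :
    ∃ C : ℝ≥0, ∀ r1 r2, a ≤ r1 → r1 < r2 → ApGood α r1 → ApGood α r2 →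
      |Gf p (α r2) - Gf p (α r1)| ≤ C * (lam0 (sphSymm n α p) (Ioo r1 r2)).toReal := by
  obtain ⟨C, hC⟩ := hat_image_le hn ha
  have := lam0_finite hF
  refine ⟨C, fun r1 r2 h1 h12 g1 g2 => ?_⟩
  set m := min (α r1) (α r2) with hm
  set M := max (α r1) (α r2) with hM
  have hGm := Gf_mono hn hp
  have habs : |Gf p (α r2) - Gf p (α r1)| = Gf p M - Gf p m := by
    rcases le_total (α r1) (α r2) with h | h
    · rw [hm, hM, min_eq_left h, max_eq_right h, abs_of_nonneg (sub_nonneg.mpr (hGm h))]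
    · rw [hm, hM, min_eq_right h, max_eq_left h, abs_of_nonpos (sub_nonpos.mpr (hGm h)), neg_sub]
  have h2 := Gf_sub_le hn hp (min_le_max : m ≤ M)
  have hsub : {x : Euc n | ‖x‖ = 1 ∧ ang p x ∈ Ioo m M} ⊆
      hatv '' (essBoundary (sphSymm n α p) ∩ {x | ‖x‖ ∈ Ioo r1 r2}) := by
    rintro ω ⟨hω, ht1, ht2⟩
    set t := ang p ω with ht
    have h0 : 0 < t := lt_of_le_of_lt (le_min (hαm r1).1 (hαm r2).1) ht1
    have hpi : t < Real.pi := lt_of_lt_of_le ht2 (max_le (hαm r1).2 (hαm r2).2)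
    have hSm : MeasurableSet {s | t < α s} := measurableSet_lt measurable_const hα
    have hcompl : {s | α s ≤ t} = {s | t < α s}ᶜ := by ext s; simp
    have hor : (D0 {s | t < α s} r1 ∧ D0 {s | t < α s}ᶜ r2) ∨ (D0 {s | t < α s}ᶜ r1 ∧ D0 {s | t < α s} r2) := by
      rcases le_total (α r1) (α r2) with h | h
      · rw [hm, min_eq_left h] at ht1
        rw [hM, max_eq_right h] at ht2
        left; refine ⟨g1.lt ht1, ?_⟩
        rw [← hcompl]; exact g2.gt ht2
      · rw [hm, min_eq_right h] at ht1
        rw [hM, max_eq_left h] at ht2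
        right; refine ⟨?_, g2.lt ht1⟩
        rw [← hcompl]; exact g1.gt ht2
    obtain ⟨r, hr, hn1, hn2⟩ := darboux hSm h12 hor
    have hr0 : 0 < r := by linarith [hr.1]
    have hnorm : ‖r • ω‖ = r := by rw [norm_smul, hω, mul_one, Real.norm_of_nonneg hr0.le]
    have hne : r • ω ≠ 0 := norm_pos_iff.mp (by rw [hnorm]; exact hr0)
    have hang : ang p (r • ω) = t := ang_smul p hr0
    refine ⟨r • ω, ⟨⟨?_, ?_⟩, ?_⟩, ?_⟩
    · rw [dens0_iff hn]
      intro hz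
      apply hn1
      have := D1a hn hp hα hne (by rwa [hang]) (by rwa [hang]) hz
      rwa [hang, hnorm] at this
    · rw [dens1_iff hn (measurableSet_sphSymm hα p)]
      intro hz
      apply hn2
      have := D1b hn hp hα hne (by rwa [hang]) (by rwa [hang]) hz
      rwa [hang, hnorm] at this
    · simp only [mem_setOf_eq, hnorm]; exact hr
    · rw [hatv_smul hr0, hatv_of_norm_one hω]
  have h3 := h2.trans ((measure_mono hsub).trans (hC _ ?_))
  · rw [← lam0_apply _ measurableSet_Ioo] at h3
    rw [habs]
    have h4 := (ENNReal.ofReal_le_iff_le_toReal (ENNReal.mul_ne_top ENNReal.coe_ne_top (measure_ne_top _ _))).mp h3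
    rwa [ENNReal.toReal_mul, ENNReal.coe_toReal] at h4
  · rintro x ⟨_, hx⟩
    exact h1.trans hx.1.le

lemma proj_null {n : ℕ} (hn : 2 ≤ n) {p : Euc n} (hp : ‖p‖ = 1) {a : ℝ} (ha : 0 < a) {Θ : Set ℝ} {R : ℝ → ℝ}
    (hΘ : Θ ⊆ Ioo 0 Real.pi) (hR : ∀ t ∈ Θ, a ≤ R t)
    (h0 : μH[(n:ℝ) - 1] {x : Euc n | x ≠ 0 ∧ ang p x ∈ Θ ∧ ‖x‖ = R (ang p x)} = 0) : volume Θ = 0 := by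
  obtain ⟨C, hC⟩ := hat_image_le hn ha
  have hcov : Θ ⊆ ⋃ k : ℕ, Θ ∩ Icc (1 / ((k:ℝ) + 1)) (Real.pi - 1 / ((k:ℝ) + 1)) := by
    intro t ht
    obtain ⟨h1, h2⟩ := hΘ ht
    obtain ⟨k, hk⟩ := exists_nat_one_div_lt (lt_min h1 (sub_pos.mpr h2))
    refine mem_iUnion.mpr ⟨k, ht, ?_, ?_⟩
    · linarith [min_le_left t (Real.pi - t)]
    · linarith [min_le_right t (Real.pi - t)]
  refine measure_mono_null hcov (measure_iUnion_null fun k => ?_)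
  obtain ⟨c, hc, H⟩ := rot_lower hn hp (ε := 1 / ((k:ℝ) + 1)) (by positivity)
  have h1 := H (Θ ∩ Icc (1 / ((k:ℝ) + 1)) (Real.pi - 1 / ((k:ℝ) + 1))) inter_subset_right
  have h2 : μH[(n:ℝ) - 1] {x : Euc n | ‖x‖ = 1 ∧ ang p x ∈ Θ ∩ Icc (1 / ((k:ℝ) + 1)) (Real.pi - 1 / ((k:ℝ) + 1))} = 0 := by
    refine measure_mono_null ?_ (le_antisymm ((hC {x : Euc n | x ≠ 0 ∧ ang p x ∈ Θ ∧ ‖x‖ = R (ang p x)} ?_).trans (by rw [h0, mul_zero])) zero_le)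
    · rintro ω ⟨hω, hωt, _⟩
      have hr0 : 0 < R (ang p ω) := ha.trans_le (hR _ hωt)
      have hnorm : ‖R (ang p ω) • ω‖ = R (ang p ω) := by rw [norm_smul, hω, mul_one, Real.norm_of_nonneg hr0.le]
      refine ⟨R (ang p ω) • ω, ⟨norm_pos_iff.mp (by rw [hnorm]; exact hr0), ?_, ?_⟩, ?_⟩
      · rwa [ang_smul p hr0]
      · rw [hnorm, ang_smul p hr0]
      · rw [hatv_smul hr0, hatv_of_norm_one hω]
    · rintro x ⟨_, hx, hx2⟩
      rw [hx2]; exact hR _ hx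
  rw [h2] at h1
  have h3 := le_antisymm h1 zero_le
  rcases mul_eq_zero.mp h3 with h | h
  · exact absurd (ENNReal.coe_eq_zero.mp h) hc
  · exact h

/-- Radial-normal points over null sets of radii are negligible. -/
def QP (n : ℕ) (p : Euc n) (α : ℝ → ℝ) (I : Set ℝ) : Prop :=
  ∀ D : Set ℝ, D ⊆ I → volume D = 0 → μH[(n:ℝ) - 1] {x : Euc n | x ≠ 0 ∧ ‖x‖ ∈ D ∧
    (HasMTNormal (sphSymm n α p) x (hatv x) ∨ HasMTNormal (sphSymm n α p) x (-hatv x))} = 0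

lemma small_tail (lam : Measure ℝ) [IsFiniteMeasure lam] (r0 : ℝ) {ε : ℝ} (hε : 0 < ε) :
    ∃ η > 0, (lam (Ioo r0 (r0 + η))).toReal < ε ∧ (lam (Ioo (r0 - η) r0)).toReal < ε := by
  set s : ℕ → Set ℝ := fun k => Ioo (r0 - 1 / ((k:ℝ) + 1)) r0 ∪ Ioo r0 (r0 + 1 / ((k:ℝ) + 1)) with hs
  have hanti : Antitone s := by
    intro i j hij
    have hij : (i:ℝ) ≤ j := by exact_mod_cast hij
    have h1 : 1 / ((j:ℝ) + 1) ≤ 1 / ((i:ℝ) + 1) := one_div_le_one_div_of_le (by positivity) (by linarith)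
    exact union_subset_union (Ioo_subset_Ioo (by linarith) le_rfl) (Ioo_subset_Ioo le_rfl (by linarith))
  have hT := tendsto_measure_iInter_atTop (μ := lam) (s := s)
    (fun k => (measurableSet_Ioo.union measurableSet_Ioo).nullMeasurableSet) hanti ⟨0, measure_ne_top _ _⟩
  have hz : (⋂ k, s k) = ∅ := by
    rw [eq_empty_iff_forall_notMem]
    intro t ht
    rw [mem_iInter] at ht
    have hne : t ≠ r0 := by
      rcases ht 0 with h | h
      · exact h.2.ne
      · exact h.1.ne'
    obtain ⟨k, hk⟩ := exists_nat_one_div_lt (abs_pos.mpr (sub_ne_zero.mpr hne))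
    have : |t - r0| < 1 / ((k:ℝ) + 1) := by
      have hpos : 0 < 1 / ((k:ℝ) + 1) := by positivity
      rw [abs_lt]
      rcases ht k with h | h <;> constructor <;> linarith [h.1, h.2]
    linarith
  rw [hz, measure_empty] at hT
  obtain ⟨k, hk⟩ := (hT.eventually_lt_const (u := ENNReal.ofReal ε) (ENNReal.ofReal_pos.mpr hε)).exists
  refine ⟨1 / ((k:ℝ) + 1), by positivity, ?_, ?_⟩
  · exact (ENNReal.lt_ofReal_iff_toReal_lt (measure_ne_top _ _)).mp ((measure_mono subset_union_right).trans_lt hk)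
  · exact (ENNReal.lt_ofReal_iff_toReal_lt (measure_ne_top _ _)).mp ((measure_mono subset_union_left).trans_lt hk)

lemma ae_dense {A : Set ℝ} (hA : ∀ᵐ r : ℝ, r ∈ A) {a b : ℝ} (hab : a < b) : ∃ r ∈ A, r ∈ Ioo a b := by
  by_contra hc
  push Not at hc
  have : volume (Ioo a b) = 0 := measure_mono_null (fun r hr => fun hrA => hc r hrA hr) hA
  rw [Real.volume_Ioo, ENNReal.ofReal_eq_zero] at this
  linarith

lemma neBot_right {A : Set ℝ} (hA : ∀ᵐ r : ℝ, r ∈ A) (r0 : ℝ) : (𝓝[A ∩ Ioi r0] r0).NeBot := by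
  rw [← mem_closure_iff_nhdsWithin_neBot, Metric.mem_closure_iff]
  intro ε hε
  obtain ⟨r, h1, h2⟩ := ae_dense hA (show r0 < r0 + ε by linarith)
  exact ⟨r, ⟨h1, h2.1⟩, by rw [Real.dist_eq, abs_lt]; constructor <;> linarith [h2.1, h2.2]⟩

lemma neBot_left {A : Set ℝ} (hA : ∀ᵐ r : ℝ, r ∈ A) (r0 : ℝ) : (𝓝[A ∩ Iio r0] r0).NeBot := by
  rw [← mem_closure_iff_nhdsWithin_neBot, Metric.mem_closure_iff]
  intro ε hε
  obtain ⟨r, h1, h2⟩ := ae_dense hA (show r0 - ε < r0 by linarith)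
  exact ⟨r, ⟨h1, h2.2⟩, by rw [Real.dist_eq, abs_lt]; constructor <;> linarith [h2.1, h2.2]⟩

/-- One-sided limits exist. -/
lemma one_sided {lam : Measure ℝ} [IsFiniteMeasure lam] {A : Set ℝ} (hA : ∀ᵐ r : ℝ, r ∈ A) {f : ℝ → ℝ} {C : ℝ≥0}
    {a r0 : ℝ} (ha : a < r0)
    (hK : ∀ r1 r2, a ≤ r1 → r1 < r2 → r1 ∈ A → r2 ∈ A → |f r2 - f r1| ≤ C * (lam (Ioo r1 r2)).toReal) :
    (∃ y, Tendsto f (𝓝[A ∩ Ioi r0] r0) (𝓝 y)) ∧ (∃ y, Tendsto f (𝓝[A ∩ Iio r0] r0) (𝓝 y)) := by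
  have := neBot_right hA r0
  have := neBot_left hA r0
  have hmain : ∀ ε > 0, ∃ η > 0, η < r0 - a ∧ C * (lam (Ioo r0 (r0 + η))).toReal < ε ∧ C * (lam (Ioo (r0 - η) r0)).toReal < ε := by
    intro ε hε
    have hC1 : (0:ℝ) < (C:ℝ) + 1 := by positivity
    obtain ⟨η, hη, h1, h2⟩ := small_tail lam r0 (show 0 < ε / ((C:ℝ) + 1) by positivity)
    rw [lt_div_iff₀ hC1] at h1 h2
    have hm : 0 < min η ((r0 - a) / 2) := lt_min hη (by linarith)
    refine ⟨min η ((r0 - a) / 2), hm, by linarith [min_le_right η ((r0 - a) / 2)], ?_, ?_⟩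
    · have h3 : (lam (Ioo r0 (r0 + min η ((r0 - a) / 2)))).toReal ≤ (lam (Ioo r0 (r0 + η))).toReal :=
        ENNReal.toReal_mono (measure_ne_top _ _) (measure_mono (Ioo_subset_Ioo le_rfl (by linarith [min_le_left η ((r0 - a) / 2)])))
      have h4 : 0 ≤ (lam (Ioo r0 (r0 + η))).toReal := ENNReal.toReal_nonneg
      nlinarith [mul_le_mul_of_nonneg_left h3 C.coe_nonneg]
    · have h3 : (lam (Ioo (r0 - min η ((r0 - a) / 2)) r0)).toReal ≤ (lam (Ioo (r0 - η) r0)).toReal :=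
        ENNReal.toReal_mono (measure_ne_top _ _) (measure_mono (Ioo_subset_Ioo (by linarith [min_le_left η ((r0 - a) / 2)]) le_rfl))
      have h4 : 0 ≤ (lam (Ioo (r0 - η) r0)).toReal := ENNReal.toReal_nonneg
      nlinarith [mul_le_mul_of_nonneg_left h3 C.coe_nonneg]
  have hgen : ∀ (S : Set ℝ) (J : ℝ → Set ℝ), (∀ η > 0, J η ∈ 𝓝[A ∩ S] r0) → (𝓝[A ∩ S] r0).NeBot →
      (∀ ε > 0, ∃ η > 0, ∀ s ∈ J η, ∀ t ∈ J η, s < t → |f t - f s| < ε) →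
      ∃ y, Tendsto f (𝓝[A ∩ S] r0) (𝓝 y) := by
    intro S J hJ hne hJ2
    rw [← cauchy_map_iff_exists_tendsto, Metric.cauchy_iff]
    refine ⟨inferInstance, fun ε hε => ?_⟩
    obtain ⟨η, hη, h⟩ := hJ2 ε hε
    refine ⟨f '' J η, image_mem_map (hJ η hη), ?_⟩
    rintro _ ⟨s, hs, rfl⟩ _ ⟨t, ht, rfl⟩
    rcases lt_trichotomy s t with h1 | h1 | h1
    · rw [dist_comm]; exact h s hs t ht h1
    · rw [h1, dist_self]; exact hε
    · exact h t ht s hs h1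
  constructor
  · refine hgen (Ioi r0) (fun η => (A ∩ Ioi r0) ∩ Iio (r0 + η)) ?_ inferInstance ?_
    · intro η hη
      exact inter_mem self_mem_nhdsWithin (mem_nhdsWithin_of_mem_nhds (Iio_mem_nhds (by linarith)))
    · intro ε hε
      obtain ⟨η, hη, h0, h1, h2⟩ := hmain ε hε
      refine ⟨η, hη, ?_⟩
      rintro s ⟨⟨hsA, hs1⟩, hs2⟩ t ⟨⟨htA, ht1⟩, ht2⟩ hst
      refine (hK s t (ha.le.trans (le_of_lt hs1)) hst hsA htA).trans_lt (lt_of_le_of_lt ?_ h1)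
      refine mul_le_mul_of_nonneg_left ?_ C.coe_nonneg
      exact ENNReal.toReal_mono (measure_ne_top _ _) (measure_mono (Ioo_subset_Ioo (le_of_lt hs1) (le_of_lt ht2)))
  · refine hgen (Iio r0) (fun η => (A ∩ Iio r0) ∩ Ioi (r0 - η) ∩ Ioi a) ?_ inferInstance ?_
    · intro η hη
      exact inter_mem (inter_mem self_mem_nhdsWithin (mem_nhdsWithin_of_mem_nhds (Ioi_mem_nhds (by linarith))))
        (mem_nhdsWithin_of_mem_nhds (Ioi_mem_nhds ha))
    · intro ε hε
      obtain ⟨η, hη, h0, h1, h2⟩ := hmain ε hε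
      refine ⟨η, hη, ?_⟩
      rintro s ⟨⟨⟨hsA, hs1⟩, hs2⟩, hs3⟩ t ⟨⟨⟨htA, ht1⟩, ht2⟩, ht3⟩ hst
      refine (hK s t (le_of_lt hs3) hst hsA htA).trans_lt (lt_of_le_of_lt ?_ h2)
      refine mul_le_mul_of_nonneg_left ?_ C.coe_nonneg
      exact ENNReal.toReal_mono (measure_ne_top _ _) (measure_mono (Ioo_subset_Ioo (le_of_lt hs2) (le_of_lt ht1)))

end


/-! ## Part 11 -/
open MeasureTheory Metric Set Filter
open scoped ENNReal NNReal Topology RealInnerProductSpace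

lemma ev_right {A : Set ℝ} {r0 : ℝ} {P : ℝ → Prop} (h : ∀ᶠ s in 𝓝[A ∩ Ioi r0] r0, P s) :
    ∃ η > 0, ∀ s ∈ A, s ∈ Ioo r0 (r0 + η) → P s := by
  rw [eventually_nhdsWithin_iff, Metric.eventually_nhds_iff] at h
  obtain ⟨η, hη, h⟩ := h
  refine ⟨η, hη, fun s hs hs' => h ?_ ⟨hs, hs'.1⟩⟩
  rw [Real.dist_eq, abs_lt]; constructor <;> linarith [hs'.1, hs'.2]

lemma ev_left {A : Set ℝ} {r0 : ℝ} {P : ℝ → Prop} (h : ∀ᶠ s in 𝓝[A ∩ Iio r0] r0, P s) :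
    ∃ η > 0, ∀ s ∈ A, s ∈ Ioo (r0 - η) r0 → P s := by
  rw [eventually_nhdsWithin_iff, Metric.eventually_nhds_iff] at h
  obtain ⟨η, hη, h⟩ := h
  refine ⟨η, hη, fun s hs hs' => h ?_ ⟨hs, hs'.2⟩⟩
  rw [Real.dist_eq, abs_lt]; constructor <;> linarith [hs'.1, hs'.2]

lemma steep_of_lims {A : Set ℝ} (hA : ∀ᵐ r : ℝ, r ∈ A) {α : ℝ → ℝ} {r0 bp bm t e : ℝ}
    (hp : Tendsto α (𝓝[A ∩ Ioi r0] r0) (𝓝 bp)) (hm : Tendsto α (𝓝[A ∩ Iio r0] r0) (𝓝 bm))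
    (h1 : 0 < e * (bp - t)) (h2 : 0 < e * (t - bm)) :
    ∀ Λ : ℝ, 0 < Λ → ∃ η > 0, ∀ᵐ s : ℝ, (s ∈ Ioo r0 (r0 + η) → Λ * (s - r0) ≤ e * (α s - t)) ∧
      (s ∈ Ioo (r0 - η) r0 → e * (α s - t) ≤ -(Λ * (r0 - s))) := by
  intro Λ hΛ
  have q1 : Tendsto (fun s => e * (α s - t)) (𝓝[A ∩ Ioi r0] r0) (𝓝 (e * (bp - t))) :=
    (hp.sub_const t).const_mul e
  have q2 : Tendsto (fun s => e * (α s - t)) (𝓝[A ∩ Iio r0] r0) (𝓝 (e * (bm - t))) :=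
    (hm.sub_const t).const_mul e
  obtain ⟨η1, hη1, k1⟩ := ev_right (q1.eventually_const_lt (half_lt_self h1))
  obtain ⟨η2, hη2, k2⟩ := ev_left (q2.eventually_lt_const
    (show e * (bm - t) < -(e * (t - bm) / 2) by linarith))
  set η := min (min η1 η2) (min (e * (bp - t) / 2 / Λ) (e * (t - bm) / 2 / Λ)) with hη
  have l1 : η ≤ η1 := (min_le_left _ _).trans (min_le_left _ _)
  have l2 : η ≤ η2 := (min_le_left _ _).trans (min_le_right _ _)
  have l3 : η ≤ e * (bp - t) / 2 / Λ := (min_le_right _ _).trans (min_le_left _ _)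
  have l4 : η ≤ e * (t - bm) / 2 / Λ := (min_le_right _ _).trans (min_le_right _ _)
  rw [le_div_iff₀ hΛ] at l3 l4
  refine ⟨η, lt_min (lt_min hη1 hη2) (lt_min (by positivity) (by positivity)), ?_⟩
  filter_upwards [hA] with s hs
  constructor
  · intro h
    have := k1 s hs ⟨h.1, by linarith [h.2]⟩
    have : (s - r0) * Λ ≤ η * Λ := by have := h.2; gcongr; linarith
    linarith
  · intro h
    have := k2 s hs ⟨by linarith [h.1], h.2⟩
    have : (r0 - s) * Λ ≤ η * Λ := by have := h.1; gcongr; linarith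
    linarith

/-- A spherical arc of radial normals is excluded. -/
lemma no_arc {n : ℕ} (hn : 2 ≤ n) {p : Euc n} (hp : ‖p‖ = 1) {α : ℝ → ℝ} {I : Set ℝ} (hQ : QP n p α I)
    {A : Set ℝ} (hA : ∀ᵐ r : ℝ, r ∈ A) {r0 bp bm : ℝ} (hr0 : 0 < r0) (hI : r0 ∈ I)
    (h1 : Tendsto α (𝓝[A ∩ Ioi r0] r0) (𝓝 bp)) (h2 : Tendsto α (𝓝[A ∩ Iio r0] r0) (𝓝 bm))
    (hbp : bp ∈ Icc 0 Real.pi) (hbm : bm ∈ Icc 0 Real.pi) : bp = bm := by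
  by_contra hne
  have key : ∃ e : ℝ, (e = 1 ∨ e = -1) ∧ ∀ t ∈ Ioo (min bp bm) (max bp bm),
      0 < e * (bp - t) ∧ 0 < e * (t - bm) := by
    rcases lt_or_gt_of_ne hne with h | h
    · refine ⟨-1, Or.inr rfl, fun t ht => ?_⟩
      rw [min_eq_left h.le, max_eq_right h.le] at ht
      constructor <;> linarith [ht.1, ht.2]
    · refine ⟨1, Or.inl rfl, fun t ht => ?_⟩
      rw [min_eq_right h.le, max_eq_left h.le] at ht
      constructor <;> linarith [ht.1, ht.2]
  obtain ⟨e, he, key⟩ := key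
  have hq := hQ {r0} (singleton_subset_iff.mpr hI) (by simp)
  have := proj_null hn hp hr0 (Θ := Ioo (min bp bm) (max bp bm)) (R := fun _ => r0)
    (Ioo_subset_Ioo (le_min hbp.1 hbm.1) (max_le hbp.2 hbm.2)) (fun _ _ => le_rfl) (by
      refine measure_mono_null ?_ hq
      rintro x ⟨hx, hxt, hxr⟩
      refine ⟨hx, hxr, ?_⟩
      obtain ⟨k1, k2⟩ := key _ hxt
      have hr := radial_normal hn hp (α := α) hx he (by
        rw [hxr]; exact steep_of_lims hA h1 h2 k1 k2)
      rcases he with rfl | rfl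
      · right; simpa using hr
      · left; simpa using hr)
  rw [Real.volume_Ioo, ENNReal.ofReal_eq_zero, sub_nonpos] at this
  exact absurd this (not_le.mpr (by simpa using Ne.symm hne))

/-- Limits along the approximately good points exist. -/
lemma lim_exists {n : ℕ} (hn : 2 ≤ n) {p : Euc n} (hp : ‖p‖ = 1) {α : ℝ → ℝ} (hα : Measurable α)
    (hαm : ∀ r, α r ∈ Icc (0:ℝ) Real.pi) (hF : perim (sphSymm n α p) univ < ⊤)
    {I : Set ℝ} (hQ : QP n p α I) {r0 : ℝ} (hr0 : 0 < r0) (hI : r0 ∈ I) :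
    ∃ y, Tendsto (fun r => Gf p (α r)) (𝓝[{r | ApGood α r}] r0) (𝓝 y) := by
  set A := {r | ApGood α r} with hAdef
  have hA : ∀ᵐ r : ℝ, r ∈ A := apGood_ae hα
  have := lam0_finite hF
  obtain ⟨C, hC⟩ := K_est hn hp hα hαm hF (a := r0 / 2) (by linarith)
  obtain ⟨⟨yp, hyp⟩, ⟨ym, hym⟩⟩ := one_sided (lam := lam0 (sphSymm n α p)) hA (f := fun r => Gf p (α r)) (C := C)
    (a := r0 / 2) (r0 := r0) (by linarith) (fun r1 r2 h1 h2 h3 h4 => hC r1 r2 h1 h2 h3 h4)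
  have nb1 := neBot_right hA r0
  have nb2 := neBot_left hA r0
  obtain ⟨H, Hc, H1, H2⟩ := exists_Ginv hn hp
  have hGr : ∀ r, Gf p (α r) ∈ Icc 0 (Gf p Real.pi) := fun r =>
    ⟨ENNReal.toReal_nonneg, Gf_mono hn hp (hαm r).2⟩
  have m1 : yp ∈ Icc 0 (Gf p Real.pi) := isClosed_Icc.mem_of_tendsto hyp (Eventually.of_forall hGr)
  have m2 : ym ∈ Icc 0 (Gf p Real.pi) := isClosed_Icc.mem_of_tendsto hym (Eventually.of_forall hGr)
  have t1 : Tendsto α (𝓝[A ∩ Ioi r0] r0) (𝓝 (H yp)) :=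
    ((Hc.tendsto yp).comp hyp).congr fun r => H1 _ (hαm r)
  have t2 : Tendsto α (𝓝[A ∩ Iio r0] r0) (𝓝 (H ym)) :=
    ((Hc.tendsto ym).comp hym).congr fun r => H1 _ (hαm r)
  have heq := no_arc hn hp hQ hA hr0 hI t1 t2 (H2 _ m1).1 (H2 _ m2).1
  have heq' : yp = ym := by rw [← (H2 _ m1).2, ← (H2 _ m2).2, heq]
  subst heq'
  refine ⟨yp, ?_⟩
  have hun : A = (A ∩ Ioi r0) ∪ (A ∩ Iio r0) ∪ (A ∩ {r0}) := by
    ext r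
    simp only [mem_union, mem_inter_iff, mem_Ioi, mem_Iio, mem_singleton_iff]
    constructor
    · intro hr
      rcases lt_trichotomy r r0 with h | h | h
      · exact Or.inl (Or.inr ⟨hr, h⟩)
      · exact Or.inr ⟨hr, h⟩
      · exact Or.inl (Or.inl ⟨hr, h⟩)
    · rintro ((h | h) | h) <;> exact h.1
  rw [hun, nhdsWithin_union, nhdsWithin_union]
  refine Tendsto.sup (Tendsto.sup hyp hym) ?_
  by_cases hr : r0 ∈ A
  swap
  · have : A ∩ {r0} = ∅ := by
      ext r; simp only [mem_inter_iff, mem_singleton_iff, mem_empty_iff_false, iff_false]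
      rintro ⟨h, rfl⟩; exact hr h
    rw [this]; simp
  have : A ∩ {r0} = {r0} := by
    ext r; simp only [mem_inter_iff, mem_singleton_iff]
    constructor
    · exact fun h => h.2
    · rintro rfl; exact ⟨hr, rfl⟩
  rw [this, nhdsWithin_singleton]
  suffices h : Gf p (α r0) = yp by
    rw [← h]; exact tendsto_pure_nhds _ _
  have hlim : Tendsto (fun r => |Gf p (α r) - Gf p (α r0)|) (𝓝[A ∩ Ioi r0] r0) (𝓝 |yp - Gf p (α r0)|) :=
    (hyp.sub_const _).abs
  have hle : |yp - Gf p (α r0)| ≤ 0 := by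
    refine le_of_forall_pos_le_add fun ε hε => ?_
    obtain ⟨η, hη, hη1, -⟩ := small_tail (lam0 (sphSymm n α p)) r0
      (show 0 < ε / ((C:ℝ) + 1) by positivity)
    refine le_of_tendsto hlim ?_
    rw [eventually_nhdsWithin_iff, Metric.eventually_nhds_iff]
    refine ⟨η, hη, fun s hs hs2 => ?_⟩
    rw [Real.dist_eq, abs_lt] at hs
    have hs3 : r0 < s := hs2.2
    have k := hC r0 s (by linarith) hs3 hr hs2.1
    have k2 : (lam0 (sphSymm n α p) (Ioo r0 s)).toReal ≤ (lam0 (sphSymm n α p) (Ioo r0 (r0 + η))).toReal :=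
      ENNReal.toReal_mono (measure_ne_top _ _) (measure_mono (Ioo_subset_Ioo le_rfl (by linarith)))
    rw [lt_div_iff₀ (by positivity)] at hη1
    have k3 : (0:ℝ) ≤ (lam0 (sphSymm n α p) (Ioo r0 (r0 + η))).toReal := ENNReal.toReal_nonneg
    have : (C:ℝ) * (lam0 (sphSymm n α p) (Ioo r0 s)).toReal ≤ C * (lam0 (sphSymm n α p) (Ioo r0 (r0 + η))).toReal := by gcongr
    linarith
  have := abs_nonpos_iff.mp hle
  linarith


/-! ## Part 12 -/
open MeasureTheory Metric Set Filter
open scoped ENNReal NNReal Topology RealInnerProductSpace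

lemma closure_ae {A : Set ℝ} (hA : ∀ᵐ r : ℝ, r ∈ A) (r : ℝ) : r ∈ closure A := by
  have := neBot_right hA r
  exact mem_closure_iff_nhdsWithin_neBot.mpr (NeBot.mono this (nhdsWithin_mono _ inter_subset_left))

/-- The continuous representative. -/
lemma exists_rep {n : ℕ} (hn : 2 ≤ n) {p : Euc n} (hp : ‖p‖ = 1) {α : ℝ → ℝ} (hα : Measurable α)
    (hαm : ∀ r, α r ∈ Icc (0:ℝ) Real.pi) (hF : perim (sphSymm n α p) univ < ⊤)
    {I : Set ℝ} (hI : IsOpen I) (hI0 : I ⊆ Ioi 0) (hQ : QP n p α I) :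
    ∃ w β : ℝ → ℝ, (∀ r ∈ I, ContinuousAt w r) ∧ (∀ r ∈ I, ContinuousAt β r) ∧
      (∀ r ∈ I, β r ∈ Icc 0 Real.pi ∧ Gf p (β r) = w r) ∧
      (∀ r ∈ I, Tendsto (fun r => Gf p (α r)) (𝓝[{r | ApGood α r}] r) (𝓝 (w r))) ∧
      (∀ r ∈ I, ApGood α r → w r = Gf p (α r)) ∧ (∀ r ∈ I, ApGood α r → β r = α r) := by
  set A := {r | ApGood α r} with hAdef
  have hA : ∀ᵐ r : ℝ, r ∈ A := apGood_ae hα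
  have hcl : I ⊆ closure A := fun r _ => closure_ae hA r
  have hnb : ∀ r, (𝓝[A] r).NeBot := fun r => mem_closure_iff_nhdsWithin_neBot.mp (closure_ae hA r)
  have hlim := fun r (hr : r ∈ I) => lim_exists hn hp hα hαm hF hQ (hI0 hr) hr
  set ξ : ℝ → ℝ := fun r => Gf p (α r) with hξ
  obtain ⟨H, Hc, H1, H2⟩ := exists_Ginv hn hp
  have hGr : ∀ r, ξ r ∈ Icc 0 (Gf p Real.pi) := fun r =>
    ⟨ENNReal.toReal_nonneg, Gf_mono hn hp (hαm r).2⟩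
  set w := extendFrom A ξ with hw
  have hwc : ∀ r ∈ I, ContinuousAt w r := fun r hr =>
    (continuousOn_extendFrom hcl hlim).continuousAt (hI.mem_nhds hr)
  have hwt : ∀ r ∈ I, Tendsto ξ (𝓝[A] r) (𝓝 (w r)) := fun r hr => tendsto_extendFrom (hlim r hr)
  have hwm : ∀ r ∈ I, w r ∈ Icc 0 (Gf p Real.pi) := fun r hr => by
    have := hnb r
    exact isClosed_Icc.mem_of_tendsto (hwt r hr) (Eventually.of_forall hGr)
  have hwA : ∀ r ∈ I, ApGood α r → w r = ξ r := fun r hr hg => by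
    have h1 := (hwt r hr).mono_left (pure_le_nhdsWithin (show r ∈ A from hg))
    exact tendsto_nhds_unique h1 (tendsto_pure_nhds ξ r)
  refine ⟨w, fun r => H (w r), hwc, fun r hr => Hc.continuousAt.comp (hwc r hr), fun r hr => H2 _ (hwm r hr), hwt, hwA, ?_⟩
  intro r hr hg
  change H (w r) = α r
  rw [hwA r hr hg]
  exact H1 _ (hαm r)

lemma lam0_atom {n : ℕ} (hn : 2 ≤ n) {p : Euc n} (hp : ‖p‖ = 1) {α β : ℝ → ℝ} (hα : Measurable α)
    {I : Set ℝ} (hI : IsOpen I) (hae : ∀ᵐ s ∂(volume.restrict I), β s = α s)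
    {r : ℝ} (hr0 : 0 < r) (hrI : r ∈ I) (hβ : ContinuousAt β r) : lam0 (sphSymm n α p) {r} = 0 := by
  rw [lam0_apply _ (measurableSet_singleton r)]
  have h1 := circle_null hn hp (T := {β r}) (by simp)
  have hd := dim_pos hn
  have h2 : μH[(n:ℝ) - 1] ((fun x : Euc n => r • x) '' {x : Euc n | ‖x‖ = 1 ∧ ang p x ∈ ({β r} : Set ℝ)}) = 0 := by
    have := Measure.hausdorffMeasure_smul₀ (d := (n:ℝ) - 1) (by linarith) hr0.ne' {x : Euc n | ‖x‖ = 1 ∧ ang p x ∈ ({β r} : Set ℝ)}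
    rw [← image_smul] at this
    rw [this, h1, smul_zero]
  refine measure_mono_null ?_ h2
  rintro x ⟨hx, hxr⟩
  have hxr : ‖x‖ = r := hxr
  have hx0 : x ≠ 0 := norm_pos_iff.mp (by rw [hxr]; exact hr0)
  refine ⟨hatv x, ⟨norm_hatv hx0, ?_⟩, ?_⟩
  · rw [mem_singleton_iff, ang_hatv p hx0, ← hxr]
    rw [← hxr] at hβ hrI
    exact D2 hn hα hI hae hx0 hrI hβ hx
  · change r • hatv x = x
    rw [← hxr]; exact smul_hatv x

lemma w_est {n : ℕ} (hn : 2 ≤ n) {p : Euc n} (hp : ‖p‖ = 1) {α : ℝ → ℝ} (hα : Measurable α)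
    (hαm : ∀ r, α r ∈ Icc (0:ℝ) Real.pi) (hF : perim (sphSymm n α p) univ < ⊤)
    {I : Set ℝ} {w : ℝ → ℝ} (hw : ∀ r ∈ I, Tendsto (fun r => Gf p (α r)) (𝓝[{r | ApGood α r}] r) (𝓝 (w r)))
    {a b : ℝ} (ha : 0 < a) (hab : Icc a b ⊆ I) :
    ∃ C : ℝ≥0, ∀ x y, a ≤ x → x ≤ y → y ≤ b →
      |w y - w x| ≤ C * (lam0 (sphSymm n α p) (Icc x y)).toReal := by
  set A := {r | ApGood α r} with hAdef
  have hA : ∀ᵐ r : ℝ, r ∈ A := apGood_ae hα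
  have := lam0_finite hF
  obtain ⟨C, hC⟩ := K_est hn hp hα hαm hF ha
  refine ⟨C, fun x y hx hxy hy => ?_⟩
  rcases hxy.eq_or_lt with rfl | hxy
  · simp; positivity
  have nb1 := neBot_right hA x
  have nb2 := neBot_left hA y
  have t1 := (hw x (hab ⟨hx, by linarith⟩)).mono_left (nhdsWithin_mono x (inter_subset_left : A ∩ Ioi x ⊆ A))
  have t2 := (hw y (hab ⟨by linarith, hy⟩)).mono_left (nhdsWithin_mono y (inter_subset_left : A ∩ Iio y ⊆ A))
  have tt := ((t2.comp tendsto_snd).sub (t1.comp tendsto_fst)).abs (f := fun q : ℝ × ℝ => _)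
  refine le_of_tendsto (x := (𝓝[A ∩ Ioi x] x) ×ˢ (𝓝[A ∩ Iio y] y)) tt ?_
  have e1 : ∀ᶠ s in 𝓝[A ∩ Ioi x] x, s ∈ A ∧ x < s ∧ s < (x + y) / 2 := by
    have : ∀ᶠ s in 𝓝[A ∩ Ioi x] x, s < (x + y) / 2 :=
      nhdsWithin_le_nhds (Iio_mem_nhds (by linarith))
    filter_upwards [this, self_mem_nhdsWithin] with s h1 h2 using ⟨h2.1, h2.2, h1⟩
  have e2 : ∀ᶠ s in 𝓝[A ∩ Iio y] y, s ∈ A ∧ s < y ∧ (x + y) / 2 < s := by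
    have : ∀ᶠ s in 𝓝[A ∩ Iio y] y, (x + y) / 2 < s :=
      nhdsWithin_le_nhds (Ioi_mem_nhds (by linarith))
    filter_upwards [this, self_mem_nhdsWithin] with s h1 h2 using ⟨h2.1, h2.2, h1⟩
  filter_upwards [e1.prod_mk e2] with q ⟨⟨h1, h2, h3⟩, ⟨h4, h5, h6⟩⟩
  have k := hC q.1 q.2 (by linarith) (by linarith) h1 h4
  refine k.trans ?_
  gcongr
  · exact measure_ne_top _ _
  · exact fun s hs => ⟨by linarith [hs.1], by linarith [hs.2]⟩


/-! ## Part 13 -/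
open MeasureTheory Metric Set Filter
open scoped ENNReal NNReal Topology RealInnerProductSpace

lemma Gsteep {G : ℝ → ℝ} (hG : Monotone G) {C : ℝ≥0} (hL : LipschitzWith C G) {e x y u : ℝ}
    (he : e = 1 ∨ e = -1) (hu : 0 < u) (h : u * ((C:ℝ) + 1) ≤ e * (G x - G y)) : u ≤ e * (x - y) := by
  have hd := hL.dist_le_mul x y
  rw [Real.dist_eq, Real.dist_eq] at hd
  have hC : (0:ℝ) ≤ C := C.2
  have hpos : 0 < u * ((C:ℝ) + 1) := by positivity
  rcases he with rfl | rfl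
  · have hxy : y ≤ x := by
      by_contra hc
      have := hG (not_le.mp hc).le
      linarith
    rw [abs_of_nonneg (by linarith), abs_of_nonneg (by linarith)] at hd
    nlinarith
  · have hxy : x ≤ y := by
      by_contra hc
      have := hG (not_le.mp hc).le
      linarith
    rw [abs_of_nonpos (by linarith), abs_of_nonpos (by linarith)] at hd
    nlinarith

lemma steep_of_inf {G w α β : ℝ → ℝ} (hG : Monotone G) {C : ℝ≥0} (hL : LipschitzWith C G)
    {I : Set ℝ} (hI : IsOpen I) (hae : ∀ᵐ s ∂(volume.restrict I), β s = α s) (hwβ : ∀ r ∈ I, G (β r) = w r)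
    {r : ℝ} (hr : r ∈ I) (h : InfSlope w r) :
    ∃ e : ℝ, (e = 1 ∨ e = -1) ∧ ∀ Λ : ℝ, 0 < Λ → ∃ η > 0, ∀ᵐ s : ℝ,
      (s ∈ Ioo r (r + η) → Λ * (s - r) ≤ e * (α s - β r)) ∧
      (s ∈ Ioo (r - η) r → e * (α s - β r) ≤ -(Λ * (r - s))) := by
  obtain ⟨e, he, ht⟩ := h
  refine ⟨e, he, fun Λ hΛ => ?_⟩
  have h1 := ht.eventually_ge_atTop (Λ * ((C:ℝ) + 1))
  have h2 : ∀ᶠ s in 𝓝[≠] r, s ∈ I := nhdsWithin_le_nhds (hI.mem_nhds hr)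
  have h3 := h1.and h2
  rw [eventually_nhdsWithin_iff, Metric.eventually_nhds_iff] at h3
  obtain ⟨η, hη, h3⟩ := h3
  refine ⟨η, hη, ?_⟩
  rw [ae_restrict_iff' hI.measurableSet] at hae
  filter_upwards [hae] with s hs
  constructor
  · intro hm
    obtain ⟨k1, k2⟩ := h3 (y := s) (by rw [Real.dist_eq, abs_lt]; constructor <;> linarith [hm.1, hm.2]) (ne_of_gt hm.1)
    rw [← hs k2]
    rw [slope_def_field, ← hwβ s k2, ← hwβ r hr, mul_div_assoc', le_div_iff₀ (by linarith [hm.1])] at k1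
    have := hm.1
    refine Gsteep hG hL he (by apply mul_pos hΛ; linarith) ?_
    linarith
  · intro hm
    obtain ⟨k1, k2⟩ := h3 (y := s) (by rw [Real.dist_eq, abs_lt]; constructor <;> linarith [hm.1, hm.2]) (ne_of_lt hm.2)
    rw [← hs k2]
    rw [slope_def_field, ← hwβ s k2, ← hwβ r hr, mul_div_assoc', le_div_iff_of_neg (by linarith [hm.2])] at k1
    have := hm.2
    have := Gsteep hG hL (e := e) (x := β r) (y := β s) (u := Λ * (r - s)) he (by apply mul_pos hΛ; linarith) (by linarith)
    linarith

lemma HN_lemma {n : ℕ} (hn : 2 ≤ n) {p : Euc n} (hp : ‖p‖ = 1) {α β w : ℝ → ℝ} 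
    {I : Set ℝ} (hI : IsOpen I) (hQ : QP n p α I) (hae : ∀ᵐ s ∂(volume.restrict I), β s = α s)
    (hβ : ∀ r ∈ I, β r ∈ Icc 0 Real.pi ∧ Gf p (β r) = w r)
    {a : ℝ} (ha : 0 < a) {D : Set ℝ} (hDI : D ⊆ I) (hDa : ∀ r ∈ D, a ≤ r) (hD0 : volume D = 0)
    (hDs : ∀ r ∈ D, InfSlope w r) : volume (w '' D) = 0 := by
  obtain ⟨C, hL⟩ := Gf_lip hn hp
  set Θ := β '' D ∩ Ioo 0 Real.pi with hΘ
  have hch : ∀ t : ℝ, ∃ r, t ∈ Θ → r ∈ D ∧ β r = t := by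
    intro t
    by_cases ht : t ∈ Θ
    · obtain ⟨⟨r, hr, hrt⟩, -⟩ := ht
      exact ⟨r, fun _ => ⟨hr, hrt⟩⟩
    · exact ⟨0, fun h => absurd h ht⟩
  choose R hR using hch
  have hv : volume Θ = 0 := by
    have hq := hQ D hDI hD0
    refine proj_null hn hp ha (R := R) inter_subset_right (fun t ht => hDa _ (hR t ht).1) ?_
    refine measure_mono_null ?_ hq
    rintro x ⟨hx, hxt, hxr⟩
    obtain ⟨q1, q2⟩ := hR _ hxt
    rw [← hxr] at q1 q2
    refine ⟨hx, q1, ?_⟩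
    obtain ⟨e, he, hst⟩ := steep_of_inf (Gf_mono hn hp) hL hI hae (fun r hr => (hβ r hr).2) (hDI q1) (hDs _ q1)
    rw [q2] at hst
    have hr := radial_normal hn hp (α := α) hx he hst
    rcases he with rfl | rfl
    · right; simpa using hr
    · left; simpa using hr
  have hsub : w '' D ⊆ (Gf p) '' Θ ∪ {Gf p 0, Gf p Real.pi} := by
    rintro _ ⟨r, hr, rfl⟩
    obtain ⟨k1, k2⟩ := hβ r (hDI hr)
    rw [← k2]
    rcases k1.1.eq_or_lt with h | h
    · right; left; rw [← h]
    rcases k1.2.eq_or_lt with h' | h'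
    · right; right; rw [h']; rfl
    · left; exact ⟨β r, ⟨⟨r, hr, rfl⟩, h, h'⟩, rfl⟩
  refine measure_mono_null hsub (measure_union_null ?_ ((Set.toFinite _).measure_zero _))
  have := hL.hausdorffMeasure_image_le (d := 1) zero_le_one Θ
  rw [hausdorffMeasure_real, hv, mul_zero] at this
  exact nonpos_iff_eq_zero.mp this

theorem QP_W11 {n : ℕ} (hn : 2 ≤ n) {p : Euc n} (hp : ‖p‖ = 1) {α : ℝ → ℝ} (hα : Measurable α)
    (hαm : ∀ r, α r ∈ Icc (0:ℝ) Real.pi) (hF : perim (sphSymm n α p) univ < ⊤)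
    {I : Set ℝ} (hI : IsOpen I) (hI0 : I ⊆ Ioi 0) (hQ : QP n p α I) :
    W11locOn (fun r => Gf p (α r)) I := by
  obtain ⟨w, β, hwc, hβc, hβ, hwt, hwA, hβA⟩ := exists_rep hn hp hα hαm hF hI hI0 hQ
  have hA : ∀ᵐ r : ℝ, ApGood α r := apGood_ae hα
  have hae : ∀ᵐ s ∂(volume.restrict I), β s = α s := by
    rw [ae_restrict_iff' hI.measurableSet]
    filter_upwards [hA] with s hs hsI using hβA s hsI hs
  have haw : ∀ᵐ s ∂(volume.restrict I), w s = Gf p (α s) := by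
    rw [ae_restrict_iff' hI.measurableSet]
    filter_upwards [hA] with s hs hsI using hwA s hsI hs
  have hloc : ∀ a b, a < b → Icc a b ⊆ I → ∃ g, IntegrableOn g (Ioc a b) ∧
      ∀ x y, a ≤ x → x ≤ y → y ≤ b → w y - w x = ∫ t in x..y, g t := by
    intro a b hab hsub
    have ha : 0 < a := hI0 (hsub ⟨le_rfl, hab.le⟩)
    obtain ⟨C, hC⟩ := w_est hn hp hα hαm hF hwt ha hsub
    have := lam0_finite hF
    refine ac_local hab (C • lam0 (sphSymm n α p)) ?_ w ?_ ?_
    · intro r hr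
      rw [Measure.smul_apply, lam0_atom hn hp hα hI hae (hI0 (hsub hr)) (hsub hr) (hβc r (hsub hr)), smul_zero]
    · intro x y h1 h2 h3
      refine (hC x y h1 h2 h3).trans (le_of_eq ?_)
      rw [Measure.smul_apply, ENNReal.smul_def, smul_eq_mul, ENNReal.toReal_mul, ENNReal.coe_toReal]
    · intro D hD hD0 hDs
      exact HN_lemma hn hp hI hQ hae hβ ha (fun r hr => hsub (Ioo_subset_Icc_self (hD hr)))
        (fun r hr => (hD hr).1.le) hD0 hDs
  obtain ⟨h1, h2⟩ := glue hI hloc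
  exact ⟨w, deriv w, haw, h1, h2⟩


/-! ## Part 14 -/
open MeasureTheory Metric Set Filter
open scoped ENNReal NNReal Topology RealInnerProductSpace

/-- Property (N) for primitives. -/
lemma luzin {f h : ℝ → ℝ} (hf : ∀ a b, IntervalIntegrable f volume a b) (hf1 : ∀ x, 1 ≤ f x)
    (hh : ∀ x y, h y - h x = ∫ t in x..y, f t) :
    StrictMono h ∧ ∀ N : Set ℝ, volume N = 0 → volume (h '' N) = 0 := by
  have hsm : StrictMono h := by
    intro x y hxy
    have h1 : ∫ t in x..y, (1:ℝ) ≤ ∫ t in x..y, f t :=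
      intervalIntegral.integral_mono_on hxy.le (by simp) (hf x y) (fun t _ => hf1 t)
    rw [← hh] at h1
    simp at h1
    linarith
  refine ⟨hsm, fun N hN => ?_⟩
  have hc : Continuous h := by
    have := intervalIntegral.continuous_primitive hf 0
    have h2 : h = fun y => h 0 + ∫ t in (0:ℝ)..y, f t := by
      funext y; rw [← hh 0 y]; ring
    rw [h2]; exact continuous_const.add this
  have he := hc.measurableEmbedding hsm.injective
  have himg : ∀ a b, a < b → (volume.comap h) (Ioc a b) = ENNReal.ofReal (h b - h a) := by
    intro a b hab
    rw [he.comap_apply]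
    have : h '' Ioc a b = Ioc (h a) (h b) := by
      apply Subset.antisymm
      · rintro _ ⟨x, hx, rfl⟩
        exact ⟨hsm hx.1, hsm.monotone hx.2⟩
      · exact intermediate_value_Ioc hab.le hc.continuousOn
    rw [this, Real.volume_Ioc]
  have heq : volume.comap h = volume.withDensity (fun t => ENNReal.ofReal (f t)) := by
    refine Measure.ext_of_Ioc' _ _ ?_ ?_
    · intro a b hab
      rw [himg a b hab]; exact ENNReal.ofReal_ne_top
    · intro a b hab
      rw [himg a b hab, withDensity_apply _ measurableSet_Ioc, hh, intervalIntegral.integral_of_le hab.le]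
      refine ofReal_integral_eq_lintegral_ofReal ?_ ?_
      · exact (intervalIntegrable_iff_integrableOn_Ioc_of_le hab.le).mp (hf a b)
      · exact Eventually.of_forall fun t => by have := hf1 t; simp only [Pi.zero_apply]; linarith
  rw [← he.comap_apply, heq]
  exact withDensity_absolutelyContinuous _ _ hN

lemma Gf_lower_abs {n : ℕ} (hn : 2 ≤ n) {p : Euc n} (hp : ‖p‖ = 1) {ε : ℝ} (hε : 0 < ε) :
    ∃ c : ℝ, 0 < c ∧ ∀ a ∈ Icc ε (Real.pi - ε), ∀ b ∈ Icc ε (Real.pi - ε), c * |b - a| ≤ |Gf p b - Gf p a| := by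
  obtain ⟨c, hc, h⟩ := Gf_lower hn hp hε
  refine ⟨c, hc, fun a ha b hb => ?_⟩
  rcases le_total a b with hab | hab
  · rw [abs_of_nonneg (sub_nonneg.mpr hab)]
    exact (h a b ha.1 hab hb.2).trans (le_abs_self _)
  · rw [abs_sub_comm, abs_of_nonneg (sub_nonneg.mpr hab), abs_sub_comm]
    exact (h b a hb.1 hab ha.2).trans (le_abs_self _)

lemma nbhd_Icc {I : Set ℝ} (hI : IsOpen I) {r : ℝ} (hr : r ∈ I) :
    ∃ a b : ℚ, r ∈ Ioo (a:ℝ) b ∧ Icc (a:ℝ) b ⊆ I := by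
  obtain ⟨ε, hε, h⟩ := Metric.isOpen_iff.mp hI r hr
  obtain ⟨a, ha1, ha2⟩ := exists_rat_btwn (show r - ε < r by linarith)
  obtain ⟨b, hb1, hb2⟩ := exists_rat_btwn (show r < r + ε by linarith)
  refine ⟨a, b, ⟨ha2, hb1⟩, fun s hs => h ?_⟩
  rw [mem_ball, Real.dist_eq, abs_lt]
  constructor <;> linarith [hs.1, hs.2]

/-- The continuous representative of the angle. -/
lemma rep_of_W11 {n : ℕ} (hn : 2 ≤ n) {p : Euc n} (hp : ‖p‖ = 1) {α : ℝ → ℝ}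
    (hαm : ∀ r, α r ∈ Icc (0:ℝ) Real.pi) {I : Set ℝ} (hI : IsOpen I)
    (hW : W11locOn (fun r => Gf p (α r)) I) :
    ∃ w g β : ℝ → ℝ, (∀ r ∈ I, ContinuousAt β r) ∧
      (∀ r ∈ I, β r ∈ Icc 0 Real.pi ∧ Gf p (β r) = w r) ∧ (∀ᵐ s ∂(volume.restrict I), β s = α s) ∧
      (∀ a b, a ≤ b → Icc a b ⊆ I → IntegrableOn g (Icc a b)) ∧
      (∀ a b, uIcc a b ⊆ I → w b - w a = ∫ t in a..b, g t) := by
  obtain ⟨w, g, hae, hg, hw⟩ := hW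
  obtain ⟨H, Hc, H1, H2⟩ := exists_Ginv hn hp
  have hgi : ∀ a b, a ≤ b → Icc a b ⊆ I → IntegrableOn g (Icc a b) := fun a b _ h =>
    hg.integrableOn_compact_subset h isCompact_Icc
  have hwc : ∀ r ∈ I, ContinuousAt w r := by
    intro r hr
    obtain ⟨a, b, hab, hsub⟩ := nbhd_Icc hI hr
    have hle : (a:ℝ) ≤ b := by linarith [hab.1, hab.2]
    have h1 := intervalIntegral.continuousOn_primitive_interval (μ := volume) (f := g) (a := (a:ℝ)) (b := b)
      (by rw [uIcc_of_le hle]; exact hgi _ _ hle hsub)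
    rw [uIcc_of_le hle] at h1
    have h2 : ContinuousOn w (Icc (a:ℝ) b) := by
      refine (continuousOn_const.add h1 (f := fun _ => w a)).congr fun x hx => ?_
      have := hw a x (by rw [uIcc_of_le hx.1]; exact (Icc_subset_Icc le_rfl hx.2).trans hsub)
      change w x = w a + ∫ (t : ℝ) in (a:ℝ)..x, g t
      rw [← this]; ring
    exact h2.continuousAt (Icc_mem_nhds hab.1 hab.2)
  rw [ae_restrict_iff' hI.measurableSet] at hae
  have hwm : ∀ r ∈ I, w r ∈ Icc 0 (Gf p Real.pi) := by
    intro r hr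
    have hnb : (𝓝[{x | x ∈ I → w x = Gf p (α x)}] r).NeBot :=
      mem_closure_iff_nhdsWithin_neBot.mp (closure_ae hae r)
    have ht : Tendsto w (𝓝[{x | x ∈ I → w x = Gf p (α x)}] r) (𝓝 (w r)) := Tendsto.mono_left (hwc r hr) nhdsWithin_le_nhds
    refine isClosed_Icc.mem_of_tendsto ht ?_
    filter_upwards [self_mem_nhdsWithin, nhdsWithin_le_nhds (hI.mem_nhds hr)] with s h1 h2
    rw [h1 h2]
    exact ⟨ENNReal.toReal_nonneg, Gf_mono hn hp (hαm s).2⟩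
  refine ⟨w, g, fun r => H (w r), fun r hr => Hc.continuousAt.comp (hwc r hr), fun r hr => H2 _ (hwm r hr), ?_, hgi, hw⟩
  rw [ae_restrict_iff' hI.measurableSet]
  filter_upwards [hae] with s hs hsI
  rw [hs hsI]; exact H1 _ (hαm s)

lemma piece_null {n : ℕ} (hn : 2 ≤ n) {p : Euc n} (hp : ‖p‖ = 1) {I : Set ℝ} {w g β : ℝ → ℝ}
    (hβ : ∀ r ∈ I, β r ∈ Icc 0 Real.pi ∧ Gf p (β r) = w r)
    (hg : ∀ a b, a ≤ b → Icc a b ⊆ I → IntegrableOn g (Icc a b))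
    (hw : ∀ a b, uIcc a b ⊆ I → w b - w a = ∫ t in a..b, g t)
    {a b : ℝ} (ha : 0 < a) (hab : a ≤ b) (hsub : Icc a b ⊆ I) {B : Set ℝ} (hBab : B ⊆ Icc a b)
    (hB : volume B = 0) : μH[(n:ℝ) - 1] {x : Euc n | x ≠ 0 ∧ ‖x‖ ∈ B ∧ ang p x = β ‖x‖} = 0 := by
  classical
  set f : ℝ → ℝ := fun t => 1 + (Icc a b).indicator (fun t => |g t|) t with hf
  have hgI := hg a b hab hsub
  have hi : Integrable ((Icc a b).indicator (fun t => |g t|)) :=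
    (integrable_indicator_iff measurableSet_Icc).mpr hgI.abs
  have hfi : ∀ x y, IntervalIntegrable f volume x y := fun x y =>
    (intervalIntegrable_const).add hi.intervalIntegrable
  have hf1 : ∀ x, 1 ≤ f x := fun x => by
    have : 0 ≤ (Icc a b).indicator (fun t => |g t|) x := indicator_nonneg (fun t _ => abs_nonneg _) x
    simp only [hf]; linarith
  set h : ℝ → ℝ := fun y => ∫ t in (0:ℝ)..y, f t with hh
  have hdiff : ∀ x y, h y - h x = ∫ t in x..y, f t := fun x y =>
    intervalIntegral.integral_interval_sub_left (hfi _ _) (hfi _ _)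
  obtain ⟨hsm, hN⟩ := luzin hfi hf1 hdiff
  have e1 : ∀ x y, x ≤ y → y - x ≤ h y - h x := by
    intro x y hxy
    have h1 : ∫ t in x..y, (1:ℝ) ≤ ∫ t in x..y, f t :=
      intervalIntegral.integral_mono_on hxy (by simp) (hfi x y) (fun t _ => hf1 t)
    rw [← hdiff] at h1
    simpa using h1
  have e2 : ∀ x ∈ Icc a b, ∀ y ∈ Icc a b, x ≤ y → |w y - w x| ≤ h y - h x := by
    intro x hx y hy hxy
    have hs : Icc x y ⊆ Icc a b := Icc_subset_Icc hx.1 hy.2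
    rw [hw x y (by rw [uIcc_of_le hxy]; exact hs.trans hsub), hdiff]
    refine (intervalIntegral.abs_integral_le_integral_abs hxy).trans ?_
    refine intervalIntegral.integral_mono_on hxy ?_ (hfi x y) ?_
    · rw [intervalIntegrable_iff_integrableOn_Icc_of_le hxy]
      exact (hgI.mono_set hs).abs
    · intro t ht
      simp only [hf]
      rw [indicator_of_mem (hs ht)]
      linarith
  have E1 : ∀ x y, |y - x| ≤ |h y - h x| := by
    intro x y
    rcases le_total x y with hxy | hxy
    · rw [abs_of_nonneg (by linarith : 0 ≤ y - x)]; exact (e1 x y hxy).trans (le_abs_self _)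
    · rw [abs_sub_comm y, abs_sub_comm (h y), abs_of_nonneg (by linarith : 0 ≤ x - y)]; exact (e1 y x hxy).trans (le_abs_self _)
  have E2 : ∀ x ∈ Icc a b, ∀ y ∈ Icc a b, |w y - w x| ≤ |h y - h x| := by
    intro x hx y hy
    rcases le_total x y with hxy | hxy
    · exact (e2 x hx y hy hxy).trans (le_abs_self _)
    · rw [abs_sub_comm (w y), abs_sub_comm (h y)]; exact (e2 y hy x hx hxy).trans (le_abs_self _)
  set ψ := Function.invFun h with hψ
  have hψh : ∀ r, ψ (h r) = r := Function.leftInverse_invFun hsm.injective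
  set S : ℕ → Set ℝ := fun k => B ∩ {r | β r ∈ Icc (1 / ((k:ℝ) + 1)) (Real.pi - 1 / ((k:ℝ) + 1))} with hS
  have hk : ∀ k : ℕ, μH[(n:ℝ) - 1] (rotGraph p (h '' S k) ψ (β ∘ ψ)) = 0 := by
    intro k
    obtain ⟨c, hc, hlow⟩ := Gf_lower_abs hn hp (ε := 1 / ((k:ℝ) + 1)) (by positivity)
    obtain ⟨C, hC⟩ := rotGraph_upper hn hp (max 1 (1 / c).toNNReal) b (by linarith)
    have key := hC (h '' S k) ψ (β ∘ ψ) ?_ ?_ ?_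
    · have hz : volume (h '' S k) = 0 := hN _ (measure_mono_null inter_subset_left hB)
      rw [hz, mul_zero] at key
      exact nonpos_iff_eq_zero.mp key
    · rintro _ ⟨r, hr, rfl⟩
      rw [hψh]
      have := hBab hr.1
      rw [abs_of_nonneg (by linarith [this.1])]; exact this.2
    · refine LipschitzOnWith.of_dist_le_mul ?_
      rintro _ ⟨r, hr, rfl⟩ _ ⟨s, hs, rfl⟩
      rw [hψh, hψh, Real.dist_eq, Real.dist_eq]
      refine (E1 s r).trans (le_mul_of_one_le_left (abs_nonneg _) ?_)
      exact_mod_cast le_max_left _ _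
    · refine LipschitzOnWith.of_dist_le_mul ?_
      rintro _ ⟨r, hr, rfl⟩ _ ⟨s, hs, rfl⟩
      simp only [Function.comp_apply]
      rw [hψh, hψh, Real.dist_eq, Real.dist_eq]
      have k1 := hlow (β s) hs.2 (β r) hr.2
      rw [(hβ r (hsub (hBab hr.1))).2, (hβ s (hsub (hBab hs.1))).2] at k1
      have k2 := k1.trans (E2 s (hBab hs.1) r (hBab hr.1))
      have k3 : |β r - β s| ≤ (1 / c) * |h r - h s| := by
        rw [one_div, ← div_eq_inv_mul, le_div_iff₀ hc]; linarith
      refine k3.trans ?_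
      gcongr
      rw [NNReal.coe_max, Real.coe_toNNReal _ (by positivity)]
      exact le_max_right _ _
  refine measure_mono_null (t := {x : Euc n | x ≠ 0 ∧ ‖x‖ ∈ B ∧ (ang p x = 0 ∨ ang p x = Real.pi)} ∪
    ⋃ k, rotGraph p (h '' S k) ψ (β ∘ ψ)) ?_ (measure_union_null (axis_null hn hp hB) (measure_iUnion_null hk))
  rintro x ⟨hx, hxB, hang⟩
  by_cases hax : ang p x = 0 ∨ ang p x = Real.pi
  · exact Or.inl ⟨hx, hxB, hax⟩
  right
  push Not at hax
  have h0 : 0 < ang p x := lt_of_le_of_ne (ang_nonneg p x) (Ne.symm hax.1)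
  have h1 : ang p x < Real.pi := lt_of_le_of_ne (ang_le_pi p x) hax.2
  obtain ⟨k, hk⟩ := exists_nat_one_div_lt (lt_min h0 (sub_pos.mpr h1))
  refine mem_iUnion.mpr ⟨k, hx, h0, h1, h ‖x‖, ⟨‖x‖, ⟨hxB, ?_⟩, rfl⟩, (hψh _).symm, ?_⟩
  · change β ‖x‖ ∈ Icc (1 / ((k:ℝ) + 1)) (Real.pi - 1 / ((k:ℝ) + 1))
    rw [← hang]
    constructor
    · linarith [min_le_left (ang p x) (Real.pi - ang p x)]
    · linarith [min_le_right (ang p x) (Real.pi - ang p x)]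
  · simp only [Function.comp_apply]; rw [hψh, hang]

theorem W11_perim {n : ℕ} (hn : 2 ≤ n) {p : Euc n} (hp : ‖p‖ = 1) {α : ℝ → ℝ} (hα : Measurable α)
    (hαm : ∀ r, α r ∈ Icc (0:ℝ) Real.pi) {I : Set ℝ} (hI : IsOpen I) (hI0 : I ⊆ Ioi 0)
    (hW : W11locOn (fun r => Gf p (α r)) I) {B : Set ℝ} (hBI : B ⊆ I) (hB : volume B = 0) :
    perim (sphSymm n α p) (sphShell n B) = 0 := by
  obtain ⟨w, g, β, hβc, hβ, hae, hg, hw⟩ := rep_of_W11 hn hp hαm hI hW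
  have hq : ∀ q : {q : ℚ × ℚ // (q.1:ℝ) ≤ q.2 ∧ Icc (q.1:ℝ) q.2 ⊆ I}, μH[(n:ℝ) - 1]
      {x : Euc n | x ≠ 0 ∧ ‖x‖ ∈ B ∩ Icc (q.1.1:ℝ) q.1.2 ∧ ang p x = β ‖x‖} = 0 := by
    rintro ⟨⟨a, b⟩, hab, hsub⟩
    exact piece_null hn hp hβ hg hw (hI0 (hsub ⟨le_rfl, hab⟩)) hab hsub inter_subset_right
      (measure_mono_null inter_subset_left hB)
  refine measure_mono_null ?_ (measure_iUnion_null hq)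
  rintro x ⟨hx, hx0, hxB⟩
  obtain ⟨a, b, hab, hsub⟩ := nbhd_Icc hI (hBI hxB)
  refine mem_iUnion.mpr ⟨⟨(a, b), by linarith [hab.1, hab.2], hsub⟩, hx0, ⟨hxB, Ioo_subset_Icc_self hab⟩, ?_⟩
  exact D2 hn hα hI hae hx0 (hBI hxB) (hβc _ (hBI hxB)) hx

theorem W11_bad {n : ℕ} (hn : 2 ≤ n) {p : Euc n} (hp : ‖p‖ = 1) {α : ℝ → ℝ} (hα : Measurable α)
    (hαm : ∀ r, α r ∈ Icc (0:ℝ) Real.pi) {I : Set ℝ} (hI : IsOpen I) (hI0 : I ⊆ Ioi 0)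
    (hW : W11locOn (fun r => Gf p (α r)) I) :
    μH[(n:ℝ) - 1] {x : Euc n | x ∈ redBoundary (sphSymm n α p) ∩ sphShell n I ∧ nuPar (sphSymm n α p) x = 0} = 0 := by
  obtain ⟨w, g, β, hβc, hβ, hae, hg, hw⟩ := rep_of_W11 hn hp hαm hI hW
  have hdiff : ∀ᵐ r : ℝ, r ∈ I → HasDerivAt w (g r) r := by
    have : ∀ q : {q : ℚ × ℚ // (q.1:ℝ) ≤ q.2 ∧ Icc (q.1:ℝ) q.2 ⊆ I}, ∀ᵐ r : ℝ,
        r ∈ Ioo (q.1.1:ℝ) q.1.2 → HasDerivAt w (g r) r := by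
      rintro ⟨⟨a, b⟩, hab, hsub⟩
      refine deriv_ae hab ((hg _ _ hab hsub).mono_set Ioc_subset_Icc_self) fun x y hx hxy hy => hw x y ?_
      rw [uIcc_of_le hxy]; exact (Icc_subset_Icc hx hy).trans hsub
    filter_upwards [ae_all_iff.mpr this] with r hr hrI
    obtain ⟨a, b, hab, hsub⟩ := nbhd_Icc hI hrI
    exact hr ⟨(a, b), by linarith [hab.1, hab.2], hsub⟩ hab
  have hae' := (ae_restrict_iff' hI.measurableSet).mp hae
  have hgood : ∀ᵐ r : ℝ, r ∈ I → HasDerivAt w (g r) r ∧ β r = α r ∧ (¬ 0 < α r → D0 {s | 0 < α s} r) ∧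
      (¬ α r < Real.pi → D0 {s | α s < Real.pi} r) := by
    filter_upwards [hdiff, hae', D0_ae (measurableSet_lt measurable_const hα : MeasurableSet {s | 0 < α s}),
      D0_ae (measurableSet_lt hα measurable_const : MeasurableSet {s | α s < Real.pi})] with r h1 h2 h3 h4 hr
    exact ⟨h1 hr, h2 hr, h3, h4⟩
  set N := {r : ℝ | r ∈ I ∧ ¬ (HasDerivAt w (g r) r ∧ β r = α r ∧ (¬ 0 < α r → D0 {s | 0 < α s} r) ∧
      (¬ α r < Real.pi → D0 {s | α s < Real.pi} r))} with hNdef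
  have hN : volume N = 0 := by
    refine measure_mono_null ?_ (ae_iff.mp hgood)
    exact fun r hr h => hr.2 (h hr.1)
  refine measure_mono_null ?_ (W11_perim hn hp hα hαm hI hI0 hW (B := N) (fun r hr => hr.1) hN)
  rintro x ⟨⟨hxr, hx0, hxI⟩, hpar⟩
  have hmeas := measurableSet_sphSymm hα p
  have hrad := (bad_iff hn hx0).mp ⟨hxr, hpar⟩
  have hess : x ∈ essBoundary (sphSymm n α p) := hrad.elim (red_sub_ess hn hmeas) (red_sub_ess hn hmeas)
  refine ⟨hess, hx0, hxI, ?_⟩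
  rintro ⟨g1, g2, g3, g4⟩
  have hang := D2 hn hα hI hae hx0 hxI (hβc _ hxI) hess
  by_cases p0 : 0 < α ‖x‖
  swap
  · exact hess.1 ((dens0_iff hn).mpr (D5c hn hα hx0 (g3 p0)))
  by_cases p1 : α ‖x‖ < Real.pi
  swap
  · exact hess.2 ((dens1_iff hn hmeas).mpr (D5b hn hp hα hx0 (g4 p1)))
  rw [← g2] at p0 p1
  set ε := min (β ‖x‖) (Real.pi - β ‖x‖) / 2 with hε
  have hεp : 0 < ε := half_pos (lt_min p0 (sub_pos.mpr p1))
  have l1 := min_le_left (β ‖x‖) (Real.pi - β ‖x‖)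
  have l2 := min_le_right (β ‖x‖) (Real.pi - β ‖x‖)
  obtain ⟨c, hc, hlow⟩ := Gf_lower_abs hn hp hεp
  obtain ⟨K, hK, hbig⟩ := g1.hasFDerivAt.isBigO_sub.exists_pos
  rw [Asymptotics.isBigOWith_iff] at hbig
  have hnear : ∀ᶠ s in 𝓝 ‖x‖, β s ∈ Icc ε (Real.pi - ε) :=
    (hβc _ hxI).eventually_mem (Icc_mem_nhds (by linarith) (by linarith))
  refine no_radial hn hp hI hae hx0 hxI (by rw [hang]; exact p0) (by rw [hang]; exact p1) hang.symm
    (Λ := K / c) (by positivity) ?_ hrad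
  filter_upwards [hbig, hnear, hI.mem_nhds hxI] with s h1 h2 h3
  have k := hlow (β ‖x‖) ⟨by linarith, by linarith⟩ (β s) h2
  rw [(hβ _ h3).2, (hβ _ hxI).2] at k
  rw [Real.norm_eq_abs, Real.norm_eq_abs] at h1
  rw [div_mul_eq_mul_div, le_div_iff₀ hc]
  linarith


/-! ## Part 15 -/
open MeasureTheory Metric Set Filter
open scoped ENNReal NNReal Topology RealInnerProductSpace

lemma norm_e1 (n : ℕ) (hn : 0 < n) : ‖e1 n hn‖ = 1 := by
  unfold e1; simp

lemma W11_congr {f f' : ℝ → ℝ} {I : Set ℝ} (h : ∀ᵐ r ∂(volume.restrict I), f r = f' r) (hW : W11locOn f I) :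
    W11locOn f' I := by
  obtain ⟨w, g, h1, h2, h3⟩ := hW
  refine ⟨w, g, ?_, h2, h3⟩
  filter_upwards [h, h1] with r k1 k2
  rw [k2, k1]

/-- The vanishing of the radial part gives the null property of radial normals. -/
lemma QP_of_bad {n : ℕ} (hn : 2 ≤ n) {p : Euc n} {α : ℝ → ℝ} {I : Set ℝ}
    (h : μH[(n : ℝ) - 1] {x : Euc n | x ∈ redBoundary (sphSymm n α p) ∩ sphShell n I ∧
      nuPar (sphSymm n α p) x = 0} = 0) : QP n p α I := by
  intro D hD _
  refine measure_mono_null ?_ h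
  rintro x ⟨hx, hxD, hrad⟩
  obtain ⟨h1, h2⟩ := (bad_iff hn hx).mpr hrad
  exact ⟨⟨h1, hx, hD hxD⟩, h2⟩

lemma QP_of_perim {n : ℕ} (hn : 2 ≤ n) {p : Euc n} {α : ℝ → ℝ} (hα : Measurable α) {I : Set ℝ} (hI : IsOpen I)
    (h : ∀ B : Set ℝ, MeasurableSet B → B ⊆ I → μH[(1:ℝ)] B = 0 →
        perim (sphSymm n α p) (sphShell n B) = 0) : QP n p α I := by
  intro D hD hD0
  have hq := h (toMeasurable volume D ∩ I) ((measurableSet_toMeasurable _ _).inter hI.measurableSet)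
    inter_subset_right (by
      rw [hausdorffMeasure_real]
      refine measure_mono_null inter_subset_left ?_
      rw [measure_toMeasurable, hD0])
  refine measure_mono_null ?_ hq
  rintro x ⟨hx, hxD, hrad⟩
  have hmeas := measurableSet_sphSymm hα p
  exact ⟨hrad.elim (red_sub_ess hn hmeas) (red_sub_ess hn hmeas), hx, subset_toMeasurable _ _ hxD, hD hxD⟩

/-- **Proposition 5.3.** For an open `I ⊆ (0,∞)` the following are equivalent:
(i) `H^{n-1}({x ∈ ∂*F_v ∩ Φ(I×S^{n-1}) : ν∥^{F_v}(x) = 0}) = 0`;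
(ii) `ξ_v ∈ W^{1,1}_loc(I)`;
(iii) `P(F_v; Φ(B×S^{n-1})) = 0` for every Borel `B ⊆ I` with `H¹(B) = 0`. -/
theorem symmetral_tangential_characterisation
    (n : ℕ) (hn : 2 ≤ n)
    (v : ℝ → ℝ) (hv_meas : Measurable v) (hv_nonneg : ∀ r ∈ Ioi (0:ℝ), 0 ≤ v r)
    (hv_le : ∀ᵐ r ∂(volume.restrict (Ioi (0:ℝ))),
      v r ≤ (n : ℝ) * omegaBall n * r ^ (n - 1))
    (α : ℝ → ℝ) (hα_meas : Measurable α) (hα_mem : ∀ r, α r ∈ Icc (0:ℝ) Real.pi)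
    (hα : ∀ᵐ r ∂(volume.restrict (Ioi (0:ℝ))),
      μH[(n : ℝ) - 1] (capSet (e1 n (by omega)) r (α r)) = ENNReal.ofReal (v r))
    (hF_perim : perim (sphSymm n α (e1 n (by omega))) univ < ⊤)
    (hF_vol : volume (sphSymm n α (e1 n (by omega))) < ⊤)
    (I : Set ℝ) (hI_open : IsOpen I) (hI_sub : I ⊆ Ioi (0:ℝ)) :
    ((μH[(n : ℝ) - 1] {x : Euc n | x ∈ redBoundary (sphSymm n α (e1 n (by omega))) ∩ sphShell n I ∧ nuPar (sphSymm n α (e1 n (by omega))) x = 0} = 0) ↔ W11locOn (fun r => v r / r ^ (n - 1)) I) ∧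
    (W11locOn (fun r => v r / r ^ (n - 1)) I ↔
      ∀ B : Set ℝ, MeasurableSet B → B ⊆ I → μH[(1:ℝ)] B = 0 →
        perim (sphSymm n α (e1 n (by omega))) (sphShell n B) = 0) := by
  have hp : ‖e1 n (by omega)‖ = 1 := norm_e1 n (by omega)
  have hξ : ∀ᵐ r ∂(volume.restrict I), Gf (e1 n (by omega)) (α r) = v r / r ^ (n - 1) := by
    have h1 := ae_restrict_of_ae_restrict_of_subset hI_sub hα
    filter_upwards [h1, ae_restrict_mem hI_open.measurableSet] with r hr hrI
    have hr0 : 0 < r := hI_sub hrI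
    rw [cap_scale hn hp hr0] at hr
    have hG : 0 ≤ Gf (e1 n (by omega)) (α r) := ENNReal.toReal_nonneg
    have h2 := (ENNReal.ofReal_eq_ofReal_iff (by positivity) (hv_nonneg r hr0)).mp hr
    rw [eq_div_iff (by positivity), ← h2]
    ring
  have hξ2 : ∀ᵐ r ∂(volume.restrict I), v r / r ^ (n - 1) = Gf (e1 n (by omega)) (α r) := by
    filter_upwards [hξ] with r hr using hr.symm
  have key : QP n (e1 n (by omega)) α I → W11locOn (fun r => v r / r ^ (n - 1)) I := fun hQ =>
    W11_congr hξ (QP_W11 hn hp hα_meas hα_mem hF_perim hI_open hI_sub hQ)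
  refine ⟨⟨fun h => key (QP_of_bad hn h), fun h =>
    W11_bad hn hp hα_meas hα_mem hI_open hI_sub (W11_congr hξ2 h)⟩,
    ⟨fun h B _ hBI hB => ?_, fun h => key (QP_of_perim hn hα_meas hI_open h)⟩⟩
  rw [hausdorffMeasure_real] at hB
  exact W11_perim hn hp hα_meas hα_mem hI_open hI_sub (W11_congr hξ2 h) hBI hB
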